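/- Let β ∈ (0, 1] and let X and Y be independent random variables with values in separable metric spaces (𝒳, d) and (𝒴, d) which are of negative type, with 𝒳 × 𝒴 σ-compact. Let Z := (X, Y), θ := L(Z), and θₙ the empirical measure of Z₁, ..., Zₙ, where (Z_k)_{k∈ℕ} is strictly stationary with L(Z₁) = θ. If X and Y have finite (1+ε)β-moments for some ε > 0 and (Z_k) is absolutely regular with β(n) = O(n^{-r}) for some r > 6(1 + 2ε^{-1}), then n·dcov_β(θₙ) converges in distribution to Σْ_{k=1}^∞ λ_k ζ_k², where (λ_k, φ_k) are the non-negative eigenvalue/eigenfunction pairs of the integral operator f ↦ ∫ δ_θ^{(β)}(·, z) f(z) dθ(z) on L²(θ) and (ζ_k) are centered Gaussian variables with Cov(ζ_i, ζ_j) = lim_n n^{-1} Σ_{t,u=1}^n Cov(φ_i(Z_t), φ_j(Z_u)). -/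

import Mathlib

open MeasureTheory Filter Topology ProbabilityTheory
open scoped ENNReal NNReal

noncomputable section

/-- The shift map on path space. -/
def shift {𝒵 : Type*} (x : ℕ → 𝒵) : ℕ → 𝒵 := fun i => x (i + 1)

/-- Empirical measure of `Z₁, …, Zₙ` (indexed here as `Z 0, …, Z (n-1)`). -/
def emp {Ω 𝒵 : Type*} [MeasurableSpace 𝒵] (Z : ℕ → Ω → 𝒵) (n : ℕ) (ω : Ω) : Measure 𝒵 :=
  (n : ℝ≥0∞)⁻¹ • ∑ k ∈ Finset.range n, Measure.dirac (Z k ω)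

/-- `a_μ(x) = ∫ ρ(x,x') dμ(x')`. -/
def aM {X : Type*} [MeasurableSpace X] (ρ : X → X → ℝ) (μ : Measure X) (x : X) : ℝ :=
  ∫ x', ρ x x' ∂μ

/-- `D(μ) = ∫ ρ(x,x') dμ²(x,x')`. -/
def DM {X : Type*} [MeasurableSpace X] (ρ : X → X → ℝ) (μ : Measure X) : ℝ :=
  ∫ p : X × X, ρ p.1 p.2 ∂(μ.prod μ)

/-- `d_μ(x,x') = ρ(x,x') - a_μ(x) - a_μ(x') + D(μ)`. -/
def dM {X : Type*} [MeasurableSpace X] (ρ : X → X → ℝ) (μ : Measure X) (x x' : X) : ℝ :=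
  ρ x x' - aM ρ μ x - aM ρ μ x' + DM ρ μ

/-- `δ_θ(z,z') = d_μ(x,x') d_ν(y,y')` where `μ, ν` are the marginals of `θ`. -/
def deltaTheta {X Y : Type*} [MeasurableSpace X] [MeasurableSpace Y]
    (ρX : X → X → ℝ) (ρY : Y → Y → ℝ) (θ : Measure (X × Y)) (z z' : X × Y) : ℝ :=
  dM ρX (θ.map Prod.fst) z.1 z'.1 * dM ρY (θ.map Prod.snd) z.2 z'.2

/-- The distance covariance `dcov(θ) = ∫ δ_θ dθ²` w.r.t. the (pseudo)metrics `ρX, ρY`;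
for `ρX = dX^β`, `ρY = dY^β` this is `dcov_β(θ)`. -/
def dcov {X Y : Type*} [MeasurableSpace X] [MeasurableSpace Y]
    (ρX : X → X → ℝ) (ρY : Y → Y → ℝ) (θ : Measure (X × Y)) : ℝ :=
  ∫ p : (X × Y) × (X × Y), deltaTheta ρX ρY θ p.1 p.2 ∂(θ.prod θ)

/-- The `β`-dependence (absolute regularity) coefficient of two sub-σ-algebras. -/
def betaDep {Ω : Type*} [MeasurableSpace Ω] (P : Measure Ω)
    (A B : MeasurableSpace Ω) : ℝ :=
  sSup {r | ∃ (I J : ℕ) (a : Fin I → Set Ω) (b : Fin J → Set Ω),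
    (∀ i, MeasurableSet[A] (a i)) ∧ (∀ j, MeasurableSet[B] (b j)) ∧
    Pairwise (Function.onFun Disjoint a) ∧ Pairwise (Function.onFun Disjoint b) ∧
    (⋃ i, a i) = Set.univ ∧ (⋃ j, b j) = Set.univ ∧
    r = (1 / 2) * ∑ i, ∑ j,
      |(P (a i ∩ b j)).toReal - (P (a i)).toReal * (P (b j)).toReal|}

/-- The σ-algebra generated by `Z 0, …, Z (l-1)`, i.e. by `Z₁, …, Z_l`. -/
def sigmaUpTo {Ω 𝒵 : Type*} [m𝒵 : MeasurableSpace 𝒵] (Z : ℕ → Ω → 𝒵) (l : ℕ) :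
    MeasurableSpace Ω :=
  ⨆ i ∈ Finset.range l, MeasurableSpace.comap (Z i) m𝒵

/-- The σ-algebra generated by `Z l, Z (l+1), …`. -/
def sigmaFrom {Ω 𝒵 : Type*} [m𝒵 : MeasurableSpace 𝒵] (Z : ℕ → Ω → 𝒵) (l : ℕ) :
    MeasurableSpace Ω :=
  ⨆ i ∈ {i : ℕ | l ≤ i}, MeasurableSpace.comap (Z i) m𝒵

/-- The β-mixing coefficient `β(n) = sup_l β(σ(Z₁,…,Z_l), σ(Z_{l+n}, …))`. -/
def betaProc {Ω 𝒵 : Type*} [MeasurableSpace Ω] [MeasurableSpace 𝒵]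
    (P : Measure Ω) (Z : ℕ → Ω → 𝒵) (n : ℕ) : ℝ :=
  sSup {r | ∃ l : ℕ, r = betaDep P (sigmaUpTo Z (l + 1)) (sigmaFrom Z (l + n))}




lemma betaDep_bddAbove {Ω : Type*} (A B : MeasurableSpace Ω) [mΩ : MeasurableSpace Ω]
    (P : Measure Ω) [IsProbabilityMeasure P] (hA : A ≤ mΩ) (hB : B ≤ mΩ) :
    ∀ r ∈ {r | ∃ (I J : ℕ) (a : Fin I → Set Ω) (b : Fin J → Set Ω),
    (∀ i, MeasurableSet[A] (a i)) ∧ (∀ j, MeasurableSet[B] (b j)) ∧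
    Pairwise (Function.onFun Disjoint a) ∧ Pairwise (Function.onFun Disjoint b) ∧
    (⋃ i, a i) = Set.univ ∧ (⋃ j, b j) = Set.univ ∧
    r = (1 / 2) * ∑ i, ∑ j,
      |(P (a i ∩ b j)).toReal - (P (a i)).toReal * (P (b j)).toReal|}, r ≤ 1 := by
  rintro r ⟨I, J, a, b, ha, hb, hda, hdb, hua, hub, rfl⟩
  have ha' : ∀ i, MeasurableSet (a i) := fun i => hA _ (ha i)
  have hb' : ∀ i, MeasurableSet (b i) := fun i => hB _ (hb i)
  have s1 : ∑ i, P.real (a i) = 1 := by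
    rw [← measureReal_iUnion_fintype hda ha', hua]; simp
  have s2 : ∑ j, P.real (b j) = 1 := by
    rw [← measureReal_iUnion_fintype hdb hb', hub]; simp
  have s3 : ∀ i, ∑ j, P.real (a i ∩ b j) = P.real (a i) := by
    intro i
    rw [← measureReal_iUnion_fintype (f := fun j => a i ∩ b j) (fun x y hxy => (hdb hxy).mono inf_le_right inf_le_right)
      (fun j => (ha' i).inter (hb' j)), ← Set.inter_iUnion, hub, Set.inter_univ]
  have : ∑ i, ∑ j, |(P (a i ∩ b j)).toReal - (P (a i)).toReal * (P (b j)).toReal| ≤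
      ∑ i, ∑ j, (P.real (a i ∩ b j) + P.real (a i) * P.real (b j)) := by
    gcongr with i _ j _
    refine (abs_sub _ _).trans ?_
    rw [abs_of_nonneg ENNReal.toReal_nonneg, abs_of_nonneg (by positivity)]
    rfl
  simp only [Finset.sum_add_distrib, s3, ← Finset.mul_sum, s2, mul_one, s1] at this
  linarith

lemma betaDep_nonneg {Ω : Type*} (A B : MeasurableSpace Ω) [mΩ : MeasurableSpace Ω]
    (P : Measure Ω) : 0 ≤ betaDep P A B := by
  apply Real.sSup_nonneg
  rintro r ⟨I, J, a, b, ha, hb, hda, hdb, hua, hub, rfl⟩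
  positivity

lemma betaDep_le_one {Ω : Type*} (A B : MeasurableSpace Ω) [mΩ : MeasurableSpace Ω]
    (P : Measure Ω) [IsProbabilityMeasure P] (hA : A ≤ mΩ) (hB : B ≤ mΩ) : betaDep P A B ≤ 1 :=
  Real.sSup_le (betaDep_bddAbove A B P hA hB) zero_le_one

lemma le_betaDep {Ω : Type*} (A B : MeasurableSpace Ω) [mΩ : MeasurableSpace Ω]
    (P : Measure Ω) [IsProbabilityMeasure P] (hA : A ≤ mΩ) (hB : B ≤ mΩ) {ι κ : Type*} [Fintype ι] [Fintype κ]
    (a : ι → Set Ω) (b : κ → Set Ω)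
    (ha : ∀ i, MeasurableSet[A] (a i)) (hb : ∀ j, MeasurableSet[B] (b j))
    (hda : Pairwise (Function.onFun Disjoint a)) (hdb : Pairwise (Function.onFun Disjoint b))
    (hua : (⋃ i, a i) = Set.univ) (hub : (⋃ j, b j) = Set.univ) :
    ∑ i, ∑ j, |P.real (a i ∩ b j) - P.real (a i) * P.real (b j)| ≤ 2 * betaDep P A B := by
  let e := Fintype.equivFin ι
  let f := Fintype.equivFin κ
  have : (1/2) * ∑ i, ∑ j, |P.real (a i ∩ b j) - P.real (a i) * P.real (b j)| ≤ betaDep P A B := by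
    apply le_csSup ⟨1, betaDep_bddAbove A B P hA hB⟩
    refine ⟨_, _, a ∘ e.symm, b ∘ f.symm, fun i => ha _, fun j => hb _, ?_, ?_, ?_, ?_, ?_⟩
    · exact fun x y hxy => hda (e.symm.injective.ne hxy)
    · exact fun x y hxy => hdb (f.symm.injective.ne hxy)
    · rw [← hua]; exact e.symm.surjective.iUnion_comp a
    · rw [← hub]; exact f.symm.surjective.iUnion_comp b
    · rw [← e.symm.sum_comp]
      congr 1
      refine Finset.sum_congr rfl fun i _ => ?_
      rw [← f.symm.sum_comp]
      rfl
  linarith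

/-- covariance inequality for simple functions -/
lemma beta_cov_simple {Ω : Type*} (A B : MeasurableSpace Ω) [mΩ : MeasurableSpace Ω]
    (P : Measure Ω) [IsProbabilityMeasure P] (hA : A ≤ mΩ) (hB : B ≤ mΩ)
    {E F G : Type*} [NormedAddCommGroup E] [NormedSpace ℝ E] [NormedAddCommGroup F]
    [NormedSpace ℝ F] [NormedAddCommGroup G] [NormedSpace ℝ G] [CompleteSpace E] [CompleteSpace F]
    [CompleteSpace G]
    (L : E →L[ℝ] F →L[ℝ] G) (hL : ‖L‖ ≤ 1) (f : Ω → E) (g : Ω → F)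
    (hfr : (Set.range f).Finite) (hgr : (Set.range g).Finite)
    (hfm : ∀ x, MeasurableSet[A] (f ⁻¹' {x})) (hgm : ∀ x, MeasurableSet[B] (g ⁻¹' {x}))
    (M N : ℝ) (hf : ∀ ω, ‖f ω‖ ≤ M) (hg : ∀ ω, ‖g ω‖ ≤ N) :
    ‖∫ ω, L (f ω) (g ω) ∂P - L (∫ ω, f ω ∂P) (∫ ω, g ω ∂P)‖ ≤ 2 * betaDep P A B * (M * N) := by
  classical
  have rf : ∀ ω, f ω ∈ hfr.toFinset := fun ω => by simp
  have rg : ∀ ω, g ω ∈ hgr.toFinset := fun ω => by simp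
  let a : hfr.toFinset → Set Ω := fun x => f ⁻¹' {x.1}
  let b : hgr.toFinset → Set Ω := fun x => g ⁻¹' {x.1}
  have ha : ∀ i, MeasurableSet[A] (a i) := fun i => hfm _
  have hb : ∀ i, MeasurableSet[B] (b i) := fun i => hgm _
  have ha' : ∀ i, MeasurableSet (a i) := fun i => hA _ (ha i)
  have hb' : ∀ i, MeasurableSet (b i) := fun i => hB _ (hb i)
  have hda : Pairwise (Function.onFun Disjoint a) := by
    intro x y hxy
    refine Set.disjoint_left.2 fun ω h1 h2 => hxy (Subtype.ext ?_)
    exact (Set.mem_singleton_iff.1 h1).symm.trans (Set.mem_singleton_iff.1 h2)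
  have hdb : Pairwise (Function.onFun Disjoint b) := by
    intro x y hxy
    refine Set.disjoint_left.2 fun ω h1 h2 => hxy (Subtype.ext ?_)
    exact (Set.mem_singleton_iff.1 h1).symm.trans (Set.mem_singleton_iff.1 h2)
  have hua : (⋃ i, a i) = Set.univ := by
    refine Set.eq_univ_of_forall fun ω => Set.mem_iUnion.2 ⟨⟨f ω, rf ω⟩, rfl⟩
  have hub : (⋃ i, b i) = Set.univ := by
    refine Set.eq_univ_of_forall fun ω => Set.mem_iUnion.2 ⟨⟨g ω, rg ω⟩, rfl⟩
  have key := le_betaDep A B P hA hB a b ha hb hda hdb hua hub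
  have ef : ∀ ω, f ω = ∑ i, (a i).indicator (fun _ => i.1) ω := by
    intro ω
    rw [Finset.sum_eq_single ⟨f ω, rf ω⟩]
    · rw [Set.indicator_of_mem]; rfl
    · intro i _ hi
      rw [Set.indicator_of_notMem]
      intro h; apply hi; exact Subtype.ext h.symm
    · simp
  have eg : ∀ ω, g ω = ∑ i, (b i).indicator (fun _ => i.1) ω := by
    intro ω
    rw [Finset.sum_eq_single ⟨g ω, rg ω⟩]
    · rw [Set.indicator_of_mem]; rfl
    · intro i _ hi
      rw [Set.indicator_of_notMem]
      intro h; apply hi; exact Subtype.ext h.symm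
    · simp
  have efg : ∀ ω, L (f ω) (g ω) = ∑ i, ∑ j, (a i ∩ b j).indicator (fun _ => L i.1 j.1) ω := by
    intro ω
    rw [ef ω, eg ω]
    simp only [map_sum, FunLike.coe_sum, Finset.sum_apply]
    rw [Finset.sum_comm]
    refine Finset.sum_congr rfl fun i _ => Finset.sum_congr rfl fun j _ => ?_
    by_cases h1 : ω ∈ a i <;> by_cases h2 : ω ∈ b j <;> simp [Set.indicator, h1, h2]
  have i1 : ∫ ω, f ω ∂P = ∑ i, P.real (a i) • i.1 := by
    simp_rw [ef]
    rw [integral_finsetSum]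
    · simp_rw [integral_indicator_const _ (ha' _)]
    · intro i _; exact (integrable_const _).indicator (ha' i)
  have i2 : ∫ ω, g ω ∂P = ∑ i, P.real (b i) • i.1 := by
    simp_rw [eg]
    rw [integral_finsetSum]
    · simp_rw [integral_indicator_const _ (hb' _)]
    · intro i _; exact (integrable_const _).indicator (hb' i)
  have i3 : ∫ ω, L (f ω) (g ω) ∂P = ∑ i, ∑ j, P.real (a i ∩ b j) • L i.1 j.1 := by
    simp_rw [efg]
    rw [integral_finsetSum]
    · refine Finset.sum_congr rfl fun i _ => ?_
      rw [integral_finsetSum]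
      · simp_rw [integral_indicator_const _ ((ha' i).inter (hb' _))]
      · intro j _; exact (integrable_const _).indicator ((ha' i).inter (hb' j))
    · intro i _
      refine integrable_finsetSum _ fun j _ => ?_
      exact (integrable_const _).indicator ((ha' i).inter (hb' j))
  have i4 : L (∫ ω, f ω ∂P) (∫ ω, g ω ∂P) = ∑ i, ∑ j, (P.real (a i) * P.real (b j)) • L i.1 j.1 := by
    rw [i1, i2]
    simp only [map_sum, FunLike.coe_sum, Finset.sum_apply, map_smul, FunLike.coe_smul, Pi.smul_apply,
      Finset.smul_sum]
    rw [Finset.sum_comm]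
    refine Finset.sum_congr rfl fun i _ => Finset.sum_congr rfl fun j _ => ?_
    rw [smul_smul, mul_comm]
  rw [i3, i4]
  simp only [← Finset.sum_sub_distrib, ← sub_smul]
  calc _ ≤ ∑ i, ∑ j, |P.real (a i ∩ b j) - P.real (a i) * P.real (b j)| * (M * N) := by
        refine (norm_sum_le _ _).trans (Finset.sum_le_sum fun i _ => (norm_sum_le _ _).trans
          (Finset.sum_le_sum fun j _ => ?_))
        rw [norm_smul, Real.norm_eq_abs]
        obtain ⟨ω, hω⟩ := hfr.mem_toFinset.1 i.2
        obtain ⟨ω', hω'⟩ := hgr.mem_toFinset.1 j.2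
        have h1 : ‖i.1‖ ≤ M := hω ▸ hf ω
        have h2 : ‖j.1‖ ≤ N := hω' ▸ hg ω'
        gcongr
        refine (L.le_opNorm₂ _ _).trans ?_
        calc ‖L‖ * ‖i.1‖ * ‖j.1‖ ≤ 1 * M * N := by gcongr; linarith [norm_nonneg i.1]
          _ = M * N := by ring
    _ ≤ _ := by
        simp only [← Finset.sum_mul]
        have : 0 ≤ M * N := by
          obtain ⟨ω⟩ := nonempty_of_isProbabilityMeasure P
          exact mul_nonneg ((norm_nonneg _).trans (hf ω)) ((norm_nonneg _).trans (hg ω))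
        gcongr

/-- covariance inequality for bounded functions -/
lemma beta_cov {Ω : Type*} (A B : MeasurableSpace Ω) [mΩ : MeasurableSpace Ω]
    (P : Measure Ω) [IsProbabilityMeasure P] (hA : A ≤ mΩ) (hB : B ≤ mΩ)
    {E F G : Type*} [NormedAddCommGroup E] [NormedSpace ℝ E] [NormedAddCommGroup F]
    [NormedSpace ℝ F] [NormedAddCommGroup G] [NormedSpace ℝ G] [CompleteSpace E] [CompleteSpace F]
    [CompleteSpace G]
    (L : E →L[ℝ] F →L[ℝ] G) (hL : ‖L‖ ≤ 1) (f : Ω → E) (g : Ω → F)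
    (hfm : StronglyMeasurable[A] f) (hgm : StronglyMeasurable[B] g)
    (M N : ℝ) (hf : ∀ ω, ‖f ω‖ ≤ M) (hg : ∀ ω, ‖g ω‖ ≤ N) :
    ‖∫ ω, L (f ω) (g ω) ∂P - L (∫ ω, f ω ∂P) (∫ ω, g ω ∂P)‖ ≤ 2 * betaDep P A B * (M * N) := by
  obtain ⟨ω₀⟩ := nonempty_of_isProbabilityMeasure P
  have hM : 0 ≤ M := (norm_nonneg _).trans (hf ω₀)
  have hN : 0 ≤ N := (norm_nonneg _).trans (hg ω₀)
  let fn := fun n => hfm.approxBounded M n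
  let gn := fun n => hgm.approxBounded N n
  have bf : ∀ n ω, ‖fn n ω‖ ≤ M := fun n ω => hfm.norm_approxBounded_le hM n ω
  have bg : ∀ n ω, ‖gn n ω‖ ≤ N := fun n ω => hgm.norm_approxBounded_le hN n ω
  have tf : ∀ ω, Tendsto (fun n => fn n ω) atTop (𝓝 (f ω)) :=
    fun ω => hfm.tendsto_approxBounded_of_norm_le (hf ω)
  have tg : ∀ ω, Tendsto (fun n => gn n ω) atTop (𝓝 (g ω)) :=
    fun ω => hgm.tendsto_approxBounded_of_norm_le (hg ω)
  have mf : ∀ n, StronglyMeasurable (fn n) := fun n =>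
    (@SimpleFunc.stronglyMeasurable _ _ A _ (fn n)).mono hA
  have mg : ∀ n, StronglyMeasurable (gn n) := fun n =>
    (@SimpleFunc.stronglyMeasurable _ _ B _ (gn n)).mono hB
  have l1 : Tendsto (fun n => ∫ ω, fn n ω ∂P) atTop (𝓝 (∫ ω, f ω ∂P)) :=
    tendsto_integral_of_dominated_convergence (fun _ => M) (fun n => (mf n).aestronglyMeasurable)
      (integrable_const _) (fun n => .of_forall (bf n)) (.of_forall tf)
  have l2 : Tendsto (fun n => ∫ ω, gn n ω ∂P) atTop (𝓝 (∫ ω, g ω ∂P)) :=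
    tendsto_integral_of_dominated_convergence (fun _ => N) (fun n => (mg n).aestronglyMeasurable)
      (integrable_const _) (fun n => .of_forall (bg n)) (.of_forall tg)
  have cL : Continuous (fun p : E × F => L p.1 p.2) := by fun_prop
  have l3 : Tendsto (fun n => ∫ ω, L (fn n ω) (gn n ω) ∂P) atTop (𝓝 (∫ ω, L (f ω) (g ω) ∂P)) := by
    refine tendsto_integral_of_dominated_convergence (fun _ => M * N)
      (fun n => (cL.comp_stronglyMeasurable ((mf n).prodMk (mg n))).aestronglyMeasurable)
      (integrable_const _) (fun n => .of_forall fun ω => ?_) (.of_forall fun ω => ?_)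
    · refine (L.le_opNorm₂ _ _).trans ?_
      calc ‖L‖ * ‖fn n ω‖ * ‖gn n ω‖ ≤ 1 * M * N := by
            gcongr
            · exact bf n ω
            · exact bg n ω
        _ = M * N := by ring
    · exact (cL.tendsto (f ω, g ω)).comp ((tf ω).prodMk_nhds (tg ω))
  have l4 : Tendsto (fun n => L (∫ ω, fn n ω ∂P) (∫ ω, gn n ω ∂P)) atTop
      (𝓝 (L (∫ ω, f ω ∂P) (∫ ω, g ω ∂P))) := (cL.tendsto _).comp (l1.prodMk_nhds l2)
  exact le_of_tendsto (l3.sub l4).norm (.of_forall fun n =>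
    beta_cov_simple A B P hA hB L hL (fn n) (gn n)
      (@SimpleFunc.finite_range _ _ A (fn n)) (@SimpleFunc.finite_range _ _ B (gn n))
      (@SimpleFunc.measurableSet_fiber _ _ A (fn n)) (@SimpleFunc.measurableSet_fiber _ _ B (gn n)) M N (bf n) (bg n))



/-- truncation -/
def trunc {E : Type*} [NormedAddCommGroup E] (M : ℝ) (x : E) : E := by
  classical exact if ‖x‖ ≤ M then x else 0

lemma trunc_of_le {E : Type*} [NormedAddCommGroup E] {M : ℝ} {x : E} (h : ‖x‖ ≤ M) :
    trunc M x = x := by simp [trunc, h]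

lemma trunc_of_gt {E : Type*} [NormedAddCommGroup E] {M : ℝ} {x : E} (h : ¬ ‖x‖ ≤ M) :
    trunc M x = 0 := by simp [trunc, h]

lemma norm_trunc_le {E : Type*} [NormedAddCommGroup E] {M : ℝ} (hM : 0 ≤ M) (x : E) :
    ‖trunc M x‖ ≤ M := by
  by_cases h : ‖x‖ ≤ M
  · rwa [trunc_of_le h]
  · rw [trunc_of_gt h]; simpa

lemma norm_trunc_le_self {E : Type*} [NormedAddCommGroup E] {M : ℝ} (x : E) :
    ‖trunc M x‖ ≤ ‖x‖ := by
  by_cases h : ‖x‖ ≤ M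
  · rw [trunc_of_le h]
  · rw [trunc_of_gt h]; simp

lemma norm_sub_trunc_le_self {E : Type*} [NormedAddCommGroup E] {M : ℝ} (x : E) :
    ‖x - trunc M x‖ ≤ ‖x‖ := by
  by_cases h : ‖x‖ ≤ M
  · rw [trunc_of_le h]; simp
  · rw [trunc_of_gt h]; simp

lemma stronglyMeasurable_trunc {E : Type*} [NormedAddCommGroup E] {M : ℝ} {α : Type*}
    {m : MeasurableSpace α} {f : α → E} (hf : StronglyMeasurable[m] f) :
    StronglyMeasurable[m] (fun x => trunc M (f x)) := by
  unfold trunc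
  refine StronglyMeasurable.ite ?_ hf stronglyMeasurable_const
  exact measurableSet_le hf.norm.measurable measurable_const

lemma aux_pow_gt {M ε c : ℝ} (hM : 1 ≤ M) (hε : 0 < ε) (hc : M < c) :
    c ^ 2 ≤ c ^ (2 + 2 * ε) * M ^ (-(2 * ε)) := by
  have hc0 : 0 < c := by linarith
  rw [Real.rpow_add hc0, mul_assoc, Real.rpow_neg (by linarith), ← div_eq_mul_inv]
  have h1 : M ^ (2 * ε) ≤ c ^ (2 * ε) := Real.rpow_le_rpow (by linarith) hc.le (by positivity)
  have h2 : 0 < M ^ (2 * ε) := by positivity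
  have : 1 ≤ c ^ (2 * ε) / M ^ (2 * ε) := by rwa [one_le_div h2]
  have h3 : c ^ (2:ℝ) = c ^ 2 := by norm_cast
  rw [h3]
  nlinarith [sq_nonneg c]

lemma sq_le_one_add_rpow {ε c : ℝ} (hε : 0 < ε) (hc : 0 ≤ c) :
    c ^ 2 ≤ 1 + c ^ (2 + 2 * ε) := by
  by_cases h : c ≤ 1
  · have : 0 ≤ c ^ (2 + 2 * ε) := by positivity
    nlinarith
  · have := aux_pow_gt (M := 1) le_rfl hε (not_le.1 h)
    simp at this; linarith

lemma self_le_one_add_rpow {ε c : ℝ} (hε : 0 < ε) (hc : 0 ≤ c) :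
    c ≤ 1 + c ^ (2 + 2 * ε) := by
  by_cases h : c ≤ 1
  · have : 0 ≤ c ^ (2 + 2 * ε) := by positivity
    nlinarith
  · have := aux_pow_gt (M := 1) le_rfl hε (not_le.1 h)
    simp at this; nlinarith

lemma mul_le_rpow_add {ε a b : ℝ} (ha : 0 ≤ a) (hb : 0 ≤ b) :
    (max a b) ^ (2 + 2 * ε) ≤ a ^ (2 + 2 * ε) + b ^ (2 + 2 * ε) := by
  have h1 : 0 ≤ a ^ (2 + 2 * ε) := by positivity
  have h2 : 0 ≤ b ^ (2 + 2 * ε) := by positivity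
  rcases max_cases a b with ⟨h, _⟩ | ⟨h, _⟩ <;> rw [h] <;> linarith

lemma integrable_of_moment {Ω : Type*} [mΩ : MeasurableSpace Ω] {P : Measure Ω}
    [IsProbabilityMeasure P] {E : Type*} [NormedAddCommGroup E] {ε : ℝ} (hε : 0 < ε) {a : Ω → E}
    (ham : AEStronglyMeasurable a P) (ha : Integrable (fun ω => ‖a ω‖ ^ (2 + 2 * ε)) P) :
    Integrable a P := by
  refine Integrable.mono' ((integrable_const 1).add ha) ham (.of_forall fun ω => ?_)
  exact self_le_one_add_rpow hε (norm_nonneg _)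

lemma integrable_sq_of_moment {Ω : Type*} [mΩ : MeasurableSpace Ω] {P : Measure Ω}
    [IsProbabilityMeasure P] {E : Type*} [NormedAddCommGroup E] {ε : ℝ} (hε : 0 < ε) {a : Ω → E}
    (ham : AEStronglyMeasurable a P) (ha : Integrable (fun ω => ‖a ω‖ ^ (2 + 2 * ε)) P) :
    Integrable (fun ω => ‖a ω‖ ^ 2) P := by
  refine Integrable.mono' ((integrable_const 1).add ha) (ham.norm.pow 2) (.of_forall fun ω => ?_)
  rw [Real.norm_of_nonneg (by positivity)]
  exact sq_le_one_add_rpow hε (norm_nonneg _)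

lemma integrable_inner_of_sq {Ω : Type*} [mΩ : MeasurableSpace Ω] {P : Measure Ω}
    {E : Type*} [NormedAddCommGroup E] [InnerProductSpace ℝ E]
    {a b : Ω → E} (ham : AEStronglyMeasurable a P) (hbm : AEStronglyMeasurable b P)
    (ha : Integrable (fun ω => ‖a ω‖ ^ 2) P) (hb : Integrable (fun ω => ‖b ω‖ ^ 2) P) :
    Integrable (fun ω => inner ℝ (a ω) (b ω)) P := by
  refine Integrable.mono' (ha.add hb) (ham.inner hbm) (.of_forall fun ω => ?_)
  refine (norm_inner_le_norm _ _).trans ?_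
  simp only [Pi.add_apply]
  nlinarith [sq_nonneg (‖a ω‖ - ‖b ω‖), sq_nonneg (‖a ω‖), sq_nonneg (‖b ω‖)]

/-- Davydov-type inequality. -/
lemma beta_cov_unbdd {Ω : Type*} (A B : MeasurableSpace Ω) [mΩ : MeasurableSpace Ω]
    (P : Measure Ω) [IsProbabilityMeasure P] (hA : A ≤ mΩ) (hB : B ≤ mΩ)
    {E : Type*} [NormedAddCommGroup E] [InnerProductSpace ℝ E] [CompleteSpace E]
    (ε : ℝ) (hε : 0 < ε) (a b : Ω → E)
    (ham : StronglyMeasurable[A] a) (hbm : StronglyMeasurable[B] b)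
    (ha : Integrable (fun ω => ‖a ω‖ ^ (2 + 2 * ε)) P)
    (hb : Integrable (fun ω => ‖b ω‖ ^ (2 + 2 * ε)) P)
    (K : ℝ) (hKa : ∫ ω, ‖a ω‖ ^ (2 + 2 * ε) ∂P ≤ K) (hKb : ∫ ω, ‖b ω‖ ^ (2 + 2 * ε) ∂P ≤ K)
    (ha0 : ∫ ω, a ω ∂P = 0) (M : ℝ) (hM : 1 ≤ M) :
    |∫ ω, inner ℝ (a ω) (b ω) ∂P| ≤
      2 * betaDep P A B * M ^ 2 + 3 * K * M ^ (-(2 * ε)) := by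
  have hM0 : 0 ≤ M := by linarith
  have ham' := ham.mono hA
  have hbm' := hbm.mono hB
  have tam := stronglyMeasurable_trunc (M := M) ham'
  have tbm := stronglyMeasurable_trunc (M := M) hbm'
  have hML : ‖(innerSL ℝ : E →L[ℝ] E →L[ℝ] ℝ)‖ ≤ 1 :=
    (norm_innerSL_le ℝ)
  have h1 := beta_cov A B P hA hB (innerSL ℝ : E →L[ℝ] E →L[ℝ] ℝ) hML
    (fun ω => trunc M (a ω)) (fun ω => trunc M (b ω))
    (stronglyMeasurable_trunc ham) (stronglyMeasurable_trunc hbm) M M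
    (fun ω => norm_trunc_le hM0 _) (fun ω => norm_trunc_le hM0 _)
  change |∫ ω, inner ℝ (trunc M (a ω)) (trunc M (b ω)) ∂P -
    inner ℝ (∫ ω, trunc M (a ω) ∂P) (∫ ω, trunc M (b ω) ∂P)| ≤ _ at h1
  rw [← sq] at h1
  have ia : Integrable a P := integrable_of_moment hε ham'.aestronglyMeasurable ha
  have iab : Integrable (fun ω => inner ℝ (a ω) (b ω)) P :=
    integrable_inner_of_sq ham'.aestronglyMeasurable hbm'.aestronglyMeasurable
      (integrable_sq_of_moment hε ham'.aestronglyMeasurable ha)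
      (integrable_sq_of_moment hε hbm'.aestronglyMeasurable hb)
  have ita : Integrable (fun ω => trunc M (a ω)) P :=
    Integrable.of_bound tam.aestronglyMeasurable M (.of_forall fun ω => norm_trunc_le hM0 _)
  have itab : Integrable (fun ω => inner ℝ (trunc M (a ω)) (trunc M (b ω))) P := by
    refine Integrable.of_bound (tam.inner tbm).aestronglyMeasurable (M * M) (.of_forall fun ω => ?_)
    refine (norm_inner_le_norm _ _).trans ?_
    have := norm_trunc_le hM0 (a ω)
    have := norm_trunc_le hM0 (b ω)
    gcongr
  -- the remainder
  have h2 : |∫ ω, inner ℝ (a ω) (b ω) ∂P - ∫ ω, inner ℝ (trunc M (a ω)) (trunc M (b ω)) ∂P| ≤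
      2 * K * M ^ (-(2 * ε)) := by
    rw [← integral_sub iab itab]
    have : ∀ ω, ‖inner ℝ (a ω) (b ω) - inner ℝ (trunc M (a ω)) (trunc M (b ω))‖ ≤
        (‖a ω‖ ^ (2 + 2 * ε) + ‖b ω‖ ^ (2 + 2 * ε)) * M ^ (-(2 * ε)) := by
      intro ω
      by_cases h : max ‖a ω‖ ‖b ω‖ ≤ M
      · rw [trunc_of_le ((le_max_left _ _).trans h), trunc_of_le ((le_max_right _ _).trans h)]
        simp only [sub_self, norm_zero]
        positivity
      · have e1 := aux_pow_gt hM hε (not_le.1 h)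
        have e2 := mul_le_rpow_add (ε := ε) (norm_nonneg (a ω)) (norm_nonneg (b ω))
        have : inner ℝ (trunc M (a ω)) (trunc M (b ω)) = 0 := by
          rcases lt_max_iff.1 (not_le.1 h) with h | h
          · rw [trunc_of_gt (not_le.2 h)]; simp
          · rw [trunc_of_gt (x := b ω) (not_le.2 h)]; simp
        rw [this, sub_zero]
        calc ‖inner ℝ (a ω) (b ω)‖ ≤ ‖a ω‖ * ‖b ω‖ := norm_inner_le_norm _ _
          _ ≤ max ‖a ω‖ ‖b ω‖ ^ 2 := by
              rw [sq]
              gcongr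
              · exact le_max_left _ _
              · exact le_max_right _ _
          _ ≤ _ := e1
          _ ≤ _ := by gcongr
    refine (norm_integral_le_of_norm_le ((ha.add hb).mul_const _) (.of_forall this)).trans ?_
    rw [integral_mul_const]
    simp only [Pi.add_apply]
    rw [integral_add ha hb]
    gcongr; linarith
  have h3 : ‖∫ ω, trunc M (a ω) ∂P‖ ≤ K * M ^ (-(2 * ε)) * M⁻¹ := by
    have : ∫ ω, trunc M (a ω) ∂P = - ∫ ω, (a ω - trunc M (a ω)) ∂P := by
      rw [integral_sub ia ita, ha0]; simp
    rw [this, norm_neg]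
    have : ∀ ω, ‖a ω - trunc M (a ω)‖ ≤ ‖a ω‖ ^ (2 + 2 * ε) * (M ^ (-(2 * ε)) * M⁻¹) := by
      intro ω
      by_cases h : ‖a ω‖ ≤ M
      · rw [trunc_of_le h]
        simp only [sub_self, norm_zero]
        positivity
      · rw [trunc_of_gt h, sub_zero]
        have e1 := aux_pow_gt hM hε (not_le.1 h)
        rw [← mul_assoc, ← div_eq_mul_inv, le_div_iff₀ (by linarith)]
        refine le_trans ?_ e1
        rw [sq]; gcongr
        exact (not_le.1 h).le
    refine (norm_integral_le_of_norm_le (ha.mul_const _) (.of_forall this)).trans ?_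
    rw [integral_mul_const, mul_assoc]
    gcongr
  have h4 : ‖∫ ω, trunc M (b ω) ∂P‖ ≤ M := by
    refine (norm_integral_le_of_norm_le_const (.of_forall fun ω => norm_trunc_le hM0 _)).trans ?_
    simp
  have h5 : |inner ℝ (∫ ω, trunc M (a ω) ∂P) (∫ ω, trunc M (b ω) ∂P)| ≤ K * M ^ (-(2 * ε)) := by
    refine (abs_real_inner_le_norm _ _).trans ?_
    calc _ ≤ K * M ^ (-(2 * ε)) * M⁻¹ * M := by
          gcongr
          exact (norm_nonneg _).trans h3
      _ = _ := by field_simp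
  have := abs_le.1 h1
  have := abs_le.1 h2
  have := abs_le.1 h5
  rw [abs_le]
  constructor <;> linarith

/-- stationary mixing setup -/
structure MixSetup {Ω 𝒵 : Type*} [MeasurableSpace Ω] [MeasurableSpace 𝒵] (P : Measure Ω)
    (Z : ℕ → Ω → 𝒵) (C r ε : ℝ) : Prop where
  prob : IsProbabilityMeasure P
  meas : ∀ i, Measurable (Z i)
  stat : MeasurePreserving shift (P.map fun ω i => Z i ω) (P.map fun ω i => Z i ω)
  eps : 0 < ε
  hr : 6 * (1 + 2 / ε) < r
  mix : ∀ n : ℕ, 1 ≤ n → betaProc P Z n ≤ C * (n : ℝ) ^ (-r)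

section
variable {Ω 𝒵 : Type*} [mΩ : MeasurableSpace Ω] [m𝒵 : MeasurableSpace 𝒵] {P : Measure Ω}
    {Z : ℕ → Ω → 𝒵} {C r ε : ℝ}

lemma sigmaUpTo_le (hZ : ∀ i, Measurable (Z i)) (l : ℕ) : sigmaUpTo Z l ≤ mΩ :=
  iSup₂_le fun i _ => (hZ i).comap_le

lemma sigmaFrom_le (hZ : ∀ i, Measurable (Z i)) (l : ℕ) : sigmaFrom Z l ≤ mΩ :=
  iSup₂_le fun i _ => (hZ i).comap_le

lemma measurable_upTo {l i : ℕ} (h : i < l) : Measurable[sigmaUpTo Z l] (Z i) := by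
  rw [measurable_iff_comap_le]
  exact le_iSup₂_of_le i (Finset.mem_range.2 h) le_rfl

lemma measurable_from {l i : ℕ} (h : l ≤ i) : Measurable[sigmaFrom Z l] (Z i) := by
  rw [measurable_iff_comap_le]
  exact le_iSup₂_of_le i h le_rfl

namespace MixSetup

lemma betaDep_le (S : MixSetup P Z C r ε) (l n : ℕ) (hn : 1 ≤ n) :
    betaDep P (sigmaUpTo Z (l + 1)) (sigmaFrom Z (l + n)) ≤ |C| * (n : ℝ) ^ (-r) := by
  have := S.prob
  refine le_trans ?_ ((S.mix n hn).trans ?_)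
  · apply le_csSup
    · refine ⟨1, ?_⟩
      rintro _ ⟨l, rfl⟩
      exact betaDep_le_one _ _ P (sigmaUpTo_le S.meas _) (sigmaFrom_le S.meas _)
    · exact ⟨l, rfl⟩
  · gcongr
    exact le_abs_self C

lemma measurable_path (S : MixSetup P Z C r ε) (k : ℕ) :
    Measurable (fun ω i => Z (i + k) ω) := measurable_pi_lambda _ fun i => S.meas _

lemma map_shift (S : MixSetup P Z C r ε) (k : ℕ) :
    P.map (fun ω i => Z (i + k) ω) = P.map (fun ω i => Z i ω) := by
  induction k with
  | zero => rfl
  | succ k ih =>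
    have h1 : (fun ω i => Z (i + (k + 1)) ω) = shift ∘ (fun ω i => Z (i + k) ω) := by
      funext ω i
      simp only [shift, Function.comp]
      rw [show i + (k + 1) = i + 1 + k by omega]
    rw [h1, ← Measure.map_map S.stat.measurable (S.measurable_path k), ih, S.stat.map_eq]

lemma integral_shift (S : MixSetup P Z C r ε) {E : Type*} [NormedAddCommGroup E]
    [NormedSpace ℝ E] (k : ℕ) {F : (ℕ → 𝒵) → E} (hF : StronglyMeasurable F) :
    ∫ ω, F (fun i => Z (i + k) ω) ∂P = ∫ ω, F (fun i => Z i ω) ∂P := by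
  have h := integral_map (S.measurable_path k).aemeasurable (μ := P)
    (f := F) hF.aestronglyMeasurable
  have h' := integral_map (S.measurable_path 0).aemeasurable (μ := P)
    (f := F) hF.aestronglyMeasurable
  simp only [add_zero] at h'
  rw [← h, ← h', S.map_shift]

lemma integral_one (S : MixSetup P Z C r ε) {E : Type*} [NormedAddCommGroup E]
    [NormedSpace ℝ E] (k : ℕ) {g : 𝒵 → E} (hg : StronglyMeasurable g) :
    ∫ ω, g (Z k ω) ∂P = ∫ ω, g (Z 0 ω) ∂P := by
  simpa using S.integral_shift k (F := fun p => g (p 0))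
    (hg.comp_measurable (measurable_pi_apply 0))

lemma map_one (S : MixSetup P Z C r ε) (k : ℕ) : P.map (Z k) = P.map (Z 0) := by
  have h := congrArg (Measure.map (fun p : ℕ → 𝒵 => p 0)) (S.map_shift k)
  rw [Measure.map_map (measurable_pi_apply 0) (S.measurable_path k),
    Measure.map_map (measurable_pi_apply 0)
      (measurable_pi_lambda _ fun i => S.meas _ : Measurable (fun ω i => Z i ω))] at h
  simpa [Function.comp_def] using h

lemma integrable_one (S : MixSetup P Z C r ε) {E : Type*} [NormedAddCommGroup E]
    [NormedSpace ℝ E] (k : ℕ) {g : 𝒵 → E} (hg : StronglyMeasurable g)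
    (h : Integrable (fun ω => g (Z 0 ω)) P) : Integrable (fun ω => g (Z k ω)) P := by
  have h1 := (integrable_map_measure (μ := P) (f := Z 0) (g := g) hg.aestronglyMeasurable
    (S.meas 0).aemeasurable).2 h
  rw [← S.map_one k] at h1
  exact (integrable_map_measure hg.aestronglyMeasurable (S.meas k).aemeasurable).1 h1

/-- covariance decay -/
lemma cov_decay (S : MixSetup P Z C r ε) {E : Type*} [NormedAddCommGroup E]
    [InnerProductSpace ℝ E] [CompleteSpace E] {f g : 𝒵 → E} (hf : StronglyMeasurable f)
    (hg : StronglyMeasurable g)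
    {K : ℝ} (hfi : Integrable (fun ω => ‖f (Z 0 ω)‖ ^ (2 + 2 * ε)) P)
    (hi : Integrable (fun ω => ‖g (Z 0 ω)‖ ^ (2 + 2 * ε)) P)
    (hfK : ∫ ω, ‖f (Z 0 ω)‖ ^ (2 + 2 * ε) ∂P ≤ K)
    (hK : ∫ ω, ‖g (Z 0 ω)‖ ^ (2 + 2 * ε) ∂P ≤ K) (h0 : ∫ ω, f (Z 0 ω) ∂P = 0)
    (t m : ℕ) (hm : 1 ≤ m) :
    |∫ ω, inner ℝ (f (Z t ω)) (g (Z (t + m) ω)) ∂P| ≤ (2 * |C| + 3 * K) / (m : ℝ) ^ 2 := by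
  have := S.prob
  have hε := S.eps
  have hm' : (1 : ℝ) ≤ m := by exact_mod_cast hm
  have hm0 : (0 : ℝ) < m := by linarith
  have hp : StronglyMeasurable (fun z => ‖g z‖ ^ (2 + 2 * ε)) := by
    exact (hg.norm.measurable.pow_const _).stronglyMeasurable
  have hp2 : StronglyMeasurable (fun z => ‖f z‖ ^ (2 + 2 * ε)) := by
    exact (hf.norm.measurable.pow_const _).stronglyMeasurable
  have hM : (1 : ℝ) ≤ (m : ℝ) ^ (1 / ε) := Real.one_le_rpow hm' (by positivity)
  have key := beta_cov_unbdd (sigmaUpTo Z (t + 1)) (sigmaFrom Z (t + m)) P (sigmaUpTo_le S.meas _)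
    (sigmaFrom_le S.meas _) ε hε (fun ω => f (Z t ω)) (fun ω => g (Z (t + m) ω))
    (hf.comp_measurable (measurable_upTo (Nat.lt_succ_self t)))
    (hg.comp_measurable (measurable_from le_rfl))
    (S.integrable_one t hp2 hfi) (S.integrable_one (t + m) hp hi) K
    ((S.integral_one t hp2).trans_le hfK) ((S.integral_one (t + m) hp).trans_le hK)
    ((S.integral_one t hf).trans h0) ((m : ℝ) ^ (1 / ε)) hM
  refine key.trans ?_
  have hb := S.betaDep_le t m hm
  have e1 : ((m : ℝ) ^ (1 / ε)) ^ (-(2 * ε)) = ((m : ℝ) ^ 2)⁻¹ := by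
    rw [← Real.rpow_mul hm0.le]
    have : 1 / ε * -(2 * ε) = - 2 := by field_simp
    rw [this, Real.rpow_neg hm0.le]; norm_cast
  have e2 : (m : ℝ) ^ (-r) * ((m : ℝ) ^ (1 / ε)) ^ 2 ≤ ((m : ℝ) ^ 2)⁻¹ := by
    have h2 : (((m : ℝ) ^ 2)⁻¹ : ℝ) = (m : ℝ) ^ (-2 : ℝ) := by
      rw [Real.rpow_neg hm0.le]; norm_cast
    rw [h2, ← Real.rpow_natCast, ← Real.rpow_mul hm0.le, ← Real.rpow_add hm0]
    apply Real.rpow_le_rpow_of_exponent_le hm'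
    have := S.hr
    have h3 : 2 / ε = 2 * (1 / ε) := by ring
    have h4 : 0 < 1 / ε := by positivity
    push_cast
    rw [h3] at this
    linarith
  rw [e1]
  calc _ ≤ 2 * (|C| * (m : ℝ) ^ (-r)) * ((m : ℝ) ^ (1 / ε)) ^ 2 + 3 * K * ((m : ℝ) ^ 2)⁻¹ := by
        gcongr
    _ = 2 * |C| * ((m : ℝ) ^ (-r) * ((m : ℝ) ^ (1 / ε)) ^ 2) + 3 * K * ((m : ℝ) ^ 2)⁻¹ := by ring
    _ ≤ 2 * |C| * ((m : ℝ) ^ 2)⁻¹ + 3 * K * ((m : ℝ) ^ 2)⁻¹ := by gcongr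
    _ = _ := by rw [div_eq_mul_inv]; ring

end MixSetup
end



/-- covariance envelope -/
def gam (c τ : ℝ) (m : ℕ) : ℝ := if m = 0 then τ else min τ (c / (m : ℝ) ^ 2)

/-- variance envelope -/
def Psi (c τ : ℝ) : ℝ := 2 * ∑' m, gam c τ m

lemma gam_nonneg {c τ : ℝ} (hc : 0 ≤ c) (hτ : 0 ≤ τ) (m : ℕ) : 0 ≤ gam c τ m := by
  unfold gam; split_ifs
  · exact hτ
  · exact le_min hτ (by positivity)

lemma gam_le {c τ : ℝ} (hc : 0 ≤ c) (m : ℕ) :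
    gam c τ m ≤ c / (m : ℝ) ^ 2 + (if m = 0 then τ else 0) := by
  unfold gam; split_ifs with h
  · simp [h]
  · rw [add_zero]; exact min_le_right _ _

lemma summable_env (c τ : ℝ) :
    Summable (fun m : ℕ => c / (m : ℝ) ^ 2 + (if m = 0 then τ else 0)) := by
  refine Summable.add ?_ (summable_of_ne_finset_zero (s := {0}) (by simp +contextual))
  simp_rw [div_eq_mul_inv]
  exact (Real.summable_nat_pow_inv.2 one_lt_two).mul_left c

lemma summable_gam {c τ : ℝ} (hc : 0 ≤ c) (hτ : 0 ≤ τ) : Summable (gam c τ) :=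
  Summable.of_nonneg_of_le (gam_nonneg hc hτ) (gam_le hc) (summable_env c τ)

lemma Psi_nonneg {c τ : ℝ} (hc : 0 ≤ c) (hτ : 0 ≤ τ) : 0 ≤ Psi c τ :=
  mul_nonneg zero_le_two (tsum_nonneg (gam_nonneg hc hτ))

lemma Psi_tendsto {c : ℝ} (hc : 0 ≤ c) : Tendsto (Psi c) (𝓝[≥] 0) (𝓝 0) := by
  have h : Tendsto (fun τ => ∑' m, gam c τ m) (𝓝[≥] 0) (𝓝 (∑' m : ℕ, (0 : ℝ))) := by
    refine tendsto_tsum_of_dominated_convergence (summable_env c 1) (fun m => ?_) ?_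
    · have : Tendsto (fun τ => gam c τ m) (𝓝 0) (𝓝 (gam c 0 m)) := by
        unfold gam
        split_ifs with h
        · exact tendsto_id
        · exact (continuous_id.min continuous_const).tendsto 0
      have h0 : gam c 0 m = 0 := by
        unfold gam; split_ifs with h
        · rfl
        · exact min_eq_left (by positivity)
      rw [h0] at this
      exact this.mono_left nhdsWithin_le_nhds
    · have h1 : ∀ᶠ τ : ℝ in 𝓝[≥] 0, τ ≤ 1 :=
        nhdsWithin_le_nhds (eventually_le_nhds zero_lt_one)
      filter_upwards [h1, self_mem_nhdsWithin] with τ h1 h2 m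
      rw [Real.norm_of_nonneg (gam_nonneg hc h2 m)]
      refine (gam_le hc m).trans ?_
      gcongr
      split_ifs <;> simp [h1]
  have h2 := h.const_mul 2
  simp only [tsum_zero, mul_zero] at h2
  exact h2

lemma sum_gam_le {c τ : ℝ} (hc : 0 ≤ c) (hτ : 0 ≤ τ) (A : Finset ℕ) (t : ℕ) :
    ∑ u ∈ A, gam c τ ((t - u) + (u - t)) ≤ Psi c τ := by
  rw [← Finset.sum_filter_add_sum_filter_not A (fun u => u ≤ t)]
  have key : ∀ (s : Finset ℕ), Set.InjOn (fun u => (t - u) + (u - t)) s →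
      ∑ u ∈ s, gam c τ ((t - u) + (u - t)) ≤ ∑' m, gam c τ m := by
    intro s hs
    rw [← Finset.sum_image (f := gam c τ) hs]
    exact (summable_gam hc hτ).sum_le_tsum _ fun i _ => gam_nonneg hc hτ i
  rw [Psi, two_mul]
  refine add_le_add (key _ ?_) (key _ ?_)
  · intro a ha b hb hab
    simp at ha hb hab
    omega
  · intro a ha b hb hab
    simp at ha hb hab
    omega

lemma norm_sum_sq {E : Type*} [NormedAddCommGroup E] [InnerProductSpace ℝ E] (A : Finset ℕ)
    (v : ℕ → E) : ‖∑ t ∈ A, v t‖ ^ 2 = ∑ t ∈ A, ∑ u ∈ A, inner ℝ (v t) (v u) := by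
  rw [← real_inner_self_eq_norm_sq, sum_inner]
  simp_rw [inner_sum]

section
variable {Ω 𝒵 : Type*} [mΩ : MeasurableSpace Ω] [m𝒵 : MeasurableSpace 𝒵] {P : Measure Ω}
    {Z : ℕ → Ω → 𝒵} {C r ε : ℝ}
namespace MixSetup

lemma integrable_sq (S : MixSetup P Z C r ε) {E : Type*} [NormedAddCommGroup E]
    {g : 𝒵 → E} (hg : StronglyMeasurable g)
    (hi : Integrable (fun ω => ‖g (Z 0 ω)‖ ^ (2 + 2 * ε)) P) (t : ℕ) :
    Integrable (fun ω => ‖g (Z t ω)‖ ^ 2) P := by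
  have := S.prob
  have h : Integrable (fun ω => ‖g (Z 0 ω)‖ ^ 2) P :=
    integrable_sq_of_moment S.eps (hg.comp_measurable (S.meas 0)).aestronglyMeasurable hi
  exact S.integrable_one (E := ℝ) t (g := fun z => ‖g z‖ ^ 2) (hg.norm.pow 2) h

lemma integrable_inner (S : MixSetup P Z C r ε) {E : Type*} [NormedAddCommGroup E]
    [InnerProductSpace ℝ E] {f g : 𝒵 → E} (hf : StronglyMeasurable f) (hg : StronglyMeasurable g)
    (hfi : Integrable (fun ω => ‖f (Z 0 ω)‖ ^ (2 + 2 * ε)) P)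
    (hi : Integrable (fun ω => ‖g (Z 0 ω)‖ ^ (2 + 2 * ε)) P) (t u : ℕ) :
    Integrable (fun ω => inner ℝ (f (Z t ω)) (g (Z u ω))) P :=
  integrable_inner_of_sq (hf.comp_measurable (S.meas t)).aestronglyMeasurable
    (hg.comp_measurable (S.meas u)).aestronglyMeasurable (S.integrable_sq hf hfi t)
    (S.integrable_sq hg hi u)

lemma cov_le_gam (S : MixSetup P Z C r ε) {E : Type*} [NormedAddCommGroup E]
    [InnerProductSpace ℝ E] [CompleteSpace E] {g : 𝒵 → E}
    (hg : StronglyMeasurable g)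
    {K τ : ℝ} (hi : Integrable (fun ω => ‖g (Z 0 ω)‖ ^ (2 + 2 * ε)) P)
    (hK : ∫ ω, ‖g (Z 0 ω)‖ ^ (2 + 2 * ε) ∂P ≤ K) (h0 : ∫ ω, g (Z 0 ω) ∂P = 0)
    (hτ : ∫ ω, ‖g (Z 0 ω)‖ ^ 2 ∂P ≤ τ) (t u : ℕ) :
    ∫ ω, inner ℝ (g (Z t ω)) (g (Z u ω)) ∂P ≤ gam (2 * |C| + 3 * K) τ ((t - u) + (u - t)) := by
  have := S.prob
  have hle : ∫ ω, inner ℝ (g (Z t ω)) (g (Z u ω)) ∂P ≤ τ := by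
    have e : ∀ t, ∫ ω, ‖g (Z t ω)‖ ^ 2 ∂P ≤ τ := fun t =>
      (S.integral_one (E := ℝ) t (g := fun z => ‖g z‖ ^ 2) (hg.norm.pow 2)).trans_le hτ
    have : ∫ ω, inner ℝ (g (Z t ω)) (g (Z u ω)) ∂P ≤
        ∫ ω, (1 / 2 * ‖g (Z t ω)‖ ^ 2 + 1 / 2 * ‖g (Z u ω)‖ ^ 2) ∂P := by
      refine integral_mono (S.integrable_inner hg hg hi hi t u)
        (((S.integrable_sq hg hi t).const_mul _).add ((S.integrable_sq hg hi u).const_mul _))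
        fun ω => ?_
      simp only
      have := real_inner_le_norm (g (Z t ω)) (g (Z u ω))
      nlinarith [sq_nonneg (‖g (Z t ω)‖ - ‖g (Z u ω)‖)]
    refine this.trans ?_
    rw [integral_add ((S.integrable_sq hg hi t).const_mul _) ((S.integrable_sq hg hi u).const_mul _),
      integral_const_mul, integral_const_mul]
    linarith [e t, e u]
  unfold gam
  split_ifs with h
  · exact hle
  refine le_min hle ?_
  rcases lt_trichotomy t u with h1 | h1 | h1
  · obtain ⟨m, rfl⟩ := Nat.exists_eq_add_of_lt h1
    have := (abs_le.1 (S.cov_decay hg hg hi hi hK hK h0 t (m + 1) (by omega))).2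
    have e1 : (t - (t + m + 1)) + (t + m + 1 - t) = m + 1 := by omega
    rw [e1]
    simpa [add_assoc] using this
  · omega
  · obtain ⟨m, rfl⟩ := Nat.exists_eq_add_of_lt h1
    have := (abs_le.1 (S.cov_decay hg hg hi hi hK hK h0 u (m + 1) (by omega))).2
    have e1 : (u + m + 1 - u) + (u - (u + m + 1)) = m + 1 := by omega
    rw [e1]
    simp_rw [real_inner_comm (g (Z u _)) (g (Z (u + m + 1) _))]
    simpa [add_assoc] using this

lemma var_bound (S : MixSetup P Z C r ε) {E : Type*} [NormedAddCommGroup E]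
    [InnerProductSpace ℝ E] [CompleteSpace E] {g : 𝒵 → E}
    (hg : StronglyMeasurable g)
    {K τ : ℝ} (hi : Integrable (fun ω => ‖g (Z 0 ω)‖ ^ (2 + 2 * ε)) P)
    (hK : ∫ ω, ‖g (Z 0 ω)‖ ^ (2 + 2 * ε) ∂P ≤ K) (h0 : ∫ ω, g (Z 0 ω) ∂P = 0)
    (hτ : ∫ ω, ‖g (Z 0 ω)‖ ^ 2 ∂P ≤ τ) (A : Finset ℕ) :
    ∫ ω, ‖∑ t ∈ A, g (Z t ω)‖ ^ 2 ∂P ≤ A.card * Psi (2 * |C| + 3 * K) τ := by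
  have hK0 : 0 ≤ K := le_trans (integral_nonneg fun ω => by positivity) hK
  have hτ0 : 0 ≤ τ := le_trans (integral_nonneg fun ω => by positivity) hτ
  simp_rw [norm_sum_sq]
  rw [integral_finsetSum _ fun t _ => integrable_finsetSum _ fun u _ =>
    S.integrable_inner hg hg hi hi t u]
  have : ∀ t ∈ A, ∫ ω, ∑ u ∈ A, inner ℝ (g (Z t ω)) (g (Z u ω)) ∂P ≤ Psi (2 * |C| + 3 * K) τ := by
    intro t _
    rw [integral_finsetSum _ fun u _ => S.integrable_inner hg hg hi hi t u]
    refine (Finset.sum_le_sum fun u _ => S.cov_le_gam hg hi hK h0 hτ t u).trans ?_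
    exact sum_gam_le (by positivity) hτ0 A t
  refine (Finset.sum_le_sum this).trans ?_
  simp

lemma integrable_norm_sum_sq (S : MixSetup P Z C r ε) {E : Type*} [NormedAddCommGroup E]
    [InnerProductSpace ℝ E] {g : 𝒵 → E} (hg : StronglyMeasurable g)
    (hi : Integrable (fun ω => ‖g (Z 0 ω)‖ ^ (2 + 2 * ε)) P) (A : Finset ℕ) :
    Integrable (fun ω => ‖∑ t ∈ A, g (Z t ω)‖ ^ 2) P := by
  simp_rw [norm_sum_sq]
  exact integrable_finsetSum _ fun t _ => integrable_finsetSum _ fun u _ =>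
    S.integrable_inner hg hg hi hi t u

/-- long-run covariance exists -/
lemma exists_lrcov (S : MixSetup P Z C r ε) {f g : 𝒵 → ℝ} (hf : StronglyMeasurable f)
    (hg : StronglyMeasurable g)
    (hfi : Integrable (fun ω => ‖f (Z 0 ω)‖ ^ (2 + 2 * ε)) P)
    (hi : Integrable (fun ω => ‖g (Z 0 ω)‖ ^ (2 + 2 * ε)) P)
    (hf0 : ∫ ω, f (Z 0 ω) ∂P = 0) (h0 : ∫ ω, g (Z 0 ω) ∂P = 0) :
    ∃ L : ℝ, Tendsto (fun n : ℕ => (n : ℝ)⁻¹ * ∑ t ∈ Finset.range n, ∑ u ∈ Finset.range n,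
      ∫ ω, f (Z t ω) * g (Z u ω) ∂P) atTop (𝓝 L) := by
  have := S.prob
  set K := max (∫ ω, ‖f (Z 0 ω)‖ ^ (2 + 2 * ε) ∂P) (∫ ω, ‖g (Z 0 ω)‖ ^ (2 + 2 * ε) ∂P) with hK
  have hK1 : ∫ ω, ‖f (Z 0 ω)‖ ^ (2 + 2 * ε) ∂P ≤ K := le_max_left _ _
  have hK2 : ∫ ω, ‖g (Z 0 ω)‖ ^ (2 + 2 * ε) ∂P ≤ K := le_max_right _ _
  -- the two one-sided covariance sequences
  set c1 : ℕ → ℝ := fun m => ∫ ω, f (Z 0 ω) * g (Z m ω) ∂P with hc1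
  set c2 : ℕ → ℝ := fun m => ∫ ω, f (Z m ω) * g (Z 0 ω) ∂P with hc2
  have e1 : ∀ t m, ∫ ω, f (Z t ω) * g (Z (t + m) ω) ∂P = c1 m := by
    intro t m
    have := S.integral_shift t (F := fun p => f (p 0) * g (p m))
      ((hf.comp_measurable (measurable_pi_apply 0)).mul
        (hg.comp_measurable (measurable_pi_apply m)))
    simpa [add_comm] using this
  have e2 : ∀ t m, ∫ ω, f (Z (t + m) ω) * g (Z t ω) ∂P = c2 m := by
    intro t m
    have := S.integral_shift t (F := fun p => f (p m) * g (p 0))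
      ((hf.comp_measurable (measurable_pi_apply m)).mul
        (hg.comp_measurable (measurable_pi_apply 0)))
    simpa [add_comm] using this
  have s1 : Summable c1 := by
    rw [← summable_nat_add_iff 1]
    refine Summable.of_norm_bounded
      ((summable_nat_add_iff 1).2 (summable_env (2 * |C| + 3 * K) 0)) fun m => ?_
    have := S.cov_decay hf hg hfi hi hK1 hK2 hf0 0 (m + 1) (by omega)
    simpa [hc1, mul_comm] using this
  have s2 : Summable c2 := by
    rw [← summable_nat_add_iff 1]
    refine Summable.of_norm_bounded
      ((summable_nat_add_iff 1).2 (summable_env (2 * |C| + 3 * K) 0)) fun m => ?_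
    have := S.cov_decay hg hf hi hfi hK2 hK1 h0 0 (m + 1) (by omega)
    simpa [hc2, mul_comm] using this
  -- increments
  set b : ℕ → ℝ := fun n => (∑ m ∈ Finset.range (n + 1), c1 m) + (∑ m ∈ Finset.range (n + 1), c2 m)
    - c1 0 with hb
  have hbl : Tendsto b atTop (𝓝 (∑' m, c1 m + ∑' m, c2 m - c1 0)) :=
    ((s1.tendsto_sum_tsum_nat.comp (tendsto_add_atTop_nat 1)).add
      (s2.tendsto_sum_tsum_nat.comp (tendsto_add_atTop_nat 1))).sub_const _
  have hsum : ∀ n, ∑ t ∈ Finset.range n, ∑ u ∈ Finset.range n, ∫ ω, f (Z t ω) * g (Z u ω) ∂P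
      = ∑ i ∈ Finset.range n, b i := by
    intro n
    induction n with
    | zero => simp
    | succ n ih =>
      rw [Finset.sum_range_succ, Finset.sum_range_succ b]
      simp_rw [Finset.sum_range_succ _ n]
      rw [Finset.sum_add_distrib, ih]
      have r1 : ∑ t ∈ Finset.range n, ∫ ω, f (Z t ω) * g (Z n ω) ∂P =
          ∑ m ∈ Finset.range n, c1 (m + 1) := by
        rw [← Finset.sum_range_reflect]
        refine Finset.sum_congr rfl fun j hj => ?_
        have hj := Finset.mem_range.1 hj
        rw [← e1 (n - 1 - j) (j + 1)]
        congr! 3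
        congr 2; omega
      have r2 : ∑ u ∈ Finset.range n, ∫ ω, f (Z n ω) * g (Z u ω) ∂P =
          ∑ m ∈ Finset.range n, c2 (m + 1) := by
        rw [← Finset.sum_range_reflect]
        refine Finset.sum_congr rfl fun j hj => ?_
        have hj := Finset.mem_range.1 hj
        rw [← e2 (n - 1 - j) (j + 1)]
        congr! 3
        congr 2; omega
      have r3 : ∫ ω, f (Z n ω) * g (Z n ω) ∂P = c1 0 := by simpa using e1 n 0
      have r4 : c2 0 = c1 0 := rfl
      rw [r1, r2, r3]
      simp only [hb]
      rw [Finset.sum_range_succ', Finset.sum_range_succ', r4]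
      ring
  refine ⟨_, hbl.cesaro.congr fun n => ?_⟩
  rw [hsum]

end MixSetup
end



/-- unit circle exponential -/
def ce (x : ℝ) : ℂ := Complex.exp (Complex.I * x)

lemma ce_norm (x : ℝ) : ‖ce x‖ = 1 := Complex.norm_exp_I_mul_ofReal x

lemma ce_zero : ce 0 = 1 := by simp [ce]

lemma ce_add (x y : ℝ) : ce (x + y) = ce x * ce y := by
  simp [ce, mul_add, Complex.exp_add]

lemma continuous_ce : Continuous ce := by unfold ce; fun_prop

lemma ce_sub_le (x y : ℝ) : ‖ce x - ce y‖ ≤ |x - y| := by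
  have : ce x - ce y = ce y * (ce (x - y) - 1) := by
    rw [mul_sub, ← ce_add]; simp
  rw [this, norm_mul, ce_norm, one_mul]
  exact Real.norm_exp_I_mul_ofReal_sub_one_le

lemma ce_taylor {x : ℝ} (hx : |x| ≤ 1) :
    ‖ce x - (1 + Complex.I * x - ((x ^ 2 / 2 : ℝ) : ℂ))‖ ≤ 3 * |x| ^ 3 := by
  have h := Complex.norm_exp_sub_sum_le_norm_mul_exp (Complex.I * x) 3
  have e : ∑ m ∈ Finset.range 3, (Complex.I * x) ^ m / (m.factorial : ℂ) =
      1 + Complex.I * x - ((x ^ 2 / 2 : ℝ) : ℂ) := by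
    simp [Finset.sum_range_succ, Nat.factorial, mul_pow]
    ring
  rw [e] at h
  refine h.trans ?_
  have n1 : ‖Complex.I * (x : ℂ)‖ = |x| := by simp
  rw [n1, mul_comm]
  gcongr
  calc Real.exp |x| ≤ Real.exp 1 := Real.exp_le_exp.2 hx
    _ ≤ 3 := by have := Real.exp_one_lt_d9; linarith

lemma pow_sub_pow_norm_le {a b : ℂ} (ha : ‖a‖ ≤ 1) (hb : ‖b‖ ≤ 1) (k : ℕ) :
    ‖a ^ k - b ^ k‖ ≤ k * ‖a - b‖ := by
  induction k with
  | zero => simp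
  | succ k ih =>
    have : a ^ (k + 1) - b ^ (k + 1) = a ^ k * (a - b) + (a ^ k - b ^ k) * b := by ring
    rw [this]
    refine (norm_add_le _ _).trans ?_
    rw [norm_mul, norm_mul]
    have h1 : ‖a ^ k‖ ≤ 1 := by rw [norm_pow]; exact pow_le_one₀ (norm_nonneg _) ha
    have : ‖a ^ k‖ * ‖a - b‖ ≤ 1 * ‖a - b‖ := by gcongr
    have : ‖a ^ k - b ^ k‖ * ‖b‖ ≤ k * ‖a - b‖ * 1 := by gcongr
    push_cast; linarith

/-- Cauchy-Schwarz / Jensen -/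
lemma integral_abs_le_sqrt {Ω : Type*} [mΩ : MeasurableSpace Ω] {P : Measure Ω}
    [IsProbabilityMeasure P] {a : Ω → ℝ} (ham : AEStronglyMeasurable a P)
    (ha : Integrable (fun ω => a ω ^ 2) P) :
    ∫ ω, |a ω| ∂P ≤ √(∫ ω, a ω ^ 2 ∂P) := by
  have hL : MemLp a 2 P := (memLp_two_iff_integrable_sq ham).2 ha
  have hi : Integrable a P := hL.integrable (by norm_num)
  apply Real.le_sqrt_of_sq_le
  have h0 : 0 ≤ ∫ ω, (|a ω| - ∫ ω, |a ω| ∂P) ^ 2 ∂P := integral_nonneg fun ω => sq_nonneg _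
  have h1 : ∀ ω, (|a ω| - ∫ ω, |a ω| ∂P) ^ 2 =
      a ω ^ 2 - 2 * (∫ ω, |a ω| ∂P) * |a ω| + (∫ ω, |a ω| ∂P) ^ 2 := by
    intro ω; rw [sub_sq, sq_abs]; ring
  simp_rw [h1] at h0
  have h2 : Integrable (fun ω => a ω ^ 2 - 2 * (∫ ω, |a ω| ∂P) * |a ω|) P :=
    ha.sub (hi.abs.const_mul _)
  rw [integral_add h2 (integrable_const _),
    integral_sub ha (hi.abs.const_mul _), integral_const_mul] at h0
  simp at h0
  nlinarith

lemma char_small {Ω : Type*} [mΩ : MeasurableSpace Ω] {P : Measure Ω}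
    [IsProbabilityMeasure P] {U : Ω → ℝ} (hU : Measurable U) {η : ℝ} (hη : η ≤ 1)
    (hb : ∀ ω, |U ω| ≤ η) (h0 : ∫ ω, U ω ∂P = 0) :
    ‖∫ ω, ce (U ω) ∂P - (Real.exp (-(∫ ω, U ω ^ 2 ∂P) / 2) : ℂ)‖ ≤
      4 * η * ∫ ω, U ω ^ 2 ∂P := by
  obtain ⟨ω0⟩ : Nonempty Ω := nonempty_of_isProbabilityMeasure P
  have hη0 : 0 ≤ η := (abs_nonneg _).trans (hb ω0)
  set v := ∫ ω, U ω ^ 2 ∂P with hv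
  have iU : Integrable U P :=
    Integrable.of_bound hU.aestronglyMeasurable η (.of_forall hb)
  have sqb : ∀ ω, U ω ^ 2 ≤ η ^ 2 := fun ω => sq_le_sq' (abs_le.1 (hb ω)).1 (abs_le.1 (hb ω)).2
  have iU2 : Integrable (fun ω => U ω ^ 2) P :=
    Integrable.of_bound (hU.pow_const 2).aestronglyMeasurable (η ^ 2) (.of_forall fun ω => by
      rw [Real.norm_of_nonneg (sq_nonneg _)]; exact sqb ω)
  have ice : Integrable (fun ω => ce (U ω)) P :=
    Integrable.of_bound (continuous_ce.measurable.comp hU).aestronglyMeasurable 1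
      (.of_forall fun ω => (ce_norm _).le)
  have hv0 : 0 ≤ v := integral_nonneg fun ω => sq_nonneg _
  have hvη : v ≤ η ^ 2 := by
    calc v ≤ ∫ ω, η ^ 2 ∂P := integral_mono iU2 (integrable_const _) sqb
      _ = η ^ 2 := by simp
  have i2 : Integrable (fun ω => (1 + Complex.I * (U ω : ℂ) - ((U ω ^ 2 / 2 : ℝ) : ℂ))) P :=
    ((integrable_const _).add (iU.ofReal.const_mul _)).sub (iU2.div_const 2).ofReal
  have e2 : ∫ ω, (1 + Complex.I * (U ω : ℂ) - ((U ω ^ 2 / 2 : ℝ) : ℂ)) ∂P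
      = ((1 - v / 2 : ℝ) : ℂ) := by
    rw [integral_sub ((integrable_const _).add (iU.ofReal.const_mul _)) (iU2.div_const 2).ofReal,
      integral_add (integrable_const _) (iU.ofReal.const_mul _), integral_const_mul,
      integral_complex_ofReal, integral_complex_ofReal, h0, integral_div]
    simp [hv]
  have h1 : ‖∫ ω, ce (U ω) ∂P - ((1 - v / 2 : ℝ) : ℂ)‖ ≤ 3 * η * v := by
    rw [← e2, ← integral_sub ice i2]
    have : ∀ ω, ‖ce (U ω) - (1 + Complex.I * (U ω : ℂ) - ((U ω ^ 2 / 2 : ℝ) : ℂ))‖ ≤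
        3 * η * U ω ^ 2 := by
      intro ω
      refine (ce_taylor ((hb ω).trans hη)).trans ?_
      rw [pow_succ, sq_abs, mul_assoc, mul_comm (U ω ^ 2)]
      gcongr
      exact hb ω
    refine (norm_integral_le_of_norm_le (iU2.const_mul _) (.of_forall this)).trans ?_
    rw [integral_const_mul]
  have h2 : ‖((1 - v / 2 : ℝ) : ℂ) - (Real.exp (-v / 2) : ℂ)‖ ≤ η * v := by
    rw [← Complex.ofReal_sub, Complex.norm_real, Real.norm_eq_abs, abs_sub_comm]
    have := Real.abs_exp_sub_one_sub_id_le (x := -v / 2) (by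
      rw [abs_le]; constructor <;> nlinarith)
    have e : Real.exp (-v / 2) - (1 - v / 2) = Real.exp (-v / 2) - 1 - -v / 2 := by ring
    rw [e]
    refine this.trans ?_
    nlinarith
  calc _ = ‖(∫ ω, ce (U ω) ∂P - ((1 - v / 2 : ℝ) : ℂ)) +
        (((1 - v / 2 : ℝ) : ℂ) - (Real.exp (-v / 2) : ℂ))‖ := by congr 1; ring
    _ ≤ _ := (norm_add_le _ _).trans (add_le_add h1 h2)
    _ = _ := by ring

section
variable {Ω 𝒵 : Type*} [mΩ : MeasurableSpace Ω] [m𝒵 : MeasurableSpace 𝒵] {P : Measure Ω}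
    {Z : ℕ → Ω → 𝒵} {C r ε : ℝ}
namespace MixSetup

lemma block_prod (S : MixSetup P Z C r ε) {h : 𝒵 → ℝ} (hh : Measurable h) (p q : ℕ) (hq : 1 ≤ q)
    (s : ℝ) (k : ℕ) :
    ‖∫ ω, ce (s * ∑ j ∈ Finset.range k, ∑ i ∈ Finset.range p, h (Z (j * (p + q) + q + i) ω)) ∂P
      - (∫ ω, ce (s * ∑ i ∈ Finset.range p, h (Z i ω)) ∂P) ^ k‖ ≤
      k * (2 * (|C| * (q : ℝ) ^ (-r))) := by
  have := S.prob
  set ψ := ∫ ω, ce (s * ∑ i ∈ Finset.range p, h (Z i ω)) ∂P with hψ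
  have hψ1 : ‖ψ‖ ≤ 1 := by
    refine (norm_integral_le_of_norm_le_const (.of_forall fun ω => (ce_norm _).le)).trans ?_
    simp
  induction k with
  | zero => simp [ce_zero]
  | succ k ih =>
    set F : Ω → ℂ := fun ω => ce (s * ∑ j ∈ Finset.range k, ∑ i ∈ Finset.range p,
      h (Z (j * (p + q) + q + i) ω)) with hF
    set G : Ω → ℂ := fun ω => ce (s * ∑ i ∈ Finset.range p, h (Z (k * (p + q) + q + i) ω)) with hG
    have hFm : StronglyMeasurable[sigmaUpTo Z (k * (p + q) + 1)] F := by
      refine continuous_ce.comp_stronglyMeasurable ?_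
      refine Measurable.stronglyMeasurable ?_
      refine Measurable.const_mul ?_ _
      refine Finset.measurable_fun_sum _ fun j hj => Finset.measurable_fun_sum _ fun i hi => ?_
      refine hh.comp (measurable_upTo ?_)
      have hj := Finset.mem_range.1 hj
      have hi := Finset.mem_range.1 hi
      have : (j + 1) * (p + q) ≤ k * (p + q) := Nat.mul_le_mul_right _ hj
      rw [add_mul] at this
      omega
    have hGm : StronglyMeasurable[sigmaFrom Z (k * (p + q) + q)] G := by
      refine continuous_ce.comp_stronglyMeasurable ?_
      refine Measurable.stronglyMeasurable ?_
      refine Measurable.const_mul ?_ _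
      refine Finset.measurable_fun_sum _ fun i hi => ?_
      exact hh.comp (measurable_from (by omega))
    have key := beta_cov (sigmaUpTo Z (k * (p + q) + 1)) (sigmaFrom Z (k * (p + q) + q)) P
      (sigmaUpTo_le S.meas _) (sigmaFrom_le S.meas _) (ContinuousLinearMap.mul ℝ ℂ)
      (ContinuousLinearMap.opNorm_mul_le ℝ ℂ) F G hFm hGm 1 1 (fun ω => (ce_norm _).le)
      (fun ω => (ce_norm _).le)
    simp only [ContinuousLinearMap.mul_apply'] at key
    have hGψ : ∫ ω, G ω ∂P = ψ := by
      have := S.integral_shift (k * (p + q) + q)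
        (F := fun x => ce (s * ∑ i ∈ Finset.range p, h (x i)))
        (continuous_ce.comp_stronglyMeasurable (Measurable.stronglyMeasurable
          (Measurable.const_mul (Finset.measurable_fun_sum _ fun i hi =>
            hh.comp (measurable_pi_apply i)) s)))
      rw [hψ, ← this]
      simp only [hG]
      congr! 7
      omega
    have hFG : ∀ ω, ce (s * ∑ j ∈ Finset.range (k + 1), ∑ i ∈ Finset.range p,
        h (Z (j * (p + q) + q + i) ω)) = F ω * G ω := by
      intro ω
      rw [Finset.sum_range_succ, mul_add, ce_add]
    simp_rw [hFG]
    have hb := S.betaDep_le (k * (p + q)) q hq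
    rw [hGψ] at key
    have e : ∫ ω, F ω * G ω ∂P - ψ ^ (k + 1) =
        (∫ ω, F ω * G ω ∂P - (∫ ω, F ω ∂P) * ψ) + ((∫ ω, F ω ∂P) - ψ ^ k) * ψ := by ring
    rw [e]
    refine (norm_add_le _ _).trans ?_
    rw [norm_mul]
    have : ‖(∫ ω, F ω ∂P) - ψ ^ k‖ * ‖ψ‖ ≤ k * (2 * (|C| * (q : ℝ) ^ (-r))) * 1 := by gcongr
    push_cast
    linarith

lemma clt_block (S : MixSetup P Z C r ε) {h : 𝒵 → ℝ} (hh : Measurable h) {M V : ℝ}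
    (hM : ∀ z, |h z| ≤ M) (h0 : ∫ ω, h (Z 0 ω) ∂P = 0)
    (hV : ∀ A : Finset ℕ, ∫ ω, (∑ t ∈ A, h (Z t ω)) ^ 2 ∂P ≤ A.card * V)
    (p q k n : ℕ) (hq : 1 ≤ q) (hk : k * (p + q) ≤ n) (s : ℝ) (hs : 0 ≤ s) (hη : s * (p * M) ≤ 1) :
    ‖∫ ω, ce (s * ∑ t ∈ Finset.range n, h (Z t ω)) ∂P -
      (Real.exp (-(k * (s ^ 2 * ∫ ω, (∑ i ∈ Finset.range p, h (Z i ω)) ^ 2 ∂P)) / 2) : ℂ)‖ ≤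
    s * √((n - k * p) * V) + k * (2 * (|C| * (q : ℝ) ^ (-r))) +
      4 * (s * (p * M)) * (k * (s ^ 2 * ∫ ω, (∑ i ∈ Finset.range p, h (Z i ω)) ^ 2 ∂P)) := by
  have := S.prob
  have hX : ∀ t, Measurable (fun ω => h (Z t ω)) := fun t => hh.comp (S.meas t)
  have iX : ∀ t, Integrable (fun ω => h (Z t ω)) P := fun t =>
    Integrable.of_bound (hX t).aestronglyMeasurable M (.of_forall fun ω => hM _)
  have EX : ∀ t, ∫ ω, h (Z t ω) ∂P = 0 := fun t => (S.integral_one t hh.stronglyMeasurable).trans h0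
  have hsumb : ∀ (A : Finset ℕ) ω, |∑ t ∈ A, h (Z t ω)| ≤ A.card * M := by
    intro A ω
    refine (Finset.abs_sum_le_sum_abs _ _).trans ((Finset.sum_le_sum fun t _ => hM (Z t ω)).trans ?_)
    simp
  have hsm : ∀ A : Finset ℕ, Measurable (fun ω => ∑ t ∈ A, h (Z t ω)) := fun A =>
    Finset.measurable_fun_sum _ fun t _ => hX t
  set ψ := ∫ ω, ce (s * ∑ i ∈ Finset.range p, h (Z i ω)) ∂P with hψ
  set v := s ^ 2 * ∫ ω, (∑ i ∈ Finset.range p, h (Z i ω)) ^ 2 ∂P with hv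
  have hv0 : 0 ≤ v := mul_nonneg (sq_nonneg _) (integral_nonneg fun ω => sq_nonneg _)
  -- blocks
  set e : ℕ × ℕ → ℕ := fun x => x.1 * (p + q) + q + x.2 with he
  have hinj : Set.InjOn e (Finset.range k ×ˢ Finset.range p : Finset (ℕ × ℕ)) := by
    rintro ⟨j, i⟩ h1 ⟨j', i'⟩ h2 h3
    simp only [Finset.coe_product, Finset.coe_range, Set.mem_prod, Set.mem_Iio] at h1 h2
    simp only [he] at h3
    have hj : j = j' := by
      rcases lt_trichotomy j j' with h | h | h
      · have : (j + 1) * (p + q) ≤ j' * (p + q) := Nat.mul_le_mul_right _ h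
        rw [add_mul] at this
        omega
      · exact h
      · have : (j' + 1) * (p + q) ≤ j * (p + q) := Nat.mul_le_mul_right _ h
        rw [add_mul] at this
        omega
    subst hj
    ext <;> simp; omega
  set B := (Finset.range k ×ˢ Finset.range p).image e with hB
  have hBc : B.card = k * p := by
    rw [hB, Finset.card_image_of_injOn hinj, Finset.card_product]; simp
  have hBn : B ⊆ Finset.range n := by
    intro t ht
    obtain ⟨⟨j, i⟩, hx, rfl⟩ := Finset.mem_image.1 ht
    simp only [Finset.mem_product, Finset.mem_range] at hx
    have : (j + 1) * (p + q) ≤ k * (p + q) := Nat.mul_le_mul_right _ hx.1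
    rw [add_mul] at this
    simp only [he, Finset.mem_range]
    omega
  have hBsum : ∀ ω, ∑ t ∈ B, h (Z t ω) = ∑ j ∈ Finset.range k, ∑ i ∈ Finset.range p,
      h (Z (j * (p + q) + q + i) ω) := by
    intro ω
    rw [hB, Finset.sum_image hinj, Finset.sum_product]
  have hAc : ((Finset.range n \ B).card : ℝ) = n - k * p := by
    rw [Finset.card_sdiff_of_subset hBn, Finset.card_range, Nat.cast_sub, hBc]
    · push_cast; ring
    · simpa using Finset.card_le_card hBn
  have ice : ∀ A : Finset ℕ, Integrable (fun ω => ce (s * ∑ t ∈ A, h (Z t ω))) P := fun A =>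
    Integrable.of_bound (continuous_ce.measurable.comp ((hsm A).const_mul s)).aestronglyMeasurable 1
      (.of_forall fun ω => (ce_norm _).le)
  have t1 : ‖∫ ω, ce (s * ∑ t ∈ Finset.range n, h (Z t ω)) ∂P - ∫ ω, ce (s * ∑ t ∈ B, h (Z t ω)) ∂P‖
      ≤ s * √((n - k * p) * V) := by
    rw [← integral_sub (ice _) (ice _)]
    have iabs : Integrable (fun ω => |∑ t ∈ Finset.range n \ B, h (Z t ω)|) P :=
      (integrable_finsetSum _ fun t _ => iX t).abs
    have : ∀ ω, ‖ce (s * ∑ t ∈ Finset.range n, h (Z t ω)) - ce (s * ∑ t ∈ B, h (Z t ω))‖ ≤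
        s * |∑ t ∈ Finset.range n \ B, h (Z t ω)| := by
      intro ω
      refine (ce_sub_le _ _).trans ?_
      rw [← mul_sub, abs_mul, abs_of_nonneg hs, ← Finset.sum_sdiff hBn]
      simp
    refine (norm_integral_le_of_norm_le (iabs.const_mul s) (.of_forall this)).trans ?_
    rw [integral_const_mul]
    gcongr
    refine (integral_abs_le_sqrt (hsm _).aestronglyMeasurable ?_).trans ?_
    · refine Integrable.of_bound ((hsm _).pow_const 2).aestronglyMeasurable
        (((Finset.range n \ B).card * M) ^ 2) (.of_forall fun ω => ?_)
      rw [Real.norm_of_nonneg (sq_nonneg _)]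
      exact sq_le_sq' (abs_le.1 (hsumb _ ω)).1 (abs_le.1 (hsumb _ ω)).2
    · rw [← hAc]
      exact Real.sqrt_le_sqrt (hV _)
  have t2 := S.block_prod hh p q hq s k
  simp_rw [← hBsum] at t2
  have t3 : ‖ψ - (Real.exp (-v / 2) : ℂ)‖ ≤ 4 * (s * (p * M)) * v := by
    have := char_small (P := P) (U := fun ω => s * ∑ i ∈ Finset.range p, h (Z i ω))
      ((hsm _).const_mul s) hη (fun ω => by
        rw [abs_mul, abs_of_nonneg hs]
        have := hsumb (Finset.range p) ω
        rw [Finset.card_range] at this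
        gcongr) (by
        rw [integral_const_mul, integral_finsetSum _ fun t _ => iX t]
        simp [EX])
    simp_rw [mul_pow] at this
    rw [integral_const_mul] at this
    exact this
  have hψ1 : ‖ψ‖ ≤ 1 := by
    refine (norm_integral_le_of_norm_le_const (.of_forall fun ω => (ce_norm _).le)).trans ?_
    simp
  have he1 : ‖(Real.exp (-v / 2) : ℂ)‖ ≤ 1 := by
    rw [Complex.norm_real, Real.norm_of_nonneg (Real.exp_nonneg _)]
    exact Real.exp_le_one_iff.2 (by linarith)
  have t4 := pow_sub_pow_norm_le hψ1 he1 k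
  have e5 : (Real.exp (-v / 2) : ℂ) ^ k = (Real.exp (-(k * v) / 2) : ℂ) := by
    rw [← Complex.ofReal_pow, ← Real.exp_nat_mul]
    congr 2; ring
  rw [e5] at t4
  have t5 : (k : ℝ) * ‖ψ - (Real.exp (-v / 2) : ℂ)‖ ≤ k * (4 * (s * (p * M)) * v) := by gcongr
  calc _ = ‖(∫ ω, ce (s * ∑ t ∈ Finset.range n, h (Z t ω)) ∂P -
            ∫ ω, ce (s * ∑ t ∈ B, h (Z t ω)) ∂P) +
          ((∫ ω, ce (s * ∑ t ∈ B, h (Z t ω)) ∂P) - ψ ^ k) +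
          (ψ ^ k - (Real.exp (-(k * v) / 2) : ℂ))‖ := by congr 1; ring
    _ ≤ _ := (norm_add₃_le).trans (add_le_add (add_le_add t1 t2) (t4.trans t5))
    _ = _ := by ring

end MixSetup
end



/-- sixth root -/
def rt (n : ℕ) : ℕ := Nat.findGreatest (fun m => m ^ 6 ≤ n) n

lemma rt_pow_le (n : ℕ) : rt n ^ 6 ≤ n :=
  Nat.findGreatest_spec (P := fun m => m ^ 6 ≤ n) (Nat.zero_le n) (by simp)

lemma le_rt {m n : ℕ} (h : m ^ 6 ≤ n) : m ≤ rt n :=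
  Nat.le_findGreatest ((Nat.le_self_pow (by norm_num) m).trans h) h

lemma lt_rt_succ (n : ℕ) : n < (rt n + 1) ^ 6 := by
  by_contra h
  have := le_rt (not_lt.1 h)
  omega

lemma tendsto_rt : Tendsto rt atTop atTop :=
  tendsto_atTop.2 fun b => (eventually_ge_atTop (b ^ 6)).mono fun _ h => le_rt h

lemma rt_estimates (n m k : ℕ) (hm : 1 ≤ m) (h1 : m ^ 6 ≤ n) (h2 : n < (m + 1) ^ 6)
    (hk : k = n / (m ^ 2 + m)) :
    k * (m ^ 2 + m) ≤ n ∧ (n : ℝ) - k * (m ^ 2 : ℕ) ≤ 3 * n / m ∧ (k : ℝ) ≤ 64 * (m : ℝ) ^ 4 := by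
  have a1 : k * (m ^ 2 + m) ≤ n := hk ▸ Nat.div_mul_le_self _ _
  have a2 : n < (k + 1) * (m ^ 2 + m) := by
    rw [hk, mul_comm]; exact Nat.lt_mul_div_succ _ (by positivity)
  have hm' : (1 : ℝ) ≤ m := by exact_mod_cast hm
  have b1 : (k : ℝ) * ((m : ℝ) ^ 2 + m) ≤ n := by exact_mod_cast a1
  have b2 : (n : ℝ) < (k + 1) * ((m : ℝ) ^ 2 + m) := by exact_mod_cast a2
  have b3 : (m : ℝ) ^ 6 ≤ n := by exact_mod_cast h1
  have b4 : (n : ℝ) < ((m : ℝ) + 1) ^ 6 := by exact_mod_cast h2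
  refine ⟨a1, ?_, ?_⟩
  · rw [le_div_iff₀ (by linarith)]
    push_cast
    have c1 : (k : ℝ) * m * m ≤ n := by nlinarith [(k.cast_nonneg : (0 : ℝ) ≤ k)]
    have c2 : ((m : ℝ) ^ 2 + m) * m ≤ 2 * n := by
      have : (m : ℝ) ^ 3 ≤ (m : ℝ) ^ 6 := pow_le_pow_right₀ hm' (by norm_num)
      have : (m : ℝ) ^ 2 ≤ (m : ℝ) ^ 3 := pow_le_pow_right₀ hm' (by norm_num)
      nlinarith
    have c3 : ((n : ℝ) - k * (m : ℝ) ^ 2) * m ≤ (k * m + ((m : ℝ) ^ 2 + m)) * m := by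
      gcongr; linarith
    linarith
  · have c1 : ((m : ℝ) + 1) ^ 6 ≤ (2 * m) ^ 6 := by gcongr; linarith
    have c2 : (k : ℝ) * (m : ℝ) ^ 2 ≤ 64 * (m : ℝ) ^ 4 * (m : ℝ) ^ 2 := by
      have : (0 : ℝ) ≤ k * m := by positivity
      calc (k : ℝ) * (m : ℝ) ^ 2 ≤ n := by linarith
        _ ≤ (2 * m) ^ 6 := by linarith
        _ = _ := by ring
    exact le_of_mul_le_mul_right c2 (by positivity)

section
variable {Ω 𝒵 : Type*} [mΩ : MeasurableSpace Ω] [m𝒵 : MeasurableSpace 𝒵] {P : Measure Ω}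
    {Z : ℕ → Ω → 𝒵} {C r ε : ℝ}
namespace MixSetup

lemma clt_bdd (S : MixSetup P Z C r ε) {h : 𝒵 → ℝ} (hh : Measurable h) {M V : ℝ}
    (hM : ∀ z, |h z| ≤ M) (h0 : ∫ ω, h (Z 0 ω) ∂P = 0) (hV0 : 0 ≤ V)
    (hV : ∀ A : Finset ℕ, ∫ ω, (∑ t ∈ A, h (Z t ω)) ^ 2 ∂P ≤ A.card * V) (σ2 : ℝ)
    (hσ : Tendsto (fun n : ℕ => (n : ℝ)⁻¹ * ∫ ω, (∑ t ∈ Finset.range n, h (Z t ω)) ^ 2 ∂P)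
      atTop (𝓝 σ2)) :
    Tendsto (fun n : ℕ => ∫ ω, ce ((√n)⁻¹ * ∑ t ∈ Finset.range n, h (Z t ω)) ∂P) atTop
      (𝓝 (Real.exp (-σ2 / 2) : ℂ)) := by
  have := S.prob
  obtain ⟨ω0⟩ : Nonempty Ω := nonempty_of_isProbabilityMeasure P
  have hM0 : 0 ≤ M := (abs_nonneg _).trans (hM (Z 0 ω0))
  set k : ℕ → ℕ := fun n => n / (rt n ^ 2 + rt n) with hk
  set W : ℕ → ℝ := fun p => ∫ ω, (∑ t ∈ Finset.range p, h (Z t ω)) ^ 2 ∂P with hW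
  set kv : ℕ → ℝ := fun n => k n * (((√(n : ℝ))⁻¹) ^ 2 * W (rt n ^ 2)) with hkv
  have hrt : Tendsto (fun n => (rt n : ℝ)) atTop atTop :=
    tendsto_natCast_atTop_atTop.comp tendsto_rt
  have hinv : Tendsto (fun n => ((rt n : ℝ))⁻¹) atTop (𝓝 0) := tendsto_inv_atTop_zero.comp hrt
  have hge : ∀ᶠ n in atTop, 1 ≤ rt n := tendsto_rt.eventually_ge_atTop 1
  have hge' : ∀ᶠ n : ℕ in atTop, (M + 1 : ℝ) ≤ rt n := hrt.eventually_ge_atTop _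
  -- ratio
  have hratio : Tendsto (fun n : ℕ => (k n * (rt n ^ 2 : ℕ) : ℝ) / n) atTop (𝓝 1) := by
    have l1 : Tendsto (fun n => 1 - 3 * ((rt n : ℝ))⁻¹) atTop (𝓝 (1 - 3 * 0)) :=
      tendsto_const_nhds.sub (hinv.const_mul 3)
    rw [mul_zero, sub_zero] at l1
    refine tendsto_of_tendsto_of_tendsto_of_le_of_le' l1 tendsto_const_nhds ?_ ?_
    · filter_upwards [hge, eventually_ge_atTop 1] with n h1 h2
      have := (rt_estimates n (rt n) (k n) h1 (rt_pow_le n) (lt_rt_succ n) rfl).2.1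
      have hn : (0 : ℝ) < n := by exact_mod_cast h2
      rw [le_div_iff₀ hn]
      have e : 3 * (n : ℝ) / rt n = 3 * (rt n : ℝ)⁻¹ * n := by field_simp
      rw [e] at this
      linarith
    · filter_upwards [hge, eventually_ge_atTop 1] with n h1 h2
      have := (rt_estimates n (rt n) (k n) h1 (rt_pow_le n) (lt_rt_succ n) rfl).1
      have hn : (0 : ℝ) < n := by exact_mod_cast h2
      rw [div_le_one hn]
      have h3 : k n * rt n ^ 2 ≤ n := le_trans (Nat.mul_le_mul_left _ (by omega)) this
      exact_mod_cast h3
  have hp : Tendsto (fun n => rt n ^ 2) atTop atTop :=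
    (tendsto_pow_atTop two_ne_zero).comp tendsto_rt
  have hkvl : Tendsto kv atTop (𝓝 σ2) := by
    have := hratio.mul (hσ.comp hp)
    rw [one_mul] at this
    refine this.congr' ?_
    filter_upwards [hge, eventually_ge_atTop 1] with n h1 h2
    have hn : (0 : ℝ) < n := by exact_mod_cast h2
    have hp0 : ((rt n ^ 2 : ℕ) : ℝ) ≠ 0 := by positivity
    simp only [hkv, Function.comp, inv_pow, Real.sq_sqrt hn.le]
    rw [div_mul_eq_mul_div, div_eq_inv_mul]
    field_simp
    rfl
  have hlim : Tendsto (fun n => ((Real.exp (-(kv n) / 2) : ℝ) : ℂ)) atTop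
      (𝓝 (Real.exp (-σ2 / 2) : ℂ)) :=
    (Complex.continuous_ofReal.tendsto _).comp
      ((Real.continuous_exp.tendsto _).comp (hkvl.neg.div_const 2))
  -- the error
  have herr : Tendsto (fun n => √(3 * V * (rt n : ℝ)⁻¹) + 128 * |C| * (rt n : ℝ)⁻¹ +
      4 * (M * (rt n : ℝ)⁻¹) * kv n) atTop (𝓝 0) := by
    have a1 : Tendsto (fun n => √(3 * V * (rt n : ℝ)⁻¹)) atTop (𝓝 (√(3 * V * 0))) :=
      (Real.continuous_sqrt.tendsto _).comp (hinv.const_mul _)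
    have a2 : Tendsto (fun n => 128 * |C| * (rt n : ℝ)⁻¹) atTop (𝓝 (128 * |C| * 0)) :=
      hinv.const_mul _
    have a3 := ((hinv.const_mul M).const_mul 4).mul hkvl
    simpa using (a1.add a2).add a3
  have hdiff : Tendsto (fun n : ℕ => ∫ ω, ce ((√n)⁻¹ * ∑ t ∈ Finset.range n, h (Z t ω)) ∂P -
      ((Real.exp (-(kv n) / 2) : ℝ) : ℂ)) atTop (𝓝 0) := by
    refine squeeze_zero_norm' ?_ herr
    filter_upwards [hge, hge', eventually_ge_atTop 1] with n h1 h1' h2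
    obtain ⟨g1, g2, g3⟩ := rt_estimates n (rt n) (k n) h1 (rt_pow_le n) (lt_rt_succ n) rfl
    have hn : (0 : ℝ) < n := by exact_mod_cast h2
    have hm1 : (1 : ℝ) ≤ rt n := by exact_mod_cast h1
    have hm0 : (0 : ℝ) < rt n := by linarith
    have hsq : (rt n : ℝ) ^ 3 ≤ √n := by
      apply Real.le_sqrt_of_sq_le
      rw [← pow_mul]
      exact_mod_cast rt_pow_le n
    have hsn : 0 < √(n : ℝ) := Real.sqrt_pos.2 hn
    have η1 : (√(n : ℝ))⁻¹ * ((rt n ^ 2 : ℕ) * M) ≤ M * (rt n : ℝ)⁻¹ := by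
      have : (√(n : ℝ))⁻¹ ≤ ((rt n : ℝ) ^ 3)⁻¹ := inv_anti₀ (by positivity) hsq
      calc _ ≤ ((rt n : ℝ) ^ 3)⁻¹ * ((rt n ^ 2 : ℕ) * M) := by gcongr
        _ = _ := by push_cast; field_simp
    have η2 : M * (rt n : ℝ)⁻¹ ≤ 1 := by
      rw [← div_eq_mul_inv, div_le_one hm0]; linarith
    have key := S.clt_block hh hM h0 hV (rt n ^ 2) (rt n) (k n) n h1 g1 (√(n : ℝ))⁻¹
      (by positivity) (η1.trans η2)
    refine key.trans ?_
    have kv0 : 0 ≤ kv n := by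
      have : 0 ≤ W (rt n ^ 2) := integral_nonneg fun ω => sq_nonneg _
      simp only [hkv]; positivity
    refine add_le_add (add_le_add ?_ ?_) ?_
    · rw [← Real.sqrt_inv, ← Real.sqrt_mul (by positivity)]
      apply Real.sqrt_le_sqrt
      calc (n : ℝ)⁻¹ * ((n - k n * (rt n ^ 2 : ℕ)) * V) ≤ (n : ℝ)⁻¹ * ((3 * n / rt n) * V) := by
            gcongr
        _ = _ := by field_simp
    · have hr6 : (6 : ℝ) < r := by
        have := S.hr
        have hε := S.eps
        have : 0 < 2 / ε := by positivity
        linarith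
      have c1 : (rt n : ℝ) ^ (-r) ≤ ((rt n : ℝ) ^ 6)⁻¹ := by
        have : (rt n : ℝ) ^ (-r) ≤ (rt n : ℝ) ^ (-(6 : ℝ)) :=
          Real.rpow_le_rpow_of_exponent_le hm1 (by linarith)
        refine this.trans (le_of_eq ?_)
        rw [Real.rpow_neg hm0.le]; norm_cast
      calc (k n : ℝ) * (2 * (|C| * (rt n : ℝ) ^ (-r))) ≤
          (64 * (rt n : ℝ) ^ 4) * (2 * (|C| * ((rt n : ℝ) ^ 6)⁻¹)) := by gcongr
        _ = 128 * |C| * ((rt n : ℝ)⁻¹ * (rt n : ℝ)⁻¹) := by field_simp; ring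
        _ ≤ 128 * |C| * ((rt n : ℝ)⁻¹ * 1) := by
            gcongr
            exact inv_le_one_of_one_le₀ hm1
        _ = _ := by ring
    · change 4 * _ * kv n ≤ _
      gcongr
  simpa using hdiff.add hlim

end MixSetup
end



lemma tendsto_of_approx {E : Type*} [NormedAddCommGroup E] {A : ℕ → ℕ → E} {a : ℕ → E}
    {L : ℕ → E} {l : E} {e : ℕ → ℝ} (h1 : ∀ M, Tendsto (A M) atTop (𝓝 (L M)))
    (h2 : ∀ M n, ‖a n - A M n‖ ≤ e M) (he : Tendsto e atTop (𝓝 0))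
    (hL : Tendsto L atTop (𝓝 l)) : Tendsto a atTop (𝓝 l) := by
  rw [Metric.tendsto_atTop]
  intro δ hδ
  have e1 : ∀ᶠ M in atTop, e M < δ / 3 := he.eventually_lt_const (by positivity)
  have e2 : ∀ᶠ M in atTop, dist (L M) l < δ / 3 := (Metric.tendsto_nhds.1 hL) _ (by positivity)
  obtain ⟨M, hM1, hM2⟩ := (e1.and e2).exists
  obtain ⟨N, hN⟩ := Metric.tendsto_atTop.1 (h1 M) (δ / 3) (by positivity)
  refine ⟨N, fun n hn => ?_⟩
  have h3 := hN n hn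
  have h4 := h2 M n
  rw [← dist_eq_norm] at h4
  calc dist (a n) l ≤ dist (a n) (A M n) + dist (A M n) (L M) + dist (L M) l :=
        dist_triangle4 _ _ _ _
    _ < δ := by linarith

lemma mom_iff {Ω : Type*} [mΩ : MeasurableSpace Ω] {P : Measure Ω} {E : Type*}
    [NormedAddCommGroup E] {a : Ω → E} (ham : AEStronglyMeasurable a P) {p : ℝ} (hp : 0 < p) :
    Integrable (fun ω => ‖a ω‖ ^ p) P ↔ MemLp a (ENNReal.ofReal p) P := by
  have := integrable_norm_rpow_iff (p := ENNReal.ofReal p) ham (by simpa using hp) (by simp)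
  rwa [ENNReal.toReal_ofReal hp.le] at this

section
variable {Ω 𝒵 : Type*} [mΩ : MeasurableSpace Ω] [m𝒵 : MeasurableSpace 𝒵] {P : Measure Ω}
    {Z : ℕ → Ω → 𝒵} {C r ε : ℝ}
namespace MixSetup

lemma integral_sum_mul (S : MixSetup P Z C r ε) {f g : 𝒵 → ℝ} (hf : StronglyMeasurable f)
    (hg : StronglyMeasurable g)
    (hfi : Integrable (fun ω => ‖f (Z 0 ω)‖ ^ (2 + 2 * ε)) P)
    (hi : Integrable (fun ω => ‖g (Z 0 ω)‖ ^ (2 + 2 * ε)) P) (A : Finset ℕ) :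
    ∫ ω, (∑ t ∈ A, f (Z t ω)) * (∑ u ∈ A, g (Z u ω)) ∂P =
      ∑ t ∈ A, ∑ u ∈ A, ∫ ω, f (Z t ω) * g (Z u ω) ∂P := by
  have h : ∀ t u, Integrable (fun ω => f (Z t ω) * g (Z u ω)) P := fun t u => by
    have := S.integrable_inner hf hg hfi hi t u
    simpa [mul_comm] using this
  simp_rw [Finset.sum_mul_sum]
  rw [integral_finsetSum _ fun t _ => integrable_finsetSum _ fun u _ => h t u]
  refine Finset.sum_congr rfl fun t _ => ?_
  rw [integral_finsetSum _ fun u _ => h t u]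

/-- scalar CLT -/
lemma clt (S : MixSetup P Z C r ε) {h : 𝒵 → ℝ} (hh : Measurable h)
    (hi : Integrable (fun ω => ‖h (Z 0 ω)‖ ^ (2 + 2 * ε)) P)
    (h0 : ∫ ω, h (Z 0 ω) ∂P = 0) (σ2 : ℝ)
    (hσ : Tendsto (fun n : ℕ => (n : ℝ)⁻¹ * ∫ ω, (∑ t ∈ Finset.range n, h (Z t ω)) ^ 2 ∂P)
      atTop (𝓝 σ2)) :
    Tendsto (fun n : ℕ => ∫ ω, ce ((√n)⁻¹ * ∑ t ∈ Finset.range n, h (Z t ω)) ∂P) atTop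
      (𝓝 (Real.exp (-σ2 / 2) : ℂ)) := by
  have := S.prob
  have hε := S.eps
  have hp : 0 < 2 + 2 * ε := by positivity
  have hX : ∀ t, Measurable (fun ω => h (Z t ω)) := fun t => hh.comp (S.meas t)
  have hs := hh.stronglyMeasurable
  have iX : Integrable (fun ω => h (Z 0 ω)) P :=
    integrable_of_moment hε (hX 0).aestronglyMeasurable hi
  set E1 := ∫ ω, |h (Z 0 ω)| ∂P with hE1
  -- truncation
  set c : ℕ → ℝ := fun M => ∫ ω, trunc (M : ℝ) (h (Z 0 ω)) ∂P with hc
  set b : ℕ → 𝒵 → ℝ := fun M z => trunc (M : ℝ) (h z) - c M with hb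
  set g : ℕ → 𝒵 → ℝ := fun M z => h z - b M z with hg
  have htm : ∀ M : ℕ, Measurable (fun z => trunc (M : ℝ) (h z)) := fun M =>
    (stronglyMeasurable_trunc hs).measurable
  have hbm : ∀ M, Measurable (b M) := fun M => (htm M).sub_const _
  have hgm : ∀ M, Measurable (g M) := fun M => hh.sub (hbm M)
  have itr : ∀ M : ℕ, Integrable (fun ω => trunc (M : ℝ) (h (Z 0 ω))) P := fun M =>
    Integrable.of_bound ((htm M).comp (S.meas 0)).aestronglyMeasurable M
      (.of_forall fun ω => norm_trunc_le (Nat.cast_nonneg M) _)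
  have hcM : ∀ M, |c M| ≤ M := fun M => by
    rw [← Real.norm_eq_abs]
    refine (norm_integral_le_of_norm_le_const
      (.of_forall fun ω => norm_trunc_le (Nat.cast_nonneg M) _)).trans ?_
    simp
  have hcE : ∀ M, |c M| ≤ E1 := fun M => by
    rw [← Real.norm_eq_abs]
    refine (norm_integral_le_of_norm_le iX.abs (.of_forall fun ω => ?_))
    exact norm_trunc_le_self _
  have hbb : ∀ M z, |b M z| ≤ 2 * M := fun M z => by
    have h1 := norm_trunc_le (Nat.cast_nonneg M) (h z)
    rw [Real.norm_eq_abs] at h1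
    have h2 := hcM M
    rw [abs_le] at *
    constructor <;> simp only [hb] <;> linarith
  have b0 : ∀ M, ∫ ω, b M (Z 0 ω) ∂P = 0 := fun M => by
    simp only [hb]
    rw [integral_sub (itr M) (integrable_const _)]
    simp [hc]
  have ib : ∀ M, Integrable (fun ω => b M (Z 0 ω)) P := fun M => (itr M).sub (integrable_const _)
  have g0 : ∀ M, ∫ ω, g M (Z 0 ω) ∂P = 0 := fun M => by
    simp only [hg]
    rw [integral_sub iX (ib M), h0, b0, sub_zero]
  have hgb : ∀ M z, |g M z| ≤ |h z| + E1 := fun M z => by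
    have e : g M z = (h z - trunc (M : ℝ) (h z)) + c M := by simp only [hg, hb]; ring
    rw [e]
    refine (abs_add_le _ _).trans (add_le_add ?_ (hcE M))
    exact norm_sub_trunc_le_self (h z)
  have hE10 : 0 ≤ E1 := integral_nonneg fun ω => abs_nonneg _
  -- uniform envelope
  have iH : Integrable (fun ω => ‖|h (Z 0 ω)| + E1‖ ^ (2 + 2 * ε)) P := by
    rw [mom_iff ((hX 0).abs.add_const _).aestronglyMeasurable hp]
    rw [mom_iff (hX 0).aestronglyMeasurable hp] at hi
    exact hi.abs.add (memLp_const E1)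
  set K := ∫ ω, ‖|h (Z 0 ω)| + E1‖ ^ (2 + 2 * ε) ∂P with hK
  have hle : ∀ M ω, ‖g M (Z 0 ω)‖ ^ (2 + 2 * ε) ≤ ‖|h (Z 0 ω)| + E1‖ ^ (2 + 2 * ε) := by
    intro M ω
    gcongr
    rw [Real.norm_eq_abs, Real.norm_of_nonneg (by positivity)]
    exact hgb M _
  have ig : ∀ M, Integrable (fun ω => ‖g M (Z 0 ω)‖ ^ (2 + 2 * ε)) P := fun M => by
    refine Integrable.mono' iH
      (((hgm M).comp (S.meas 0)).norm.pow_const _).aestronglyMeasurable (.of_forall fun ω => ?_)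
    rw [Real.norm_of_nonneg (by positivity)]
    exact hle M ω
  have gK : ∀ M, ∫ ω, ‖g M (Z 0 ω)‖ ^ (2 + 2 * ε) ∂P ≤ K := fun M =>
    integral_mono (ig M) iH (hle M)
  have hK0 : 0 ≤ K := integral_nonneg fun ω => by positivity
  set τ : ℕ → ℝ := fun M => ∫ ω, ‖g M (Z 0 ω)‖ ^ 2 ∂P with hτ
  have hτ0 : ∀ M, 0 ≤ τ M := fun M => integral_nonneg fun ω => by positivity
  have hcl : Tendsto c atTop (𝓝 0) := by
    rw [← h0]
    refine tendsto_integral_of_dominated_convergence (fun ω => |h (Z 0 ω)|)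
      (fun M => ((htm M).comp (S.meas 0)).aestronglyMeasurable) iX.abs
      (fun M => .of_forall fun ω => norm_trunc_le_self _) (.of_forall fun ω => ?_)
    refine tendsto_const_nhds.congr' ?_
    obtain ⟨N, hN⟩ := exists_nat_ge ‖h (Z 0 ω)‖
    filter_upwards [eventually_ge_atTop N] with M hM
    rw [trunc_of_le]
    exact hN.trans (by exact_mod_cast hM)
  have hgl : ∀ z, Tendsto (fun M => g M z) atTop (𝓝 0) := by
    intro z
    refine hcl.congr' ?_
    obtain ⟨N, hN⟩ := exists_nat_ge ‖h z‖
    filter_upwards [eventually_ge_atTop N] with M hM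
    simp only [hg, hb]
    rw [trunc_of_le]
    · ring
    · exact hN.trans (by exact_mod_cast hM)
  have hτl : Tendsto τ atTop (𝓝 0) := by
    have : (0 : ℝ) = ∫ ω, (0 : ℝ) ∂P := by simp
    rw [this]
    refine tendsto_integral_of_dominated_convergence (fun ω => ‖|h (Z 0 ω)| + E1‖ ^ 2)
      (fun M => (((hgm M).comp (S.meas 0)).norm.pow_const _).aestronglyMeasurable)
      (integrable_sq_of_moment hε ((hX 0).abs.add_const _).aestronglyMeasurable iH)
      (fun M => .of_forall fun ω => ?_) (.of_forall fun ω => ?_)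
    · rw [Real.norm_of_nonneg (by positivity)]
      gcongr
      rw [Real.norm_eq_abs, Real.norm_of_nonneg (by positivity)]
      exact hgb M _
    · have := ((hgl (Z 0 ω)).norm).pow 2
      simpa using this
  set Q : ℝ := 2 * |C| + 3 * K with hQ
  have hQ0 : 0 ≤ Q := by positivity
  have hΨl : Tendsto (fun M => Psi Q (τ M)) atTop (𝓝 0) :=
    (Psi_tendsto hQ0).comp (tendsto_nhdsWithin_iff.2 ⟨hτl, .of_forall hτ0⟩)
  have hΨ0 : ∀ M, 0 ≤ Psi Q (τ M) := fun M => Psi_nonneg hQ0 (hτ0 M)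
  have varg : ∀ M (A : Finset ℕ), ∫ ω, (∑ t ∈ A, g M (Z t ω)) ^ 2 ∂P ≤ A.card * Psi Q (τ M) :=
    fun M A => by
      have := S.var_bound (hgm M).stronglyMeasurable (ig M) (gK M) (g0 M) le_rfl A
      simpa [hQ, hτ] using this
  have varh := fun A => S.var_bound hs hi le_rfl h0 le_rfl A
  set Vh := Psi (2 * |C| + 3 * ∫ ω, ‖h (Z 0 ω)‖ ^ (2 + 2 * ε) ∂P) (∫ ω, ‖h (Z 0 ω)‖ ^ 2 ∂P) with hVh
  have ibm : ∀ M, Integrable (fun ω => ‖b M (Z 0 ω)‖ ^ (2 + 2 * ε)) P := fun M => by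
    refine Integrable.of_bound (((hbm M).comp (S.meas 0)).norm.pow_const _).aestronglyMeasurable
      ((2 * M) ^ (2 + 2 * ε)) (.of_forall fun ω => ?_)
    rw [Real.norm_of_nonneg (by positivity)]
    gcongr
    exact hbb M _
  have varb := fun M A => S.var_bound (hbm M).stronglyMeasurable (ibm M) le_rfl (b0 M) le_rfl A
  choose σM hσM using fun M => S.exists_lrcov (hbm M).stronglyMeasurable (hbm M).stronglyMeasurable
    (ibm M) (ibm M) (b0 M) (b0 M)
  have hσM' : ∀ M, Tendsto (fun n : ℕ => (n : ℝ)⁻¹ *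
      ∫ ω, (∑ t ∈ Finset.range n, b M (Z t ω)) ^ 2 ∂P) atTop (𝓝 (σM M)) := by
    intro M
    refine (hσM M).congr fun n => ?_
    rw [← S.integral_sum_mul (hbm M).stronglyMeasurable (hbm M).stronglyMeasurable (ibm M) (ibm M)]
    simp_rw [sq]
  have hclt : ∀ M, Tendsto (fun n : ℕ => ∫ ω, ce ((√n)⁻¹ * ∑ t ∈ Finset.range n, b M (Z t ω)) ∂P)
      atTop (𝓝 (Real.exp (-(σM M) / 2) : ℂ)) := fun M =>
    S.clt_bdd (hbm M) (hbb M) (b0 M)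
      (V := Psi (2 * |C| + 3 * ∫ ω, ‖b M (Z 0 ω)‖ ^ (2 + 2 * ε) ∂P) (∫ ω, ‖b M (Z 0 ω)‖ ^ 2 ∂P))
      (Psi_nonneg (by
        have : 0 ≤ ∫ ω, ‖b M (Z 0 ω)‖ ^ (2 + 2 * ε) ∂P := integral_nonneg fun ω => by positivity
        positivity) (integral_nonneg fun ω => by positivity))
      (fun A => by simpa using varb M A) _ (hσM' M)
  have hsplit : ∀ M n ω, ∑ t ∈ Finset.range n, h (Z t ω) =
      ∑ t ∈ Finset.range n, b M (Z t ω) + ∑ t ∈ Finset.range n, g M (Z t ω) := by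
    intro M n ω
    rw [← Finset.sum_add_distrib]
    refine Finset.sum_congr rfl fun t _ => ?_
    simp [hg]
  have ish : ∀ n, Integrable (fun ω => (∑ t ∈ Finset.range n, h (Z t ω)) ^ 2) P := fun n => by
    simpa using S.integrable_norm_sum_sq hs hi (Finset.range n)
  have isg : ∀ M n, Integrable (fun ω => (∑ t ∈ Finset.range n, g M (Z t ω)) ^ 2) P := fun M n => by
    simpa using S.integrable_norm_sum_sq (hgm M).stronglyMeasurable (ig M) (Finset.range n)
  have isb : ∀ M n, Integrable (fun ω => (∑ t ∈ Finset.range n, b M (Z t ω)) ^ 2) P := fun M n => by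
    simpa using S.integrable_norm_sum_sq (hbm M).stronglyMeasurable (ibm M) (Finset.range n)
  -- variances converge
  set δ : ℕ → ℝ := fun M => √(Psi Q (τ M)) + ((M : ℝ) + 1)⁻¹ with hδ
  have hδ0 : ∀ M, 0 < δ M := fun M => by simp only [hδ]; positivity
  have hδl : Tendsto δ atTop (𝓝 0) := by
    have a1 : Tendsto (fun M => √(Psi Q (τ M))) atTop (𝓝 (√0)) :=
      (Real.continuous_sqrt.tendsto _).comp hΨl
    have a2 : Tendsto (fun M : ℕ => ((M : ℝ) + 1)⁻¹) atTop (𝓝 0) := by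
      simpa using tendsto_one_div_add_atTop_nhds_zero_nat (𝕜 := ℝ)
    simpa using a1.add a2
  have hδΨ : ∀ M, (δ M)⁻¹ * Psi Q (τ M) ≤ δ M := by
    intro M
    rw [inv_mul_le_iff₀ (hδ0 M), ← sq]
    calc Psi Q (τ M) = √(Psi Q (τ M)) ^ 2 := (Real.sq_sqrt (hΨ0 M)).symm
      _ ≤ δ M ^ 2 := by
        gcongr
        simp only [hδ]
        have : 0 < ((M : ℝ) + 1)⁻¹ := by positivity
        linarith
  have hvd : ∀ (M n : ℕ), |(n : ℝ)⁻¹ * ∫ ω, (∑ t ∈ Finset.range n, h (Z t ω)) ^ 2 ∂P -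
      (n : ℝ)⁻¹ * ∫ ω, (∑ t ∈ Finset.range n, b M (Z t ω)) ^ 2 ∂P| ≤
      δ M + δ M * Vh + Psi Q (τ M) := by
    intro M n
    have hV0 : 0 ≤ Vh := by
      have := (integral_nonneg fun ω => by positivity).trans (varh {0})
      simpa using this
    rcases Nat.eq_zero_or_pos n with hn | hn
    · subst hn
      simp
      have := (hδ0 M).le
      have := hΨ0 M
      positivity
    have hn' : (0 : ℝ) < n := by exact_mod_cast hn
    rw [← mul_sub, ← integral_sub (ish n) (isb M n), abs_mul, abs_of_pos (inv_pos.2 hn'),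
      inv_mul_le_iff₀ hn']
    have hpt : ∀ ω, ‖(∑ t ∈ Finset.range n, h (Z t ω)) ^ 2 -
        (∑ t ∈ Finset.range n, b M (Z t ω)) ^ 2‖ ≤
        ((δ M)⁻¹ * (∑ t ∈ Finset.range n, g M (Z t ω)) ^ 2 +
          δ M * (∑ t ∈ Finset.range n, h (Z t ω)) ^ 2) +
          (∑ t ∈ Finset.range n, g M (Z t ω)) ^ 2 := by
      intro ω
      rw [hsplit M n ω]
      set x := ∑ t ∈ Finset.range n, b M (Z t ω)
      set y := ∑ t ∈ Finset.range n, g M (Z t ω)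
      have key : 2 * |y| * |x + y| ≤ (δ M)⁻¹ * y ^ 2 + δ M * (x + y) ^ 2 := by
        have hd := hδ0 M
        have e := sq_nonneg (|y| - δ M * |x + y|)
        have e2 : (δ M)⁻¹ * (|y| - δ M * |x + y|) ^ 2 =
            (δ M)⁻¹ * y ^ 2 + δ M * (x + y) ^ 2 - 2 * |y| * |x + y| := by
          rw [← sq_abs y, ← sq_abs (x + y)]
          field_simp; ring
        have : 0 ≤ (δ M)⁻¹ * (|y| - δ M * |x + y|) ^ 2 := by positivity
        linarith
      rw [Real.norm_eq_abs]
      have : (x + y) ^ 2 - x ^ 2 = 2 * y * (x + y) - y ^ 2 := by ring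
      rw [this]
      refine (abs_sub _ _).trans ?_
      rw [abs_mul, abs_mul, abs_two, abs_of_nonneg (sq_nonneg y)]
      linarith
    have I1 := ((isg M n).const_mul (δ M)⁻¹).add ((ish n).const_mul (δ M))
    refine (norm_integral_le_of_norm_le (I1.add (isg M n)) (.of_forall hpt)).trans ?_
    have e3 : ∫ ω, (((δ M)⁻¹ * (∑ t ∈ Finset.range n, g M (Z t ω)) ^ 2 +
          δ M * (∑ t ∈ Finset.range n, h (Z t ω)) ^ 2) +
          (∑ t ∈ Finset.range n, g M (Z t ω)) ^ 2) ∂P =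
        (δ M)⁻¹ * (∫ ω, (∑ t ∈ Finset.range n, g M (Z t ω)) ^ 2 ∂P) +
        δ M * (∫ ω, (∑ t ∈ Finset.range n, h (Z t ω)) ^ 2 ∂P) +
        ∫ ω, (∑ t ∈ Finset.range n, g M (Z t ω)) ^ 2 ∂P := by
      rw [← integral_const_mul, ← integral_const_mul,
        ← integral_add ((isg M n).const_mul (δ M)⁻¹) ((ish n).const_mul (δ M)),
        ← integral_add _ (isg M n)]
      exact I1
    refine (le_of_eq e3).trans ?_
    have v1 := varg M (Finset.range n)
    have v2 := varh (Finset.range n)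
    rw [Finset.card_range] at v1 v2
    simp only [Real.norm_eq_abs, sq_abs] at v2
    have hd := hδ0 M
    calc _ ≤ (δ M)⁻¹ * (n * Psi Q (τ M)) + δ M * (n * Vh) + n * Psi Q (τ M) := by
          have : ∫ ω, (∑ t ∈ Finset.range n, h (Z t ω)) ^ 2 ∂P ≤ n * Vh := by
            simpa [hVh] using v2
          gcongr
      _ = n * ((δ M)⁻¹ * Psi Q (τ M) + δ M * Vh + Psi Q (τ M)) := by ring
      _ ≤ _ := by
        gcongr
        exact hδΨ M
  have hσl : Tendsto σM atTop (𝓝 σ2) := by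
    have he : Tendsto (fun M => δ M + δ M * Vh + Psi Q (τ M)) atTop (𝓝 0) := by
      simpa using (hδl.add (hδl.mul_const Vh)).add hΨl
    rw [tendsto_iff_dist_tendsto_zero]
    refine squeeze_zero (fun M => dist_nonneg) (fun M => ?_) he
    have h1 := ((hσ.sub (hσM' M)).abs)
    have := le_of_tendsto h1 (.of_forall fun n => hvd M n)
    rwa [dist_comm, Real.dist_eq]
  refine tendsto_of_approx (e := fun M => √(Psi Q (τ M))) hclt ?_ ?_ ?_
  · intro M n
    have ice : ∀ f : 𝒵 → ℝ, Measurable f →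
        Integrable (fun ω => ce ((√(n : ℝ))⁻¹ * ∑ t ∈ Finset.range n, f (Z t ω))) P := fun f hf =>
      Integrable.of_bound (continuous_ce.measurable.comp ((Finset.measurable_fun_sum _ fun t _ =>
        hf.comp (S.meas t)).const_mul _)).aestronglyMeasurable 1 (.of_forall fun ω => (ce_norm _).le)
    rw [← integral_sub (ice h hh) (ice (b M) (hbm M))]
    rcases Nat.eq_zero_or_pos n with hn | hn
    · subst hn; simp
    have hn' : (0 : ℝ) < n := by exact_mod_cast hn
    have hgsm : Measurable (fun ω => ∑ t ∈ Finset.range n, g M (Z t ω)) :=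
      Finset.measurable_fun_sum _ fun t _ => (hgm M).comp (S.meas t)
    have iabs : Integrable (fun ω => |∑ t ∈ Finset.range n, g M (Z t ω)|) P :=
      (((memLp_two_iff_integrable_sq hgsm.aestronglyMeasurable).2 (isg M n)).integrable
        (by norm_num)).abs
    have hpt : ∀ ω, ‖ce ((√(n : ℝ))⁻¹ * ∑ t ∈ Finset.range n, h (Z t ω)) -
        ce ((√(n : ℝ))⁻¹ * ∑ t ∈ Finset.range n, b M (Z t ω))‖ ≤
        (√(n : ℝ))⁻¹ * |∑ t ∈ Finset.range n, g M (Z t ω)| := by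
      intro ω
      refine (ce_sub_le _ _).trans ?_
      rw [← mul_sub, abs_mul, abs_of_nonneg (by positivity), hsplit M n ω, add_sub_cancel_left]
    refine (norm_integral_le_of_norm_le (iabs.const_mul _) (.of_forall hpt)).trans ?_
    rw [integral_const_mul, inv_mul_le_iff₀ (Real.sqrt_pos.2 hn'), ← Real.sqrt_mul hn'.le]
    refine (integral_abs_le_sqrt hgsm.aestronglyMeasurable (isg M n)).trans ?_
    apply Real.sqrt_le_sqrt
    simpa using varg M (Finset.range n)
  · have a1 : Tendsto (fun M => √(Psi Q (τ M))) atTop (𝓝 (√0)) :=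
      (Real.continuous_sqrt.tendsto _).comp hΨl
    simpa using a1
  · exact (Complex.continuous_ofReal.tendsto _).comp
      ((Real.continuous_exp.tendsto _).comp (hσl.neg.div_const 2))

end MixSetup
end


/-- Positive semidefinite real kernel. -/
def PSDk {X : Type*} (g : X → X → ℝ) : Prop :=
  (∀ x y, g x y = g y x) ∧
    ∀ c : X →₀ ℝ, 0 ≤ ∑ x ∈ c.support, ∑ y ∈ c.support, c x * c y * g x y

universe uX

theorem gram_exists {X : Type uX} {g : X → X → ℝ} (hg : PSDk g) :
    ∃ (H : Type uX) (_ : NormedAddCommGroup H) (_ : InnerProductSpace ℝ H) (_ : CompleteSpace H)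
      (v : X → H), ∀ x y, inner ℝ (v x) (v y) = g x y := by
  let K : Matrix X X (ℝ →L[ℝ] ℝ) := Matrix.of fun x y => g x y • ContinuousLinearMap.id ℝ ℝ
  have hK : K.PosSemidef := by
    have h02 := (RKHS.posSemidef_tfae (K := K)).out 0 2
    refine h02.mpr (And.intro ?_ fun vv => ?_)
    · ext x y
      have hid : ContinuousLinearMap.adjoint (ContinuousLinearMap.id ℝ ℝ) = ContinuousLinearMap.id ℝ ℝ :=
        ContinuousLinearMap.adjoint_id
      simp [K, Matrix.conjTranspose_apply, hg.1 x y, ContinuousLinearMap.star_eq_adjoint, hid]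
    · have := hg.2 vv
      simp only [Finsupp.sum, RCLike.re_to_real]
      refine this.trans_eq ?_
      refine Finset.sum_congr rfl fun x _ => Finset.sum_congr rfl fun y _ => ?_
      simp [K, hg.1 x y]; ring
  have : Fact K.PosSemidef := ⟨hK⟩
  refine ⟨RKHS.OfKernel K, inferInstance, inferInstance, inferInstance,
    fun x => RKHS.kerFun (RKHS.OfKernel K) x 1, fun x y => ?_⟩
  rw [← RKHS.kernel_inner, RKHS.OfKernel.kernel_ofKernel]
  simp [K, hg.1 x y]

theorem psdk_inner {X H : Type*} [NormedAddCommGroup H] [InnerProductSpace ℝ H] (v : X → H) :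
    PSDk fun x y => inner ℝ (v x) (v y) := by
  refine ⟨fun x y => real_inner_comm _ _, fun c => ?_⟩
  have : ∑ x ∈ c.support, ∑ y ∈ c.support, c x * c y * inner ℝ (v x) (v y)
      = inner ℝ (∑ x ∈ c.support, c x • v x) (∑ x ∈ c.support, c x • v x) := by
    rw [sum_inner]
    refine Finset.sum_congr rfl fun x _ => ?_
    rw [inner_sum]
    refine Finset.sum_congr rfl fun y _ => ?_
    rw [real_inner_smul_left, real_inner_smul_right]; ring
  rw [this]; exact real_inner_self_nonneg

theorem psdk_iff {X : Type*} (g : X → X → ℝ) : PSDk g ↔ (Matrix.of g).PosSemidef := by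
  unfold PSDk Matrix.PosSemidef
  refine and_congr ?_ (forall_congr' fun c => ?_)
  · constructor
    · intro h; ext x y; simp [h x y]
    · intro h x y
      simpa using (congrFun (congrFun h y) x)
  · simp only [Finsupp.sum]
    refine iff_of_eq (congrArg _ ?_)
    refine Finset.sum_congr rfl fun x _ => Finset.sum_congr rfl fun y _ => ?_
    simp; ring

theorem PSDk.mul {X : Type*} {g h : X → X → ℝ} (hg : PSDk g) (hh : PSDk h) :
    PSDk fun x y => g x y * h x y := by
  rw [psdk_iff] at *
  exact hg.hadamard hh

theorem PSDk.pow {X : Type*} {g : X → X → ℝ} (hg : PSDk g) (n : ℕ) :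
    PSDk fun x y => g x y ^ n := by
  induction n with
  | zero =>
    have := psdk_inner (H := ℝ) (fun _ : X => (1:ℝ))
    simpa using this
  | succ n ih => simpa [pow_succ] using ih.mul hg

theorem PSDk.const_mul {X : Type*} {g : X → X → ℝ} (hg : PSDk g) {a : ℝ} (ha : 0 ≤ a) :
    PSDk fun x y => a * g x y := by
  refine ⟨fun x y => by simp [hg.1 x y], fun c => ?_⟩
  have := mul_nonneg ha (hg.2 c)
  refine this.trans_eq ?_
  simp only [Finset.mul_sum]
  refine Finset.sum_congr rfl fun x _ => Finset.sum_congr rfl fun y _ => ?_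
  ring

theorem PSDk.hasSum {X : Type*} {g : ℕ → X → X → ℝ} {G : X → X → ℝ} (hg : ∀ n, PSDk (g n))
    (h : ∀ x y, HasSum (fun n => g n x y) (G x y)) : PSDk G := by
  refine ⟨fun x y => ?_, fun c => ?_⟩
  · have := h x y
    simp_rw [fun n => (hg n).1 x y] at this
    exact this.unique (h y x)
  · have : HasSum (fun n => ∑ x ∈ c.support, ∑ y ∈ c.support, c x * c y * g n x y)
        (∑ x ∈ c.support, ∑ y ∈ c.support, c x * c y * G x y) :=
      hasSum_sum fun x _ => hasSum_sum fun y _ => (h x y).mul_left _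
    exact this.nonneg fun n => (hg n).2 c

theorem PSDk.limit {X : Type*} {g : ℕ → X → X → ℝ} {G : X → X → ℝ} (hg : ∀ n, PSDk (g n))
    (h : ∀ x y, Tendsto (fun n => g n x y) atTop (𝓝 (G x y))) : PSDk G := by
  refine ⟨fun x y => ?_, fun c => ?_⟩
  · have := h x y
    simp_rw [fun n => (hg n).1 x y] at this
    exact tendsto_nhds_unique this (h y x)
  · have : Tendsto (fun n => ∑ x ∈ c.support, ∑ y ∈ c.support, c x * c y * g n x y) atTop
        (𝓝 (∑ x ∈ c.support, ∑ y ∈ c.support, c x * c y * G x y)) :=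
      tendsto_finsetSum _ fun x _ => tendsto_finsetSum _ fun y _ => (h x y).const_mul _
    exact ge_of_tendsto' this fun n => (hg n).2 c

theorem PSDk.exp {X : Type*} {g : X → X → ℝ} (hg : PSDk g) :
    PSDk fun x y => Real.exp (g x y) := by
  refine PSDk.hasSum (g := fun n x y => ((n.factorial : ℝ)⁻¹) * g x y ^ n)
    (fun n => (hg.pow n).const_mul (by positivity)) fun x y => ?_
  have := NormedSpace.expSeries_div_hasSum_exp (g x y)
  rw [← Real.exp_eq_exp_ℝ] at this
  simp only [div_eq_inv_mul] at this
  exact this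

theorem psdk_gauss {X H : Type*} [NormedAddCommGroup H] [InnerProductSpace ℝ H] (v : X → H)
    {t : ℝ} (ht : 0 ≤ t) : PSDk fun x y => Real.exp (-(t * ‖v x - v y‖ ^ 2)) := by
  have h1 := ((psdk_inner v).const_mul (a := 2 * t) (by positivity)).exp
  have h2 := psdk_inner (H := ℝ) (fun x => Real.exp (-(t * ‖v x‖ ^ 2)))
  have := h2.mul h1
  convert this using 3 with x y
  rw [norm_sub_sq_real]
  simp only [RCLike.inner_apply, conj_trivial]
  rw [← Real.exp_add, ← Real.exp_add]
  congr 1; ring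

theorem psdk_gauss0 {X H : Type*} [NormedAddCommGroup H] [InnerProductSpace ℝ H] (v : X → H)
    {t : ℝ} (ht : 0 ≤ t) (x₀ : X) :
    PSDk fun x y => (1 - Real.exp (-(t * ‖v x - v x₀‖ ^ 2)))
      + (1 - Real.exp (-(t * ‖v y - v x₀‖ ^ 2))) - (1 - Real.exp (-(t * ‖v x - v y‖ ^ 2))) := by
  obtain ⟨H', _, _, _, w, hw⟩ := gram_exists (psdk_gauss v ht)
  have := psdk_inner fun x => w x - w x₀
  convert this using 3 with x y
  simp only [inner_sub_left, inner_sub_right, hw, sub_self]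
  rw [norm_sub_rev (v x₀)]
  simp; ring

theorem fracker_integrable {β : ℝ} (h0 : 0 < β) (h1 : β < 1) :
    IntegrableOn (fun s : ℝ => (1 - Real.exp (-s)) * s ^ (-1 - β)) (Set.Ioi 0) := by
  have hm : AEStronglyMeasurable (fun s : ℝ => (1 - Real.exp (-s)) * s ^ (-1 - β))
      (volume.restrict (Set.Ioi 0)) := by
    apply Measurable.aestronglyMeasurable; fun_prop
  rw [← Set.Ioc_union_Ioi_eq_Ioi (zero_le_one' ℝ)]
  refine IntegrableOn.union ?_ ?_
  · have : IntegrableOn (fun s : ℝ => s ^ (-β)) (Set.Ioc 0 1) := by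
      rw [← intervalIntegrable_iff_integrableOn_Ioc_of_le zero_le_one]
      exact intervalIntegral.intervalIntegrable_rpow' (by linarith)
    refine Integrable.mono' this (hm.mono_measure (Measure.restrict_mono Set.Ioc_subset_Ioi_self le_rfl)) ?_
    filter_upwards [ae_restrict_mem measurableSet_Ioc] with s hs
    have e1 : 0 ≤ 1 - Real.exp (-s) := by
      have : Real.exp (-s) ≤ 1 := Real.exp_le_one_iff.mpr (by linarith [hs.1])
      linarith
    rw [Real.norm_of_nonneg (mul_nonneg e1 (Real.rpow_nonneg hs.1.le _))]
    have e2 : 1 - Real.exp (-s) ≤ s := by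
      have := Real.add_one_le_exp (-s); linarith
    calc _ ≤ s * s ^ (-1 - β) := by gcongr; exact Real.rpow_nonneg hs.1.le _
      _ = s ^ (-β) := by
        rw [← Real.rpow_one_add' hs.1.le (by linarith)]; congr 1; ring
  · have : IntegrableOn (fun s : ℝ => s ^ (-1-β)) (Set.Ioi 1) :=
      integrableOn_Ioi_rpow_of_lt (by linarith) zero_lt_one
    refine Integrable.mono' this (hm.mono_measure (Measure.restrict_mono (Set.Ioi_subset_Ioi zero_le_one) le_rfl)) ?_
    filter_upwards [ae_restrict_mem measurableSet_Ioi] with s hs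
    have hs0 : (0:ℝ) < s := zero_lt_one.trans hs
    have e1 : 0 ≤ 1 - Real.exp (-s) := by
      have : Real.exp (-s) ≤ 1 := Real.exp_le_one_iff.mpr (by linarith)
      linarith
    rw [Real.norm_of_nonneg (mul_nonneg e1 (Real.rpow_nonneg hs0.le _))]
    have := Real.exp_pos (-s)
    exact mul_le_of_le_one_left (Real.rpow_nonneg hs0.le _) (by linarith)

/-- the constant in the subordination formula -/
def fracc (β : ℝ) : ℝ := ∫ s in Set.Ioi (0:ℝ), (1 - Real.exp (-s)) * s ^ (-1 - β)

theorem fracc_pos {β : ℝ} (h0 : 0 < β) (h1 : β < 1) : 0 < fracc β := by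
  unfold fracc
  have hpos : ∀ s ∈ Set.Ioi (0:ℝ), 0 < (1 - Real.exp (-s)) * s ^ (-1 - β) := fun s hs => by
    have : Real.exp (-s) < 1 := Real.exp_lt_one_iff.mpr (by simpa using hs)
    exact mul_pos (by linarith) (Real.rpow_pos_of_pos hs _)
  rw [setIntegral_pos_iff_support_of_nonneg_ae]
  · have : Function.support (fun s : ℝ => (1 - Real.exp (-s)) * s ^ (-1 - β)) ∩ Set.Ioi 0
        = Set.Ioi 0 := Set.inter_eq_right.mpr fun s hs => (hpos s hs).ne'
    rw [this]; simp
  · filter_upwards [ae_restrict_mem measurableSet_Ioi] with s hs using (hpos s hs).le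
  · exact fracker_integrable h0 h1

theorem frac_formula {β : ℝ} (h0 : 0 < β) (h1 : β < 1) {d : ℝ} (hd : 0 ≤ d) :
    IntegrableOn (fun t : ℝ => (1 - Real.exp (-(t * d))) * t ^ (-1 - β)) (Set.Ioi 0) ∧
    ∫ t in Set.Ioi (0:ℝ), (1 - Real.exp (-(t * d))) * t ^ (-1 - β) = d ^ β * fracc β := by
  rcases hd.eq_or_lt with rfl | hd
  · simp [Real.zero_rpow h0.ne']
  have key : Set.EqOn (fun t : ℝ => (1 - Real.exp (-(t * d))) * t ^ (-1 - β))
      (fun t => d ^ (1 + β) * ((fun s => (1 - Real.exp (-s)) * s ^ (-1 - β)) (t * d)))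
      (Set.Ioi 0) := fun t ht => by
    simp only
    rw [Real.mul_rpow (le_of_lt ht) hd.le]
    have : d ^ (1 + β) * d ^ (-1 - β) = 1 := by
      rw [← Real.rpow_add hd]; simp
    linear_combination (-(1 - Real.exp (-(t * d))) * t ^ (-1 - β)) * this
  constructor
  · refine (integrableOn_congr_fun key measurableSet_Ioi).mpr ?_
    refine Integrable.const_mul ?_ _
    have := (integrableOn_Ioi_comp_mul_right_iff (fun s => (1 - Real.exp (-s)) * s ^ (-1 - β)) 0 hd).mpr
      (by simpa using fracker_integrable h0 h1)
    exact this
  · rw [setIntegral_congr_fun measurableSet_Ioi key, integral_const_mul,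
      integral_comp_mul_right_Ioi (fun s => (1 - Real.exp (-s)) * s ^ (-1 - β)) _ hd]
    simp only [zero_mul, smul_eq_mul]
    unfold fracc
    rw [← mul_assoc, ← Real.rpow_neg_one d, ← Real.rpow_add hd]; congr 2; ring

theorem psdk_negtype {X H : Type*} [NormedAddCommGroup H] [InnerProductSpace ℝ H] (v : X → H)
    {β : ℝ} (h0 : 0 < β) (h1 : β ≤ 1) (x₀ : X) :
    PSDk fun x y => (‖v x - v x₀‖ ^ 2) ^ β + (‖v y - v x₀‖ ^ 2) ^ β - (‖v x - v y‖ ^ 2) ^ β := by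
  rcases h1.eq_or_lt with rfl | h1
  · have := (psdk_inner fun x => v x - v x₀).const_mul (a := 2) (by norm_num)
    convert this using 3 with x y
    simp only [Real.rpow_one]
    have : v x - v y = (v x - v x₀) - (v y - v x₀) := by abel
    rw [this, norm_sub_sq_real (v x - v x₀)]; ring
  refine ⟨fun x y => by simp only; rw [norm_sub_rev (v x) (v y)]; ring, fun c => ?_⟩
  set F := fun (t : ℝ) (x y : X) => (1 - Real.exp (-(t * ‖v x - v x₀‖ ^ 2)))
      + (1 - Real.exp (-(t * ‖v y - v x₀‖ ^ 2))) - (1 - Real.exp (-(t * ‖v x - v y‖ ^ 2)))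
  have A : ∀ x y, IntegrableOn (fun t => F t x y * t ^ (-1 - β)) (Set.Ioi 0) ∧
      ∫ t in Set.Ioi (0:ℝ), F t x y * t ^ (-1 - β) = ((‖v x - v x₀‖ ^ 2) ^ β +
        (‖v y - v x₀‖ ^ 2) ^ β - (‖v x - v y‖ ^ 2) ^ β) * fracc β := fun x y => by
    have a1 := frac_formula h0 h1 (sq_nonneg ‖v x - v x₀‖)
    have a2 := frac_formula h0 h1 (sq_nonneg ‖v y - v x₀‖)
    have a3 := frac_formula h0 h1 (sq_nonneg ‖v x - v y‖)
    simp only [F, sub_mul _ _ (_ ^ (-1 - β)), add_mul _ _ (_ ^ (-1 - β))] at a1 a2 a3 ⊢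
    refine ⟨(a1.1.add a2.1).sub a3.1, ?_⟩
    have e := integral_sub (a1.1.add a2.1) a3.1
    simp only [Pi.add_apply] at e
    rw [e, integral_add a1.1 a2.1, a1.2, a2.2, a3.2]
    ring
  have B : (∑ x ∈ c.support, ∑ y ∈ c.support, c x * c y * ((‖v x - v x₀‖ ^ 2) ^ β +
        (‖v y - v x₀‖ ^ 2) ^ β - (‖v x - v y‖ ^ 2) ^ β)) * fracc β =
      ∫ t in Set.Ioi (0:ℝ), (∑ x ∈ c.support, ∑ y ∈ c.support, c x * c y * F t x y)
        * t ^ (-1 - β) := by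
    simp only [Finset.sum_mul]
    rw [integral_finsetSum]
    · refine Finset.sum_congr rfl fun x _ => ?_
      rw [integral_finsetSum]
      · refine Finset.sum_congr rfl fun y _ => ?_
        simp only [mul_assoc (c x * c y)]
        rw [integral_const_mul, (A x y).2]
      · intro y _
        simp only [mul_assoc (c x * c y)]
        exact (A x y).1.const_mul _
    · intro x _
      refine integrable_finsetSum _ fun y _ => ?_
      simp only [mul_assoc (c x * c y)]
      exact (A x y).1.const_mul _
  refine nonneg_of_mul_nonneg_left ?_ (fracc_pos h0 h1)
  rw [B]
  refine setIntegral_nonneg measurableSet_Ioi fun t ht => ?_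
  exact mul_nonneg ((psdk_gauss0 v (le_of_lt ht) x₀).2 c) (Real.rpow_nonneg (le_of_lt ht) _)

theorem negtype_rpow {X : Type uX} {H : Type*} [NormedAddCommGroup H] [InnerProductSpace ℝ H]
    (v : X → H) {β : ℝ} (h0 : 0 < β) (h1 : β ≤ 1) (x₀ : X) :
    ∃ (H : Type uX) (_ : NormedAddCommGroup H) (_ : InnerProductSpace ℝ H) (_ : CompleteSpace H)
      (w : X → H), ∀ x y, (‖v x - v y‖ ^ 2) ^ β = ‖w x - w y‖ ^ 2 := by
  obtain ⟨H', i1, i2, i3, w, hw⟩ := gram_exists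
    ((psdk_negtype v h0 h1 x₀).const_mul (a := 1/2) (by norm_num))
  refine ⟨H', i1, i2, i3, w, fun x y => ?_⟩
  rw [norm_sub_sq_real (w x), ← real_inner_self_eq_norm_sq (w x), ← real_inner_self_eq_norm_sq (w y), hw, hw, hw]
  simp [Real.zero_rpow h0.ne']
  ring


theorem eig_basis {H : Type*} [NormedAddCommGroup H] [InnerProductSpace ℝ H] [CompleteSpace H]
    [TopologicalSpace.SeparableSpace H] (T : H →L[ℝ] H) (hT : IsCompactOperator T)
    (hT' : T.IsSymmetric) :
    ∃ (e : ℕ → H) (κ : ℕ → ℝ), (∀ i, T (e i) = κ i • e i) ∧ (∀ i, κ i * ‖e i‖ ^ 2 = κ i) ∧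
      ∀ x y, HasSum (fun i => inner ℝ x (e i) * inner ℝ (e i) y) (inner ℝ x y) := by
  classical
  let E : ℝ → Submodule ℝ H := fun μ => Module.End.eigenspace (T : Module.End ℝ H) μ
  have hE : ∀ μ, IsClosed (E μ : Set H) := fun μ => by
    have : (E μ : Set H) = {x | T x = μ • x} := by
      ext x; simp [E, Module.End.mem_eigenspace_iff]
    rw [this]
    exact isClosed_eq T.continuous (by fun_prop)
  have hEc : ∀ μ, CompleteSpace (E μ) := fun μ => (hE μ).completeSpace_coe
  choose w b hb using fun μ => exists_hilbertBasis ℝ (E μ)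
  have hO : OrthogonalFamily ℝ (fun μ => E μ) fun μ => (E μ).subtypeₗᵢ :=
    hT'.orthogonalFamily_eigenspaces
  let v : (Σ μ, w μ) → H := fun a => (E a.1).subtypeₗᵢ (b a.1 a.2)
  have hv : Orthonormal ℝ v := hO.orthonormal_sigma_orthonormal (fun μ => (b μ).orthonormal)
  have hsp : (Submodule.span ℝ (Set.range v))ᗮ = ⊥ := by
    rw [eq_bot_iff]
    intro x hx
    have hx' : x ∈ (⨆ μ, E μ)ᗮ := by
      rw [Submodule.mem_orthogonal]
      intro y hy
      induction hy using Submodule.iSup_induction' with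
      | mem μ y hy =>
        have := ((b μ).hasSum_repr ⟨y, hy⟩).mapL ((innerSL ℝ x).comp (E μ).subtypeL)
        have h0 : ∀ i, inner ℝ x ((b μ i : E μ) : H) = 0 := fun i => by
          rw [real_inner_comm]
          exact (Submodule.mem_orthogonal _ _).mp hx _ (Submodule.subset_span ⟨⟨μ, i⟩, rfl⟩)
        simp [h0, inner_smul_right] at this
        rw [real_inner_comm]
        exact this.unique hasSum_zero
      | zero => simp
      | add y z _ _ h1 h2 => rw [inner_add_left, h1, h2, add_zero]
    rw [show (⨆ μ, E μ)ᗮ = ⊥ from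
      ContinuousLinearMap.orthogonalComplement_iSup_eigenspaces_eq_bot hT hT'] at hx'
    exact hx'
  let B := HilbertBasis.mkOfOrthogonalEqBot hv hsp
  have hBv : ∀ a, B a = v a := fun a => by simp [B]
  have hcount : Countable (Σ μ, w μ) := by
    refine Pairwise.countable_of_isOpen_disjoint (α := H) (s := fun a => Metric.ball (v a) (1/2)) ?_
      (fun a => Metric.isOpen_ball) (fun a => ⟨v a, Metric.mem_ball_self (by norm_num)⟩)
    intro a a' haa
    refine Metric.ball_disjoint_ball ?_
    have : ‖v a - v a'‖ ^ 2 = 2 := by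
      rw [norm_sub_sq_real, hv.1, hv.1, hv.2 haa]; norm_num
    rw [dist_eq_norm]
    nlinarith [norm_nonneg (v a - v a')]
  let _ := Encodable.ofCountable (Σ μ, w μ)
  let e : ℕ → H := fun n => (Encodable.decode₂ (Σ μ, w μ) n).elim 0 v
  let κ : ℕ → ℝ := fun n => (Encodable.decode₂ (Σ μ, w μ) n).elim 0 (fun a => a.1)
  refine ⟨e, κ, fun i => ?_, fun i => ?_, fun x y => ?_⟩
  · simp only [e, κ]
    cases h : Encodable.decode₂ (Σ μ, w μ) i with
    | none => simp
    | some a =>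
      exact Module.End.mem_eigenspace_iff.mp (b a.1 a.2).2
  · simp only [e, κ]
    cases h : Encodable.decode₂ (Σ μ, w μ) i with
    | none => simp
    | some a => simp [hv.1 a]
  · have h1 := B.hasSum_inner_mul_inner x y
    rw [← (Encodable.encode_injective (α := Σ μ, w μ)).hasSum_iff]
    · simpa [Function.comp_def, e, hBv] using h1
    · intro n hn
      have : Encodable.decode₂ (Σ μ, w μ) n = none := by
        by_contra h
        obtain ⟨a, ha⟩ := Option.ne_none_iff_exists'.mp h
        exact hn ⟨a, Encodable.mem_decode₂.mp ha⟩
      simp [e, this]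

theorem cov_op {X H : Type*} [MeasurableSpace X] [NormedAddCommGroup H] [InnerProductSpace ℝ H]
    [CompleteSpace H] (μ : Measure X) [IsProbabilityMeasure μ] (f : X → H)
    (hf : StronglyMeasurable f) (hi : Integrable (fun x => ‖f x‖ ^ 2) μ) :
    ∃ T : H →L[ℝ] H, IsCompactOperator T ∧ T.IsSymmetric ∧
      (∀ a b, Integrable (fun x => inner ℝ a (f x) * inner ℝ b (f x)) μ) ∧
      ∀ a b, inner ℝ (T a) b = ∫ x, inner ℝ a (f x) * inner ℝ b (f x) ∂μ := by
  let R : X → H →L[ℝ] H := fun x => (innerSL ℝ (f x)).smulRight (f x)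
  have hcont : Continuous fun h : H => ((innerSL ℝ h).smulRight h : H →L[ℝ] H) := by
    fun_prop
  have hR : StronglyMeasurable R := hcont.comp_stronglyMeasurable hf
  have hRn : ∀ x, ‖R x‖ = ‖f x‖ ^ 2 := fun x => by
    simp only [R]
    rw [ContinuousLinearMap.norm_smulRight_apply, innerSL_apply_norm, sq]
  have hRi : Integrable R μ := by
    refine hi.mono' hR.aestronglyMeasurable (Eventually.of_forall fun x => ?_)
    rw [hRn]
  have hTa : ∀ a b, inner ℝ ((∫ x, R x ∂μ) a) b = ∫ x, inner ℝ a (f x) * inner ℝ b (f x) ∂μ ∧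
      Integrable (fun x => inner ℝ a (f x) * inner ℝ b (f x)) μ := fun a b => by
    let L : (H →L[ℝ] H) →L[ℝ] ℝ := (innerSL ℝ b).comp (ContinuousLinearMap.apply ℝ H a)
    have h1 := L.integral_comp_comm hRi
    have h2 := L.integrable_comp hRi
    have h3 : ∀ x, L (R x) = inner ℝ a (f x) * inner ℝ b (f x) := fun x => by
      simp [L, R, inner_smul_right, real_inner_comm]
    simp only [h3] at h1 h2
    refine ⟨?_, h2⟩
    rw [h1]; simp [L, real_inner_comm]
  refine ⟨∫ x, R x ∂μ, ?_, fun a b => ?_, fun a b => (hTa a b).2, fun a b => (hTa a b).1⟩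
  · have hcl := isClosed_setOfPred_isCompactOperator (σ₁₂ := RingHom.id ℝ) (M₁ := H) (M₂ := H)
    refine Convex.integral_mem (s := {T : H →L[ℝ] H | IsCompactOperator T}) ?_ hcl
      (Eventually.of_forall fun x => ?_) hRi
    · intro S hS T hT a b _ _ _
      exact (IsCompactOperator.smul hS a).add (IsCompactOperator.smul hT b)
    · change IsCompactOperator (R x)
      have := (isCompactOperator_of_locallyCompactSpace_dom (innerSL ℝ (f x))).clm_comp
        (ContinuousLinearMap.toSpanSingleton ℝ (f x))
      exact this
  · change inner ℝ ((∫ x, R x ∂μ) a) b = inner ℝ a ((∫ x, R x ∂μ) b)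
    rw [(hTa a b).1, real_inner_comm, (hTa b a).1]
    simp only [mul_comm]


theorem hasSum_of_eq {ι : Type*} {f g : ι → ℝ} {a b : ℝ} (h : HasSum f a) (hfg : ∀ i, g i = f i)
    (hab : b = a) : HasSum g b := by
  rw [hab, funext hfg]; exact h

/-- Mercer-type decomposition of the centred kernel. -/
structure Merc {X : Type*} [MeasurableSpace X] (ρ : X → X → ℝ) (μ : Measure X) (ε : ℝ)
    (u : ℕ → X → ℝ) (κ : ℕ → ℝ) : Prop where
  meas : ∀ i, Measurable (u i)
  sum : ∀ x x', HasSum (fun i => u i x * u i x') (-dM ρ μ x x')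
  diff : ∀ x x', HasSum (fun i => (u i x - u i x') ^ 2) (2 * ρ x x')
  zero : ∀ i, ∫ x, u i x ∂μ = 0
  sq : ∀ i, ∫ x, u i x ^ 2 ∂μ = κ i
  eig : ∀ i x, ∫ x', dM ρ μ x x' * u i x' ∂μ = -(κ i * u i x)
  mom : Integrable (fun x => (-dM ρ μ x x) ^ (1 + ε)) μ

theorem merc0 {X H : Type*} [MeasurableSpace X] [NormedAddCommGroup H] [InnerProductSpace ℝ H]
    [CompleteSpace H] [TopologicalSpace.SeparableSpace H] (μ : Measure X) [IsProbabilityMeasure μ]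
    (w : X → H) (hw : StronglyMeasurable w) {ε : ℝ} (hε : 0 < ε) (x₀ : X)
    (hi : Integrable (fun x => ‖w x - w x₀‖ ^ (2 + 2 * ε)) μ) (ρ : X → X → ℝ)
    (hρ : ∀ x y, ρ x y = ‖w x - w y‖ ^ 2) :
    ∃ u κ, Merc ρ μ ε u κ := by
  have hw0 : StronglyMeasurable fun x => w x - w x₀ := hw.sub stronglyMeasurable_const
  have i0 : Integrable (fun x => w x - w x₀) μ :=
    integrable_of_moment hε hw0.aestronglyMeasurable hi
  set m := ∫ x, (w x - w x₀) ∂μ with hm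
  set f : X → H := fun x => w x - w x₀ - m with hfdef
  have hf : StronglyMeasurable f := hw0.sub stronglyMeasurable_const
  have hp : 0 < 2 + 2 * ε := by positivity
  have fmom : Integrable (fun x => ‖f x‖ ^ (2 + 2 * ε)) μ := by
    rw [mom_iff hf.aestronglyMeasurable hp]
    rw [mom_iff hw0.aestronglyMeasurable hp] at hi
    exact hi.sub (memLp_const m)
  have fi : Integrable f μ := integrable_of_moment hε hf.aestronglyMeasurable fmom
  have f2 : Integrable (fun x => ‖f x‖ ^ 2) μ :=
    integrable_sq_of_moment hε hf.aestronglyMeasurable fmom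
  have f0 : ∫ x, f x ∂μ = 0 := by
    rw [hfdef, integral_sub i0 (integrable_const _)]; simp [hm]
  have fin0 : ∀ a : H, Integrable (fun x => inner ℝ a (f x)) μ ∧ ∫ x, inner ℝ a (f x) ∂μ = 0 :=
    fun a => ⟨(innerSL ℝ a).integrable_comp fi, by rw [integral_inner fi, f0, inner_zero_right]⟩
  have hρf : ∀ x y, ρ x y = ‖f x‖ ^ 2 + ‖f y‖ ^ 2 - 2 * inner ℝ (f x) (f y) := fun x y => by
    have : w x - w y = f x - f y := by simp [hfdef]
    rw [hρ, this, norm_sub_sq_real]; ring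
  set V := ∫ x, ‖f x‖ ^ 2 ∂μ with hV
  have ha : ∀ x, aM ρ μ x = ‖f x‖ ^ 2 + V := fun x => by
    unfold aM
    simp only [hρf]
    have e1 := integral_sub ((integrable_const (‖f x‖ ^ 2)).add f2) ((fin0 (f x)).1.const_mul 2)
    simp only [Pi.add_apply] at e1
    rw [e1, integral_add (integrable_const _) f2, integral_const_mul, (fin0 (f x)).2]
    simp [hV]
  have hD : DM ρ μ = 2 * V := by
    unfold DM
    rw [integral_prod]
    · have : ∀ x, ∫ y, ρ x y ∂μ = ‖f x‖ ^ 2 + V := ha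
      simp only [this]
      rw [integral_add f2 (integrable_const _)]; simp [hV]; ring
    · have hm' : StronglyMeasurable fun p : X × X => ρ p.1 p.2 := by
        have : (fun p : X × X => ρ p.1 p.2) = fun p => ‖w p.1 - w p.2‖ ^ 2 := by
          funext p; exact hρ _ _
        rw [this]
        exact ((hw.comp_measurable measurable_fst).sub (hw.comp_measurable measurable_snd)).norm.pow 2
      refine Integrable.mono' (((f2.comp_fst μ).const_mul 2).add ((f2.comp_snd μ).const_mul 2))
        hm'.aestronglyMeasurable (.of_forall fun p => ?_)
      rw [Real.norm_of_nonneg (by rw [hρ]; positivity), hρf]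
      have := norm_add_sq_real (f p.1) (f p.2)
      have h2 := sq_nonneg ‖f p.1 + f p.2‖
      simp only [Pi.add_apply]
      nlinarith
  have hdM : ∀ x y, dM ρ μ x y = -2 * inner ℝ (f x) (f y) := fun x y => by
    unfold dM; rw [ha, ha, hD, hρf]; ring
  obtain ⟨T, hTc, hTs, hTi, hT⟩ := cov_op μ f hf f2
  obtain ⟨e, κ, he, hκ, hsum⟩ := eig_basis T hTc hTs
  have s2 : √2 * √2 = 2 := Real.mul_self_sqrt (by norm_num)
  refine ⟨fun i x => √2 * inner ℝ (e i) (f x), fun i => 2 * κ i, ?_, ?_, ?_, ?_, ?_, ?_, ?_⟩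
  · intro i
    exact ((stronglyMeasurable_const.inner hf).measurable).const_mul _
  · intro x y
    have := (hsum (f x) (f y)).mul_left 2
    rw [hdM]
    refine hasSum_of_eq this (fun i => ?_) ?_
    · rw [real_inner_comm (f x) (e i)]
      linear_combination (inner ℝ (f x) (e i) * inner ℝ (e i) (f y)) * s2
    · ring
  · intro x y
    have := (hsum (f x - f y) (f x - f y)).mul_left 2
    have hxy : f x - f y = w x - w y := by simp [hfdef]
    rw [real_inner_self_eq_norm_sq] at this
    rw [hρ, ← hxy]
    refine hasSum_of_eq this (fun i => ?_) rfl
    rw [real_inner_comm (e i) (f x - f y), inner_sub_right (e i) (f x) (f y)]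
    linear_combination ((inner ℝ (e i) (f x) - inner ℝ (e i) (f y)) ^ 2) * s2
  · intro i
    rw [integral_const_mul, (fin0 _).2, mul_zero]
  · intro i
    have : ∀ x, (√2 * inner ℝ (e i) (f x)) ^ 2
        = 2 * (inner ℝ (e i) (f x) * inner ℝ (e i) (f x)) := fun x => by
      linear_combination (inner ℝ (e i) (f x) ^ 2) * s2
    simp only [this]
    rw [integral_const_mul, ← hT, he, real_inner_smul_left, real_inner_self_eq_norm_sq, hκ]
  · intro i x
    have : ∀ y, dM ρ μ x y * (√2 * inner ℝ (e i) (f y))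
        = (-2 * √2) * (inner ℝ (e i) (f y) * inner ℝ (f x) (f y)) := fun y => by
      rw [hdM]; ring
    simp only [this]
    rw [integral_const_mul, ← hT, he, real_inner_smul_left]; ring
  · have : ∀ x, (-dM ρ μ x x) ^ (1 + ε) = 2 ^ (1 + ε) * ‖f x‖ ^ (2 + 2 * ε) := fun x => by
      rw [hdM, real_inner_self_eq_norm_sq]
      have : -(-2 * ‖f x‖ ^ 2) = 2 * ‖f x‖ ^ 2 := by ring
      rw [this, Real.mul_rpow (by norm_num) (by positivity), ← Real.rpow_natCast,
        ← Real.rpow_mul (norm_nonneg _)]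
      congr 2; push_cast; ring
    simp only [this]
    exact fmom.const_mul _

theorem merc {X H : Type*} [TopologicalSpace X] [SecondCountableTopology X] [MeasurableSpace X]
    [BorelSpace X] [NormedAddCommGroup H] [InnerProductSpace ℝ H]
    [CompleteSpace H] (μ : Measure X) [IsProbabilityMeasure μ]
    (w : X → H) (hw : Continuous w) {ε : ℝ} (hε : 0 < ε) (x₀ : X)
    (hi : Integrable (fun x => ‖w x - w x₀‖ ^ (2 + 2 * ε)) μ) (ρ : X → X → ℝ)
    (hρ : ∀ x y, ρ x y = ‖w x - w y‖ ^ 2) :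
    ∃ u κ, Merc ρ μ ε u κ := by
  let H' : Submodule ℝ H := (Submodule.span ℝ (Set.range w)).topologicalClosure
  have hsep : TopologicalSpace.IsSeparable (H' : Set H) := by
    have h1 : TopologicalSpace.IsSeparable (Set.range w) :=
      TopologicalSpace.isSeparable_range hw
    exact (h1.span (R := ℝ)).closure
  have : TopologicalSpace.SeparableSpace H' := hsep.separableSpace
  have : CompleteSpace H' := (Submodule.isClosed_topologicalClosure _).completeSpace_coe
  let w' : X → H' := fun x => ⟨w x, Submodule.le_topologicalClosure _ (Submodule.subset_span ⟨x, rfl⟩)⟩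
  have hw' : Continuous w' := hw.subtype_mk _
  exact merc0 μ w' hw'.stronglyMeasurable hε x₀ hi ρ hρ

/-- factor decomposition in the negative-type setting -/
theorem merc_negtype {β : ℝ} (hβ : β ∈ Set.Ioc (0 : ℝ) 1) {X : Type*}
    [MetricSpace X] [TopologicalSpace.SeparableSpace X] [MeasurableSpace X] [BorelSpace X]
    {H₁ : Type*} [NormedAddCommGroup H₁] [InnerProductSpace ℝ H₁]
    (φemb : X → H₁) (hφ : ∀ x x' : X, dist x x' = ‖φemb x - φemb x'‖ ^ 2)
    (μ : Measure X) [IsProbabilityMeasure μ] {ε : ℝ} (hε : 0 < ε) (x₀ : X)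
    (hmom : Integrable (fun x => dist x x₀ ^ ((1 + ε) * β)) μ) :
    ∃ u κ, Merc (fun a b : X => dist a b ^ β) μ ε u κ := by
  obtain ⟨H, i1, i2, i3, w, hw⟩ := negtype_rpow φemb hβ.1 hβ.2 x₀
  simp only [← hφ] at hw
  have : SecondCountableTopology X := UniformSpace.secondCountable_of_separable X
  have hwc : Continuous w := by
    rw [continuous_iff_continuousAt]
    intro x
    rw [ContinuousAt, tendsto_iff_norm_sub_tendsto_zero]
    have h1 : Tendsto (fun y => dist y x ^ β) (𝓝 x) (𝓝 0) := by
      have : Continuous fun y => dist y x ^ β :=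
        (continuous_id.dist continuous_const).rpow_const fun _ => Or.inr hβ.1.le
      have h := this.tendsto x
      simpa [Real.zero_rpow hβ.1.ne'] using h
    have h2 := h1.sqrt
    simp only [hw, Real.sqrt_sq (norm_nonneg _), Real.sqrt_zero] at h2
    exact h2
  refine merc μ w hwc hε x₀ ?_ _ hw
  convert hmom using 2 with x
  rw [mul_comm (1 + ε), Real.rpow_mul dist_nonneg, hw, ← Real.rpow_natCast,
    ← Real.rpow_mul (norm_nonneg _)]
  congr 1; push_cast; ring


/-- uniform measure on a finite family of points -/
def unif {𝒵 : Type*} [MeasurableSpace 𝒵] (z : ℕ → 𝒵) (n : ℕ) : Measure 𝒵 :=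
  (n : ℝ≥0∞)⁻¹ • ∑ k ∈ Finset.range n, Measure.dirac (z k)

theorem unif_integral {𝒵 : Type*} [MeasurableSpace 𝒵] [MeasurableSingletonClass 𝒵]
    (z : ℕ → 𝒵) (n : ℕ) (f : 𝒵 → ℝ) :
    ∫ x, f x ∂(unif z n) = (n : ℝ)⁻¹ * ∑ k ∈ Finset.range n, f (z k) := by
  unfold unif
  rw [integral_smul_measure, integral_finsetSum_measure]
  · simp
  · intro i _
    exact integrable_dirac (by simp)

theorem unif_map {𝒵 𝒳 : Type*} [MeasurableSpace 𝒵] [MeasurableSpace 𝒳]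
    (z : ℕ → 𝒵) (n : ℕ) (g : 𝒵 → 𝒳) (hg : Measurable g) :
    (unif z n).map g = unif (fun k => g (z k)) n := by
  unfold unif
  rw [Measure.map_smul]
  congr 1
  induction n with
  | zero => simp
  | succ n ih => rw [Finset.sum_range_succ, Measure.map_add _ _ hg, ih, Finset.sum_range_succ,
      Measure.map_dirac' hg]

theorem unif_prod_integral {𝒵 : Type*} [MeasurableSpace 𝒵] [MeasurableSingletonClass 𝒵]
    (z : ℕ → 𝒵) (n : ℕ) (hn : 0 < n) (f : 𝒵 × 𝒵 → ℝ) :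
    ∫ p, f p ∂((unif z n).prod (unif z n)) = (n : ℝ)⁻¹ * ∑ k ∈ Finset.range n,
      ((n : ℝ)⁻¹ * ∑ l ∈ Finset.range n, f (z k, z l)) := by
  have hn' : (n : ℝ≥0∞)⁻¹ ≠ ∞ := by simp [hn.ne']
  have hfin : IsFiniteMeasure (unif z n) := by
    refine ⟨?_⟩
    simp only [unif, Measure.smul_apply, Measure.coe_finsetSum, Finset.sum_apply, measure_univ,
      smul_eq_mul]
    exact ENNReal.mul_lt_top hn'.lt_top (by simp)
  have hprod : (unif z n).prod (unif z n) = ((n : ℝ≥0∞)⁻¹ * (n : ℝ≥0∞)⁻¹) •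
      ∑ k ∈ Finset.range n, ∑ l ∈ Finset.range n, Measure.dirac (z k, z l) := by
    refine Measure.prod_eq fun s t hs ht => ?_
    simp only [unif, Measure.smul_apply, Measure.coe_finsetSum, Finset.sum_apply, smul_eq_mul,
      Measure.dirac_apply' _ hs, Measure.dirac_apply' _ ht, Measure.dirac_apply' _ (hs.prod ht)]
    have : ∀ k l, (s ×ˢ t).indicator (1 : 𝒵 × 𝒵 → ℝ≥0∞) (z k, z l) =
        s.indicator 1 (z k) * t.indicator 1 (z l) := fun k l => by
      simp only [Set.indicator, Set.mem_prod, Pi.one_apply]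
      by_cases h1 : z k ∈ s <;> by_cases h2 : z l ∈ t <;> simp [h1, h2]
    simp only [this, ← Finset.mul_sum, ← Finset.sum_mul]
    ring
  rw [hprod, integral_smul_measure, integral_finsetSum_measure]
  · have : ∀ k ∈ Finset.range n, ∫ p, f p ∂(∑ l ∈ Finset.range n, Measure.dirac (z k, z l))
        = ∑ l ∈ Finset.range n, f (z k, z l) := fun k _ => by
      rw [integral_finsetSum_measure]
      · simp
      · intro i _
        exact integrable_dirac (by simp)
    rw [Finset.sum_congr rfl this, ← Finset.mul_sum]
    simp [mul_assoc]
  · intro k _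
    rw [integrable_finsetSum_measure]
    intro i _
    exact integrable_dirac (by simp)

/-- mean of the family -/
theorem dM_unif {X H : Type*} [MeasurableSpace X] [MeasurableSingletonClass X]
    [NormedAddCommGroup H] [InnerProductSpace ℝ H] (a : X → H) (ρ : X → X → ℝ)
    (hρ : ∀ x y, 2 * ρ x y = ‖a x - a y‖ ^ 2) (z : ℕ → X) (n : ℕ) (hn : 0 < n) (x y : X) :
    dM ρ (unif z n) x y = - inner ℝ (a x - (n : ℝ)⁻¹ • ∑ k ∈ Finset.range n, a (z k))
      (a y - (n : ℝ)⁻¹ • ∑ k ∈ Finset.range n, a (z k)) := by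
  have hn0 : (n : ℝ) ≠ 0 := by positivity
  set A := (n : ℝ)⁻¹ • ∑ k ∈ Finset.range n, a (z k) with hA
  set Q := (n : ℝ)⁻¹ * ∑ k ∈ Finset.range n, ‖a (z k) - A‖ ^ 2 with hQ
  have hcen : ∑ k ∈ Finset.range n, (a (z k) - A) = 0 := by
    rw [Finset.sum_sub_distrib, Finset.sum_const, Finset.card_range, hA, ← Nat.cast_smul_eq_nsmul ℝ,
      smul_smul, mul_inv_cancel₀ hn0, one_smul, sub_self]
  have hρ' : ∀ x y, ρ x y = (1/2) * ‖a x - A‖ ^ 2 + (1/2) * ‖a y - A‖ ^ 2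
      - inner ℝ (a x - A) (a y - A) := fun x y => by
    have h1 : a x - a y = (a x - A) - (a y - A) := by abel
    have h2 := hρ x y
    rw [h1, norm_sub_sq_real (a x - A)] at h2
    linarith
  have ha : ∀ x, aM ρ (unif z n) x = (1/2) * ‖a x - A‖ ^ 2 + (1/2) * Q := fun x => by
    unfold aM
    rw [unif_integral]
    simp only [hρ', Finset.sum_sub_distrib, Finset.sum_add_distrib, ← inner_sum, hcen,
      ← Finset.mul_sum, inner_zero_right]
    rw [hQ]; simp; field_simp
  have hD : DM ρ (unif z n) = Q := by
    unfold DM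
    rw [unif_prod_integral _ _ hn]
    have : ∀ k, (n : ℝ)⁻¹ * ∑ l ∈ Finset.range n, ρ (z k) (z l)
        = (1/2) * ‖a (z k) - A‖ ^ 2 + (1/2) * Q := fun k => by
      rw [← ha]; unfold aM; rw [unif_integral]
    simp only [this, Finset.sum_add_distrib, ← Finset.mul_sum]
    rw [mul_add, mul_left_comm, ← hQ]; simp; field_simp; ring
  unfold dM
  rw [ha, ha, hD, hρ']
  ring

theorem dcov_unif {X Y H H' : Type*} [MeasurableSpace X] [MeasurableSingletonClass X]
    [MeasurableSpace Y] [MeasurableSingletonClass Y]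
    [NormedAddCommGroup H] [InnerProductSpace ℝ H]
    [NormedAddCommGroup H'] [InnerProductSpace ℝ H'] (a : X → H) (ρ : X → X → ℝ)
    (hρ : ∀ x y, 2 * ρ x y = ‖a x - a y‖ ^ 2) (b : Y → H') (ρ' : Y → Y → ℝ)
    (hρ' : ∀ x y, 2 * ρ' x y = ‖b x - b y‖ ^ 2)
    (z : ℕ → X × Y) (n : ℕ) (hn : 0 < n) :
    dcov ρ ρ' (unif z n) = (n : ℝ)⁻¹ * ∑ s ∈ Finset.range n, ((n : ℝ)⁻¹ * ∑ t ∈ Finset.range n,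
      (inner ℝ (a (z s).1 - (n : ℝ)⁻¹ • ∑ k ∈ Finset.range n, a (z k).1)
        (a (z t).1 - (n : ℝ)⁻¹ • ∑ k ∈ Finset.range n, a (z k).1) *
      inner ℝ (b (z s).2 - (n : ℝ)⁻¹ • ∑ k ∈ Finset.range n, b (z k).2)
        (b (z t).2 - (n : ℝ)⁻¹ • ∑ k ∈ Finset.range n, b (z k).2))) := by
  unfold dcov
  rw [unif_prod_integral _ _ hn]
  unfold deltaTheta
  rw [unif_map _ _ _ measurable_fst, unif_map _ _ _ measurable_snd]
  simp only [dM_unif a ρ hρ _ n hn, dM_unif b ρ' hρ' _ n hn, neg_mul_neg]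

/-! ℓ² vectors -/

/-- real sequence space -/
abbrev L2 := lp (fun _ : ℕ => ℝ) 2

theorem memℓ2 {a : ℕ → ℝ} (h : Summable fun i => a i ^ 2) : Memℓp a 2 := by
  rw [memℓp_gen_iff (by norm_num)]
  simpa using h

theorem l2_norm_sq (a : L2) : ‖a‖ ^ 2 = ∑' i, a i ^ 2 := by
  have := lp.norm_rpow_eq_tsum (p := 2) (by norm_num) a
  simpa using this

theorem l2_summable (a : L2) : Summable fun i => a i ^ 2 := by
  have := (memℓp_gen_iff (p := 2) (by norm_num)).mp (lp.memℓp a)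
  simpa using this

theorem l2_inner (a b : L2) : HasSum (fun i => a i * b i) (inner ℝ a b) := by
  have := lp.hasSum_inner (𝕜 := ℝ) a b
  simpa [mul_comm] using this

theorem l2_strong {X : Type*} [MeasurableSpace X] (a : X → L2)
    (h : ∀ i, Measurable fun x => a x i) : StronglyMeasurable a := by
  have hS : ∀ n : ℕ, StronglyMeasurable fun x => ∑ i ∈ Finset.range n, lp.single 2 i (a x i) := by
    intro n
    refine Finset.stronglyMeasurable_fun_sum _ fun i _ => ?_
    have hc : Continuous fun t : ℝ => (lp.single 2 i t : L2) := by
      refine (LipschitzWith.of_dist_le_mul (K := 1) fun s t => ?_).continuous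
      rw [dist_eq_norm, ← lp.single_sub, lp.norm_single (by norm_num)]
      simp [Real.dist_eq]
    exact hc.comp_stronglyMeasurable (h i).stronglyMeasurable
  refine stronglyMeasurable_of_tendsto atTop hS ?_
  rw [tendsto_pi_nhds]
  intro x
  exact (lp.hasSum_single (p := 2) (by norm_num) (a x)).tendsto_sum_nat


theorem l2_integral_zero {Ω : Type*} [MeasurableSpace Ω] {P : Measure Ω} {a : Ω → L2}
    (hi : Integrable a P) (h0 : ∀ i, ∫ ω, a ω i ∂P = 0) : ∫ ω, a ω ∂P = 0 := by
  ext i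
  have := (lp.evalCLM ℝ (fun _ : ℕ => ℝ) 2 i).integral_comp_comm hi
  change ∫ ω, a ω i ∂P = (∫ ω, a ω ∂P : L2) i at this
  rw [← this, h0]; rfl

theorem Merc.vec {X : Type*} [MeasurableSpace X] {ρ : X → X → ℝ} {μ : Measure X} {ε : ℝ}
    {u : ℕ → X → ℝ} {κ : ℕ → ℝ} [IsProbabilityMeasure μ] (hε : 0 < ε) (M : Merc ρ μ ε u κ) :
    ∃ a : X → L2, (∀ x i, a x i = u i x) ∧ StronglyMeasurable a ∧
      (∀ x y, 2 * ρ x y = ‖a x - a y‖ ^ 2) ∧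
      Integrable (fun x => ‖a x‖ ^ (2 + 2 * ε)) μ ∧ ∫ x, a x ∂μ = 0 := by
  have hs : ∀ x, Summable fun i => u i x ^ 2 := fun x => by
    simpa [pow_two] using (M.sum x x).summable
  let a : X → L2 := fun x => ⟨fun i => u i x, memℓ2 (hs x)⟩
  have ha : ∀ x i, a x i = u i x := fun x i => rfl
  have hst : StronglyMeasurable a := l2_strong a fun i => M.meas i
  have hn : ∀ x, ‖a x‖ ^ 2 = - dM ρ μ x x := fun x => by
    rw [l2_norm_sq, ← (M.sum x x).tsum_eq]
    simp only [ha, pow_two]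
  have hi : Integrable (fun x => ‖a x‖ ^ (2 + 2 * ε)) μ := by
    refine M.mom.congr (Eventually.of_forall fun x => ?_)
    simp only
    rw [← hn, ← Real.rpow_natCast, ← Real.rpow_mul (norm_nonneg _)]
    congr 1; push_cast; ring
  refine ⟨a, ha, hst, fun x y => ?_, hi, ?_⟩
  · rw [l2_norm_sq, ← (M.diff x y).tsum_eq]
    rfl
  · exact l2_integral_zero (integrable_of_moment hε hst.aestronglyMeasurable hi) M.zero

theorem hasSum_unpair {f g : ℕ → ℝ} {s t : ℝ} (hf : HasSum f s) (hg : HasSum g t)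
    (hf2 : Summable fun i => |f i|) (hg2 : Summable fun i => |g i|) :
    HasSum (fun k : ℕ => f k.unpair.1 * g k.unpair.2) (s * t) := by
  have h := hf.mul hg (Summable.mul_of_nonneg hf2 hg2 (fun _ => abs_nonneg _) (fun _ => abs_nonneg _)
    |>.of_norm_bounded (fun p => by simp [abs_mul]))
  exact (Nat.pairEquiv.symm.hasSum_iff (f := fun p : ℕ × ℕ => f p.1 * g p.2)).mpr h

theorem summable_abs_mul (a b : L2) : Summable fun i => |a i * b i| := by
  refine Summable.of_nonneg_of_le (fun _ => abs_nonneg _) (fun i => ?_)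
    ((l2_summable a).add (l2_summable b))
  rw [abs_le]; constructor <;> nlinarith [sq_nonneg (a i + b i), sq_nonneg (a i - b i), sq_nonneg (a i), sq_nonneg (b i)]

/-- tensor product of two sequences -/
def tens (a b : L2) : L2 := ⟨fun k => a k.unpair.1 * b k.unpair.2, memℓ2 (by
  have h := hasSum_unpair (l2_summable a).hasSum (l2_summable b).hasSum
    (by simpa using l2_summable a) (by simpa using l2_summable b)
  simpa [mul_pow] using h.summable)⟩

theorem tens_apply (a b : L2) (k : ℕ) : tens a b k = a k.unpair.1 * b k.unpair.2 := rfl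

theorem tens_inner (a b a' b' : L2) :
    inner ℝ (tens a b) (tens a' b') = inner ℝ a a' * inner ℝ b b' := by
  have h := hasSum_unpair (l2_inner a a') (l2_inner b b') (summable_abs_mul _ _) (summable_abs_mul _ _)
  refine (l2_inner _ _).unique (hasSum_of_eq h (fun i => ?_) rfl)
  simp only [tens_apply]; ring

theorem tens_norm (a b : L2) : ‖tens a b‖ = ‖a‖ * ‖b‖ := by
  have h := tens_inner a b a b
  rw [real_inner_self_eq_norm_sq, real_inner_self_eq_norm_sq, real_inner_self_eq_norm_sq, ← mul_pow] at h
  exact (pow_left_inj₀ (norm_nonneg _) (by positivity) two_ne_zero).mp h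

theorem sum_coord {ι : Type*} (A : Finset ι) (f : ι → L2) (k : ℕ) :
    (∑ t ∈ A, f t : L2) k = ∑ t ∈ A, f t k := by
  exact map_sum (lp.evalCLM ℝ (fun _ : ℕ => ℝ) 2 k) f A

theorem tens_center (n : ℕ) (hn : 0 < n) (a b : ℕ → L2) :
    ∑ t ∈ Finset.range n, tens (a t - (n : ℝ)⁻¹ • ∑ k ∈ Finset.range n, a k)
      (b t - (n : ℝ)⁻¹ • ∑ k ∈ Finset.range n, b k) =
    ∑ t ∈ Finset.range n, tens (a t) (b t) -
      tens ((√n)⁻¹ • ∑ k ∈ Finset.range n, a k) ((√n)⁻¹ • ∑ k ∈ Finset.range n, b k) := by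
  have hn0 : (n : ℝ) ≠ 0 := by positivity
  have hs : (√n : ℝ)⁻¹ * (√n)⁻¹ = (n : ℝ)⁻¹ := by
    rw [← mul_inv, Real.mul_self_sqrt (Nat.cast_nonneg n)]
  ext k
  simp only [lp.coeFn_sub, Pi.sub_apply, sum_coord, tens_apply, lp.coeFn_smul, Pi.smul_apply, smul_eq_mul]
  set p := k.unpair.1
  set q := k.unpair.2
  simp only [sub_mul, mul_sub, Finset.sum_sub_distrib, ← Finset.mul_sum, ← Finset.sum_mul,
    Finset.sum_const, Finset.card_range, nsmul_eq_mul]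
  set s := ∑ i ∈ Finset.range n, a i p
  set t := ∑ i ∈ Finset.range n, b i q
  have : (√n : ℝ)⁻¹ * s * ((√n)⁻¹ * t) = (n : ℝ)⁻¹ * (s * t) := by rw [← hs]; ring
  rw [this]
  field_simp
  ring

theorem n_dcov {X Y : Type*} [MeasurableSpace X] [MeasurableSingletonClass X]
    [MeasurableSpace Y] [MeasurableSingletonClass Y] (a : X → L2) (ρ : X → X → ℝ)
    (hρ : ∀ x y, 2 * ρ x y = ‖a x - a y‖ ^ 2) (b : Y → L2) (ρ' : Y → Y → ℝ)
    (hρ' : ∀ x y, 2 * ρ' x y = ‖b x - b y‖ ^ 2)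
    (z : ℕ → X × Y) (n : ℕ) (hn : 0 < n) :
    n * dcov ρ ρ' (unif z n) = ‖(√n)⁻¹ • ∑ t ∈ Finset.range n, tens (a (z t).1) (b (z t).2)
      - (√n)⁻¹ • tens ((√n)⁻¹ • ∑ k ∈ Finset.range n, a (z k).1)
        ((√n)⁻¹ • ∑ k ∈ Finset.range n, b (z k).2)‖ ^ 2 := by
  have hn0 : (n : ℝ) ≠ 0 := by positivity
  rw [← smul_sub, ← tens_center n hn (fun t => a (z t).1) (fun t => b (z t).2), norm_smul, mul_pow,
    norm_sum_sq, dcov_unif a ρ hρ b ρ' hρ' z n hn]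
  simp only [tens_inner, ← Finset.mul_sum]
  rw [Real.norm_eq_abs, sq_abs, inv_pow, Real.sq_sqrt (Nat.cast_nonneg n), ← mul_assoc, mul_inv_cancel₀ hn0, one_mul]


theorem chol {Γ : ℕ → ℕ → ℝ} (hΓ : PSDk Γ) : ∃ L : ℕ → ℕ → ℝ, (∀ k j, k < j → L k j = 0) ∧
    ∀ N k l, k < N → l < N → ∑ j ∈ Finset.range N, L k j * L l j = Γ k l := by
  obtain ⟨H, i1, i2, i3, v, hv⟩ := gram_exists hΓ
  set g := InnerProductSpace.gramSchmidt ℝ v with hg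
  have hdef : ∀ k, v k = g k + ∑ i ∈ Finset.Iio k, (inner ℝ (g i) (v k) / ‖g i‖ ^ 2) • g i :=
    fun k => InnerProductSpace.gramSchmidt_def'' ℝ v k
  have hort : ∀ i j, i ≠ j → inner ℝ (g i) (g j) = 0 := fun i j h =>
    InnerProductSpace.gramSchmidt_orthogonal ℝ v h
  have htri : ∀ k j, k < j → inner ℝ (g j) (v k) = 0 := fun k j h => by
    rw [hdef k, inner_add_right, inner_sum, hort j k h.ne', zero_add]
    refine Finset.sum_eq_zero fun i hi => ?_
    rw [inner_smul_right, hort j i, mul_zero]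
    have := Finset.mem_Iio.1 hi
    omega
  have hdiag : ∀ k, inner ℝ (g k) (v k) = ‖g k‖ ^ 2 := fun k => by
    conv_lhs => rw [hdef k]
    rw [inner_add_right, inner_sum, real_inner_self_eq_norm_sq, Finset.sum_eq_zero, add_zero]
    intro i hi
    rw [inner_smul_right, hort k i, mul_zero]
    have := Finset.mem_Iio.1 hi
    omega
  have hexp : ∀ N k, k < N → v k = ∑ j ∈ Finset.range N, (inner ℝ (g j) (v k) / ‖g j‖ ^ 2) • g j := by
    intro N k hk
    have h1 : Finset.range (k + 1) ⊆ Finset.range N := Finset.range_subset_range.2 hk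
    rw [← Finset.sum_subset h1, Finset.sum_range_succ, ← Nat.Iio_eq_range]
    · conv_lhs => rw [hdef k]
      rw [add_comm, hdiag]
      congr 1
      by_cases h : g k = 0
      · rw [h]; simp
      · rw [div_self (by positivity), one_smul]
    · intro j _ hj
      rw [htri k j (by simpa using hj)]; simp
  refine ⟨fun k j => inner ℝ (g j) (v k) / ‖g j‖, fun k j h => by simp [htri k j h], ?_⟩
  intro N k l hk hl
  rw [← hv, hexp N l hl, inner_sum]
  refine Finset.sum_congr rfl fun j _ => ?_
  rw [inner_smul_right, real_inner_comm (g j) (v k)]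
  simp only
  ring

theorem gauss_lin (s : ℕ → ℝ) (N : ℕ) :
    (Measure.infinitePi (fun _ : ℕ => gaussianReal 0 1)).map
      (fun ω => ∑ j ∈ Finset.range N, s j * ω j) =
      gaussianReal 0 (Real.toNNReal (∑ j ∈ Finset.range N, s j ^ 2)) := by
  set P := Measure.infinitePi (fun _ : ℕ => gaussianReal 0 1) with hP
  have hm : Measurable fun ω : ℕ → ℝ => ∑ j ∈ Finset.range N, s j * ω j := by fun_prop
  have : IsProbabilityMeasure (P.map (fun ω => ∑ j ∈ Finset.range N, s j * ω j)) :=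
    Measure.isProbabilityMeasure_map hm.aemeasurable
  have hind : iIndepFun (fun (i : ℕ) (ω : ℕ → ℝ) => ω i) P :=
    iIndepFun_infinitePi (X := fun _ x => x) (fun _ => measurable_id)
  have hind' : iIndepFun (fun (i : Fin N) (ω : ℕ → ℝ) => ω i) P :=
    hind.precomp (g := fun i : Fin N => (i : ℕ)) Fin.val_injective
  refine Measure.ext_of_charFun ?_
  ext t
  rw [charFun_gaussianReal, charFun_apply_real, integral_map hm.aemeasurable (by fun_prop)]
  have e1 : ∀ ω : ℕ → ℝ, Complex.exp (t * ((∑ j ∈ Finset.range N, s j * ω j : ℝ) : ℂ) * Complex.I) =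
      ∏ i : Fin N, Complex.exp (((t * s i : ℝ) : ℂ) * (ω i : ℝ) * Complex.I) := fun ω => by
    rw [← Complex.exp_sum]
    congr 1
    rw [← Fin.sum_univ_eq_sum_range (fun j => s j * ω j)]
    push_cast
    rw [Finset.mul_sum, Finset.sum_mul]
    exact Finset.sum_congr rfl fun i _ => by ring
  simp_rw [e1]
  rw [hind'.integral_fun_prod_comp (f := fun (i : Fin N) (x : ℝ) =>
    Complex.exp (((t * s i : ℝ) : ℂ) * x * Complex.I)) (fun i => (measurable_pi_apply (i : ℕ)).aemeasurable) (fun i => by fun_prop)]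
  have e2 : ∀ i : Fin N, ∫ ω, Complex.exp (((t * s i : ℝ) : ℂ) * (ω i : ℝ) * Complex.I) ∂P =
      Complex.exp (-(t ^ 2 / 2 * s i ^ 2 : ℂ)) := fun i => by
    have h1 : ∫ ω, Complex.exp (((t * s i : ℝ) : ℂ) * (ω i : ℝ) * Complex.I) ∂P =
      charFun (P.map (fun ω => ω i)) (t * s i) := by
      rw [charFun_apply_real, integral_map (measurable_pi_apply (i : ℕ)).aemeasurable (by fun_prop)]
    rw [h1]
    have h2 : P.map (fun ω => ω i) = gaussianReal 0 1 := Measure.infinitePi_map_eval _ (i : ℕ)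
    rw [h2, charFun_gaussianReal]
    congr 1
    push_cast; ring
  simp_rw [e2]
  rw [← Complex.exp_sum]
  congr 1
  rw [Real.coe_toNNReal _ (Finset.sum_nonneg fun _ _ => sq_nonneg _),
    ← Fin.sum_univ_eq_sum_range (fun j => s j ^ 2)]
  push_cast
  rw [Finset.sum_neg_distrib, ← Finset.mul_sum]
  ring

/-- Gaussian sequence with given covariance -/
structure GSeq {Ω' : Type} [MeasurableSpace Ω'] (P' : Measure Ω') (G : ℕ → Ω' → ℝ)
    (Γ : ℕ → ℕ → ℝ) : Prop where
  meas : ∀ k, Measurable (G k)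
  nonneg : ∀ m (t : ℕ → ℝ), 0 ≤ ∑ k ∈ Finset.range m, ∑ l ∈ Finset.range m, t k * t l * Γ k l
  law : ∀ m (t : ℕ → ℝ), P'.map (fun ω => ∑ k ∈ Finset.range m, t k * G k ω) =
    gaussianReal 0 (Real.toNNReal (∑ k ∈ Finset.range m, ∑ l ∈ Finset.range m, t k * t l * Γ k l))

theorem gauss_seq {Γ : ℕ → ℕ → ℝ} (hΓ : PSDk Γ) : ∃ (Ω' : Type) (_ : MeasurableSpace Ω')
    (P' : Measure Ω') (_ : IsProbabilityMeasure P') (G : ℕ → Ω' → ℝ), GSeq P' G Γ := by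
  obtain ⟨L, hL0, hL⟩ := chol hΓ
  have key : ∀ m (t : ℕ → ℝ), ∑ k ∈ Finset.range m, ∑ l ∈ Finset.range m, t k * t l * Γ k l =
      ∑ j ∈ Finset.range m, (∑ k ∈ Finset.range m, t k * L k j) ^ 2 := fun m t => by
    simp_rw [pow_two, Finset.sum_mul_sum]
    rw [Finset.sum_comm]
    conv_rhs => rw [Finset.sum_comm]
    rw [Finset.sum_comm]
    refine Finset.sum_congr rfl fun k hk => ?_
    rw [Finset.sum_comm]
    refine Finset.sum_congr rfl fun l hl => ?_
    rw [← hL m k l (by simpa using hk) (by simpa using hl), Finset.mul_sum]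
    exact Finset.sum_congr rfl fun j _ => by ring
  refine ⟨ℕ → ℝ, inferInstance, Measure.infinitePi (fun _ : ℕ => gaussianReal 0 1), inferInstance,
    fun k ω => ∑ j ∈ Finset.range (k + 1), L k j * ω j, fun k => by fun_prop, fun m t => ?_,
    fun m t => ?_⟩
  · rw [key]; exact Finset.sum_nonneg fun _ _ => sq_nonneg _
  · rw [key, ← gauss_lin]
    congr 1
    ext ω
    simp_rw [Finset.sum_mul]
    rw [Finset.sum_comm]
    refine Finset.sum_congr rfl fun k hk => ?_
    have h1 : Finset.range (k + 1) ⊆ Finset.range m :=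
      Finset.range_subset_range.2 (by simpa using hk)
    rw [Finset.sum_subset h1, Finset.mul_sum]
    · exact Finset.sum_congr rfl fun j _ => by ring
    · intro j _ hj
      rw [hL0 k j (by simpa using hj), zero_mul]

namespace GSeq
variable {Ω' : Type} [MeasurableSpace Ω'] {P' : Measure Ω'} {G : ℕ → Ω' → ℝ} {Γ : ℕ → ℕ → ℝ}

theorem lin (S : GSeq P' G Γ) (k : ℕ) : P'.map (G k) = gaussianReal 0 (Real.toNNReal (Γ k k)) ∧
    0 ≤ Γ k k := by
  have h := S.law (k + 1) (fun i => if i = k then 1 else 0)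
  have h' := S.nonneg (k + 1) (fun i => if i = k then 1 else 0)
  simp at h h'
  exact ⟨h, h'⟩

theorem gauss_mom {Ω' : Type} [MeasurableSpace Ω'] {P' : Measure Ω'} {f : Ω' → ℝ} (hf : Measurable f)
    {v : ℝ≥0} (h : P'.map f = gaussianReal 0 v) : MemLp f 2 P' ∧ ∫ ω, f ω ∂P' = 0 ∧
      ∫ ω, f ω ^ 2 ∂P' = v := by
  refine ⟨?_, ?_, ?_⟩
  · have := memLp_id_gaussianReal (μ := 0) (v := v) 2
    rw [← h] at this
    exact (memLp_map_measure_iff (by fun_prop) hf.aemeasurable).1 this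
  · have := integral_id_gaussianReal (μ := 0) (v := v)
    rw [← h, integral_map hf.aemeasurable (by fun_prop)] at this
    exact this
  · have := variance_id_gaussianReal (μ := 0) (v := v)
    rw [variance_eq_integral (by fun_prop), ← h, integral_map hf.aemeasurable (by fun_prop),
      integral_map hf.aemeasurable (by fun_prop)] at this
    have h2 := integral_id_gaussianReal (μ := 0) (v := v)
    rw [← h, integral_map hf.aemeasurable (by fun_prop)] at h2
    simpa [h2] using this

theorem cov (S : GSeq P' G Γ) (hsymm : ∀ k l, Γ k l = Γ l k) (k l : ℕ) :
    ∫ ω, G k ω * G l ω ∂P' = Γ k l := by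
  have hk := gauss_mom (S.meas k) (S.lin k).1
  have hl := gauss_mom (S.meas l) (S.lin l).1
  rw [Real.coe_toNNReal _ (S.lin _).2] at hk hl
  by_cases hkl : k = l
  · subst hkl
    rw [← hk.2.2]; simp only [pow_two]
  set t : ℕ → ℝ := fun i => (if i = k then 1 else 0) + (if i = l then 1 else 0) with ht
  set m := max k l + 1 with hm
  have hkm : k < m := by omega
  have hlm : l < m := by omega
  have e : ∀ ω, ∑ i ∈ Finset.range m, t i * G i ω = G k ω + G l ω := fun ω => by
    simp [ht, add_mul, Finset.sum_add_distrib, hkm, hlm]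
  have e' : ∑ i ∈ Finset.range m, ∑ j ∈ Finset.range m, t i * t j * Γ i j =
      Γ k k + Γ l l + 2 * Γ k l := by
    simp [ht, add_mul, mul_add, Finset.sum_add_distrib, hkm, hlm]
    rw [hsymm l k]; ring
  have h := S.law m t
  have h' := S.nonneg m t
  simp only [e, e'] at h h'
  have h3 := (gauss_mom ((S.meas k).add (S.meas l)) h).2.2
  rw [Real.coe_toNNReal _ h'] at h3
  have i1 := hk.1.integrable_sq
  have i2 := hl.1.integrable_sq
  have i3 : Integrable (fun ω => G k ω * G l ω) P' := hk.1.integrable_mul hl.1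
  have h4 : ∫ ω, (G k ω + G l ω) ^ 2 ∂P' = ∫ ω, (G k ω ^ 2 + G l ω ^ 2 + 2 * (G k ω * G l ω)) ∂P' :=
    integral_congr_ae (Eventually.of_forall fun ω => by ring)
  have h5 := integral_add (i1.add i2) (i3.const_mul 2)
  simp only [Pi.add_apply] at h5
  rw [h5, integral_add i1 i2, integral_const_mul, hk.2.2,
    hl.2.2] at h4
  simp only [Pi.add_apply] at h3
  linarith

theorem char (S : GSeq P' G Γ) (m : ℕ) (t : ℕ → ℝ) :
    ∫ ω, ce (∑ k ∈ Finset.range m, t k * G k ω) ∂P' = (Real.exp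
      (-(∑ k ∈ Finset.range m, ∑ l ∈ Finset.range m, t k * t l * Γ k l) / 2) : ℂ) := by
  have hm : Measurable (fun ω => ∑ k ∈ Finset.range m, t k * G k ω) := by
    have := S.meas
    fun_prop
  have h := charFun_gaussianReal (μ := 0) (v := (Real.toNNReal
    (∑ k ∈ Finset.range m, ∑ l ∈ Finset.range m, t k * t l * Γ k l))) 1
  rw [← S.law m t, charFun_apply_real, integral_map hm.aemeasurable (by fun_prop),
    Real.coe_toNNReal _ (S.nonneg m t)] at h
  unfold ce
  rw [Complex.ofReal_exp]
  convert h using 2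
  · ext ω; congr 1; push_cast; ring
  · push_cast; ring
end GSeq


/-- tail of a sequence -/
def tailv (m : ℕ) (a : L2) : L2 := a - ∑ i ∈ Finset.range m, lp.single 2 i (a i)

theorem tailv_apply (m : ℕ) (a : L2) (i : ℕ) : tailv m a i = if i < m then 0 else a i := by
  unfold tailv
  rw [lp.coeFn_sub, Pi.sub_apply, sum_coord]
  simp only [lp.single_apply, Finset.sum_pi_single, Finset.mem_range]
  split_ifs <;> simp

theorem tailv_norm (m : ℕ) (a : L2) : ‖a‖ ^ 2 = ∑ i ∈ Finset.range m, a i ^ 2 + ‖tailv m a‖ ^ 2 := by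
  rw [l2_norm_sq, l2_norm_sq, ← (l2_summable a).sum_add_tsum_nat_add m,
    ← (l2_summable (tailv m a)).sum_add_tsum_nat_add m]
  rw [Finset.sum_eq_zero (f := fun i => (tailv m a i) ^ 2)]
  · simp [tailv_apply]
  · intro i hi
    simp [tailv_apply, Finset.mem_range.1 hi]

theorem tailv_le (m : ℕ) (a : L2) : ‖tailv m a‖ ≤ ‖a‖ := by
  have h := tailv_norm m a
  have h2 : 0 ≤ ∑ i ∈ Finset.range m, a i ^ 2 := Finset.sum_nonneg fun _ _ => sq_nonneg _
  exact (sq_le_sq₀ (norm_nonneg _) (norm_nonneg _)).1 (by linarith)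

theorem tailv_tendsto (a : L2) : Tendsto (fun m => ‖tailv m a‖) atTop (𝓝 0) := by
  have h := (lp.hasSum_single (p := 2) (by norm_num) a).tendsto_sum_nat
  have := (tendsto_const_nhds (x := a)).sub h
  rw [sub_self] at this
  have h2 := this.norm
  rw [norm_zero] at h2
  exact h2

theorem head_close (m : ℕ) (a : L2) : |‖a‖ - √(∑ i ∈ Finset.range m, a i ^ 2)| ≤ ‖tailv m a‖ := by
  have h := tailv_norm m a
  set s := ∑ i ∈ Finset.range m, a i ^ 2 with hs
  have h2 : 0 ≤ s := Finset.sum_nonneg fun _ _ => sq_nonneg _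
  have h3 := Real.sq_sqrt h2
  have h4 := Real.sqrt_nonneg s
  have h5 := norm_nonneg a
  have h6 := norm_nonneg (tailv m a)
  rw [abs_le]
  constructor
  · nlinarith
  · by_contra hc
    push Not at hc
    nlinarith

theorem tailv_sum {ι : Type*} (m : ℕ) (A : Finset ι) (f : ι → L2) :
    tailv m (∑ t ∈ A, f t) = ∑ t ∈ A, tailv m (f t) := by
  ext i
  simp only [tailv_apply, sum_coord]
  split_ifs <;> simp

theorem tailv_smul (m : ℕ) (c : ℝ) (a : L2) : tailv m (c • a) = c • tailv m a := by
  ext i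
  simp only [tailv_apply, lp.coeFn_smul, Pi.smul_apply, smul_eq_mul]
  split_ifs <;> simp

theorem coord_meas {𝒵 : Type*} [MeasurableSpace 𝒵] {g : 𝒵 → L2} (hg : StronglyMeasurable g) (k : ℕ) :
    Measurable fun z => g z k :=
  ((lp.evalCLM ℝ (fun _ : ℕ => ℝ) 2 k).continuous.comp_stronglyMeasurable hg).measurable

/-- centered vector-valued functional with moments -/
structure GV {Ω 𝒵 : Type*} [MeasurableSpace Ω] [MeasurableSpace 𝒵] (P : Measure Ω)
    (Z : ℕ → Ω → 𝒵) (ε : ℝ) (g : 𝒵 → L2) : Prop where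
  sm : StronglyMeasurable g
  mom : Integrable (fun ω => ‖g (Z 0 ω)‖ ^ (2 + 2 * ε)) P
  cen : ∫ ω, g (Z 0 ω) ∂P = 0

section
variable {Ω 𝒵 : Type*} [mΩ : MeasurableSpace Ω] [m𝒵 : MeasurableSpace 𝒵] {P : Measure Ω}
    {Z : ℕ → Ω → 𝒵} {C r ε : ℝ}
namespace MixSetup

lemma mono_mom (S : MixSetup P Z C r ε) {E F : Type*} [NormedAddCommGroup E] [NormedAddCommGroup F]
    {g : 𝒵 → E} {h : 𝒵 → F}
    (hi : Integrable (fun ω => ‖g (Z 0 ω)‖ ^ (2 + 2 * ε)) P) (hh : StronglyMeasurable h)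
    (hle : ∀ z, ‖h z‖ ≤ ‖g z‖) : Integrable (fun ω => ‖h (Z 0 ω)‖ ^ (2 + 2 * ε)) P := by
  have hε := S.eps
  refine hi.mono' ?_ (Eventually.of_forall fun ω => ?_)
  · exact (((hh.comp_measurable (S.meas 0)).norm.measurable).pow_const _).aestronglyMeasurable
  · rw [Real.norm_of_nonneg (by positivity)]
    exact Real.rpow_le_rpow (norm_nonneg _) (hle _) (by positivity)

lemma gv_coord (S : MixSetup P Z C r ε) {g : 𝒵 → L2} (hg : GV P Z ε g) (k : ℕ) :
    Measurable (fun z => g z k) ∧ Integrable (fun ω => ‖g (Z 0 ω) k‖ ^ (2 + 2 * ε)) P ∧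
      ∫ ω, g (Z 0 ω) k ∂P = 0 := by
  refine ⟨coord_meas hg.sm k, S.mono_mom (h := fun z => g z k) hg.mom
    (coord_meas hg.sm k).stronglyMeasurable (fun z => lp.norm_apply_le_norm (by norm_num) _ _), ?_⟩
  have hi : Integrable (fun ω => g (Z 0 ω)) P := by
    have := S.prob
    exact integrable_of_moment S.eps (hg.sm.comp_measurable (S.meas 0)).aestronglyMeasurable hg.mom
  have := (lp.evalCLM ℝ (fun _ : ℕ => ℝ) 2 k).integral_comp_comm hi
  rw [hg.cen, map_zero] at this
  exact this

lemma gv_tail (S : MixSetup P Z C r ε) {g : 𝒵 → L2} (hg : GV P Z ε g) (m : ℕ) :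
    GV P Z ε (fun z => tailv m (g z)) := by
  have hsm : StronglyMeasurable fun z => tailv m (g z) := by
    refine l2_strong _ fun i => ?_
    simp only [tailv_apply]
    split_ifs
    · exact measurable_const
    · exact coord_meas hg.sm i
  have hi := S.mono_mom hg.mom hsm (fun z => tailv_le m _)
  have := S.prob
  refine ⟨hsm, hi, l2_integral_zero (integrable_of_moment S.eps
    (hsm.comp_measurable (S.meas 0)).aestronglyMeasurable hi) fun i => ?_⟩
  simp only [tailv_apply]
  split_ifs
  · simp
  · exact (S.gv_coord hg i).2.2

/-- existence of the long-run covariance -/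
lemma exists_Gam (S : MixSetup P Z C r ε) {g : 𝒵 → L2} (hg : GV P Z ε g) :
    ∃ Γ : ℕ → ℕ → ℝ, PSDk Γ ∧ ∀ k l, Tendsto (fun n : ℕ => (n : ℝ)⁻¹ *
      ∑ t ∈ Finset.range n, ∑ u ∈ Finset.range n, ∫ ω, g (Z t ω) k * g (Z u ω) l ∂P) atTop
        (𝓝 (Γ k l)) := by
  have hc := S.gv_coord hg
  have hsm := fun k => (hc k).1.stronglyMeasurable
  choose Γ hΓ using fun k l => S.exists_lrcov (hsm k) (hsm l) (hc k).2.1 (hc l).2.1 (hc k).2.2 (hc l).2.2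
  refine ⟨Γ, PSDk.limit (fun n => ?_) hΓ, hΓ⟩
  have hintg : ∀ k l, Integrable (fun ω => (∑ t ∈ Finset.range n, g (Z t ω) k) *
      (∑ t ∈ Finset.range n, g (Z t ω) l)) P := fun k l => by
    simp_rw [Finset.sum_mul_sum]
    refine integrable_finsetSum _ fun t _ => integrable_finsetSum _ fun u _ => ?_
    have := S.integrable_inner (hsm k) (hsm l) (hc k).2.1 (hc l).2.1 t u
    simpa [mul_comm] using this
  have e := fun k l => S.integral_sum_mul (hsm k) (hsm l) (hc k).2.1 (hc l).2.1 (Finset.range n)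
  simp only at e
  refine ⟨fun k l => ?_, fun c => ?_⟩
  · beta_reduce
    rw [← e k l, ← e l k]
    congr 1
    exact integral_congr_ae (Eventually.of_forall fun ω => mul_comm _ _)
  · have : ∑ x ∈ c.support, ∑ y ∈ c.support, c x * c y * ((n : ℝ)⁻¹ *
      ∑ t ∈ Finset.range n, ∑ u ∈ Finset.range n, ∫ ω, g (Z t ω) x * g (Z u ω) y ∂P) =
      (n : ℝ)⁻¹ * ∫ ω, (∑ x ∈ c.support, c x * ∑ t ∈ Finset.range n, g (Z t ω) x) ^ 2 ∂P := by
      simp_rw [pow_two, Finset.sum_mul_sum]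
      simp_rw [mul_mul_mul_comm]
      rw [integral_finsetSum _ fun k _ => integrable_finsetSum _ fun l _ => (hintg k l).const_mul _,
        Finset.mul_sum]
      refine Finset.sum_congr rfl fun k _ => ?_
      rw [integral_finsetSum _ fun l _ => (hintg k l).const_mul _, Finset.mul_sum]
      refine Finset.sum_congr rfl fun l _ => ?_
      rw [integral_const_mul, e]; ring
    rw [this]
    exact mul_nonneg (by positivity) (integral_nonneg fun ω => sq_nonneg _)

/-- finite dimensional CLT, characteristic functions -/
lemma fdd_char (S : MixSetup P Z C r ε) {g : 𝒵 → L2} (hg : GV P Z ε g) {Γ : ℕ → ℕ → ℝ}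
    (hΓ : ∀ k l, Tendsto (fun n : ℕ => (n : ℝ)⁻¹ *
      ∑ t ∈ Finset.range n, ∑ u ∈ Finset.range n, ∫ ω, g (Z t ω) k * g (Z u ω) l ∂P) atTop
        (𝓝 (Γ k l))) (m : ℕ) (c : ℕ → ℝ) :
    Tendsto (fun n : ℕ => ∫ ω, ce (∑ k ∈ Finset.range m, c k *
      ((√n)⁻¹ • ∑ t ∈ Finset.range n, g (Z t ω) : L2) k) ∂P) atTop
      (𝓝 (Real.exp (-(∑ k ∈ Finset.range m, ∑ l ∈ Finset.range m, c k * c l * Γ k l) / 2) : ℂ)) := by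
  have hc := S.gv_coord hg
  have := S.prob
  have hsm := fun k => (hc k).1.stronglyMeasurable
  set h : 𝒵 → ℝ := fun z => ∑ k ∈ Finset.range m, c k * g z k with hh
  have hhm : Measurable h := by
    have := fun k => (hc k).1
    fun_prop
  have hcm : Integrable (fun ω => ‖(∑ k ∈ Finset.range m, |c k|) • g (Z 0 ω)‖ ^ (2 + 2 * ε)) P := by
    simp_rw [norm_smul, Real.mul_rpow (norm_nonneg _) (norm_nonneg _)]
    exact hg.mom.const_mul _
  have hi : Integrable (fun ω => ‖h (Z 0 ω)‖ ^ (2 + 2 * ε)) P := by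
    refine S.mono_mom (g := fun z => (∑ k ∈ Finset.range m, |c k|) • g z) hcm hhm.stronglyMeasurable
      fun z => ?_
    rw [norm_smul, Real.norm_of_nonneg (Finset.sum_nonneg fun _ _ => abs_nonneg _), Finset.sum_mul]
    refine (norm_sum_le _ _).trans (Finset.sum_le_sum fun k _ => ?_)
    rw [norm_mul, Real.norm_eq_abs]
    exact mul_le_mul_of_nonneg_left (lp.norm_apply_le_norm (by norm_num) _ _) (abs_nonneg _)
  have hii : ∀ k, Integrable (fun ω => g (Z 0 ω) k) P := fun k =>
    integrable_of_moment S.eps ((hc k).1.comp (S.meas 0)).aestronglyMeasurable (hc k).2.1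
  have h0 : ∫ ω, h (Z 0 ω) ∂P = 0 := by
    simp only [hh]
    rw [integral_finsetSum _ fun k _ => (hii k).const_mul _]
    refine Finset.sum_eq_zero fun k _ => ?_
    rw [integral_const_mul, (hc k).2.2, mul_zero]
  have hintg : ∀ n k l, Integrable (fun ω => (∑ t ∈ Finset.range n, g (Z t ω) k) *
      (∑ t ∈ Finset.range n, g (Z t ω) l)) P := fun n k l => by
    simp_rw [Finset.sum_mul_sum]
    refine integrable_finsetSum _ fun t _ => integrable_finsetSum _ fun u _ => ?_
    have := S.integrable_inner (hsm k) (hsm l) (hc k).2.1 (hc l).2.1 t u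
    simpa [mul_comm] using this
  have hswap : ∀ n ω, ∑ t ∈ Finset.range n, h (Z t ω) =
      ∑ k ∈ Finset.range m, c k * ∑ t ∈ Finset.range n, g (Z t ω) k := fun n ω => by
    simp only [hh, Finset.mul_sum]
    rw [Finset.sum_comm]
  have key := S.clt hhm hi h0 (∑ k ∈ Finset.range m, ∑ l ∈ Finset.range m, c k * c l * Γ k l) (by
    have : ∀ n : ℕ, (n : ℝ)⁻¹ * ∫ ω, (∑ t ∈ Finset.range n, h (Z t ω)) ^ 2 ∂P =
      ∑ x ∈ Finset.range m, ∑ y ∈ Finset.range m, c x * c y * ((n : ℝ)⁻¹ *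
      ∑ t ∈ Finset.range n, ∑ u ∈ Finset.range n, ∫ ω, g (Z t ω) x * g (Z u ω) y ∂P) := fun n => by
      have e := fun k l => S.integral_sum_mul (hsm k) (hsm l) (hc k).2.1 (hc l).2.1 (Finset.range n)
      simp only at e
      simp_rw [hswap, pow_two, Finset.sum_mul_sum]
      simp_rw [mul_mul_mul_comm]
      rw [integral_finsetSum _ fun k _ => integrable_finsetSum _ fun l _ => (hintg n k l).const_mul _,
        Finset.mul_sum]
      refine Finset.sum_congr rfl fun k _ => ?_
      rw [integral_finsetSum _ fun l _ => (hintg n k l).const_mul _, Finset.mul_sum]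
      refine Finset.sum_congr rfl fun l _ => ?_
      rw [integral_const_mul, e]; ring
    simp_rw [this]
    exact tendsto_finsetSum _ fun k _ => tendsto_finsetSum _ fun l _ => (hΓ k l).const_mul _)
  refine key.congr fun n => ?_
  refine integral_congr_ae (Eventually.of_forall fun ω => ?_)
  simp only [hswap, lp.coeFn_smul, Pi.smul_apply, smul_eq_mul, sum_coord]
  rw [Finset.mul_sum]
  congr 1
  exact Finset.sum_congr rfl fun k _ => by ring

end MixSetup
end


/-- the first coordinates as a Euclidean vector -/
def hvec (m : ℕ) (a : ℕ → ℝ) : EuclideanSpace ℝ (Fin m) := WithLp.toLp 2 fun i => a i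

theorem hvec_norm (m : ℕ) (a : ℕ → ℝ) : ‖hvec m a‖ = √(∑ i ∈ Finset.range m, a i ^ 2) := by
  rw [EuclideanSpace.norm_eq, ← Fin.sum_univ_eq_sum_range (fun i => a i ^ 2)]
  simp [hvec]

theorem hvec_inner (m : ℕ) (a c : ℕ → ℝ) (t : EuclideanSpace ℝ (Fin m)) (hc : ∀ i : Fin m, c i = t i) :
    inner ℝ (hvec m a) t = ∑ i ∈ Finset.range m, c i * a i := by
  rw [PiLp.inner_apply, ← Fin.sum_univ_eq_sum_range (fun i => c i * a i)]
  simp [hvec, hc]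

theorem hvec_meas {Ω : Type*} [MeasurableSpace Ω] (m : ℕ) (a : Ω → ℕ → ℝ)
    (h : ∀ i, Measurable fun ω => a ω i) : Measurable fun ω => hvec m (a ω) := by
  unfold hvec
  refine (PiLp.continuous_toLp 2 (fun _ : Fin m => ℝ)).measurable.comp ?_
  exact measurable_pi_lambda _ fun i => h i

/-- Levy's theorem, packaged. -/
theorem levy_head {Ω Ω' : Type*} [MeasurableSpace Ω] [MeasurableSpace Ω'] {P : Measure Ω}
    {P' : Measure Ω'} [IsProbabilityMeasure P] [IsProbabilityMeasure P'] (m : ℕ)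
    (a : ℕ → Ω → ℕ → ℝ) (b : Ω' → ℕ → ℝ) (ha : ∀ n i, Measurable fun ω => a n ω i)
    (hb : ∀ i, Measurable fun ω => b ω i)
    (h : ∀ c : ℕ → ℝ, Tendsto (fun n => ∫ ω, ce (∑ k ∈ Finset.range m, c k * a n ω k) ∂P) atTop
      (𝓝 (∫ ω, ce (∑ k ∈ Finset.range m, c k * b ω k) ∂P')))
    (f : BoundedContinuousFunction ℝ ℝ) :
    Tendsto (fun n => ∫ ω, f (√(∑ k ∈ Finset.range m, a n ω k ^ 2)) ∂P) atTop
      (𝓝 (∫ ω, f (√(∑ k ∈ Finset.range m, b ω k ^ 2)) ∂P')) := by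
  have hma := fun n => hvec_meas m (a n) (ha n)
  have hmb := hvec_meas m b hb
  let μ : ℕ → ProbabilityMeasure (EuclideanSpace ℝ (Fin m)) := fun n =>
    ⟨P.map (fun ω => hvec m (a n ω)), Measure.isProbabilityMeasure_map (hma n).aemeasurable⟩
  let μ₀ : ProbabilityMeasure (EuclideanSpace ℝ (Fin m)) :=
    ⟨P'.map (fun ω => hvec m (b ω)), Measure.isProbabilityMeasure_map hmb.aemeasurable⟩
  have key : Tendsto μ atTop (𝓝 μ₀) := by
    rw [ProbabilityMeasure.tendsto_iff_tendsto_charFun]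
    intro t
    have e1 : ∀ n, charFun (μ n : Measure (EuclideanSpace ℝ (Fin m))) t = ∫ ω, ce (∑ k ∈ Finset.range m,
        (fun k => if h : k < m then t ⟨k, h⟩ else 0) k * a n ω k) ∂P := fun n => by
      change charFun (P.map _) t = _
      rw [charFun_apply, integral_map (hma n).aemeasurable (by fun_prop)]
      refine integral_congr_ae (Eventually.of_forall fun ω => ?_)
      beta_reduce
      rw [hvec_inner m (a n ω) (fun k => if h : k < m then t ⟨k, h⟩ else 0) t (fun i => by simp)]
      unfold ce; rw [mul_comm]
    have e2 : charFun (μ₀ : Measure (EuclideanSpace ℝ (Fin m))) t = ∫ ω, ce (∑ k ∈ Finset.range m,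
        (fun k => if h : k < m then t ⟨k, h⟩ else 0) k * b ω k) ∂P' := by
      change charFun (P'.map _) t = _
      rw [charFun_apply, integral_map hmb.aemeasurable (by fun_prop)]
      refine integral_congr_ae (Eventually.of_forall fun ω => ?_)
      beta_reduce
      rw [hvec_inner m (b ω) (fun k => if h : k < m then t ⟨k, h⟩ else 0) t (fun i => by simp)]
      unfold ce; rw [mul_comm]
    simp_rw [e1, e2]
    exact h _
  rw [ProbabilityMeasure.tendsto_iff_forall_integral_tendsto] at key
  have k2 := key (f.compContinuous ⟨fun x => ‖x‖, continuous_norm⟩)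
  have e1 : ∀ n, ∫ x, (f.compContinuous ⟨fun x => ‖x‖, continuous_norm⟩) x ∂(μ n : Measure (EuclideanSpace ℝ (Fin m))) = ∫ ω, f (√(∑ k ∈ Finset.range m, a n ω k ^ 2)) ∂P := fun n => by
    change ∫ x, _ ∂(P.map _) = _
    rw [integral_map (hma n).aemeasurable (by fun_prop)]
    refine integral_congr_ae (Eventually.of_forall fun ω => ?_)
    simp [hvec_norm]
  have e2 : ∫ x, (f.compContinuous ⟨fun x => ‖x‖, continuous_norm⟩) x ∂(μ₀ : Measure (EuclideanSpace ℝ (Fin m))) = ∫ ω, f (√(∑ k ∈ Finset.range m, b ω k ^ 2)) ∂P' := by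
    change ∫ x, _ ∂(P'.map _) = _
    rw [integral_map hmb.aemeasurable (by fun_prop)]
    refine integral_congr_ae (Eventually.of_forall fun ω => ?_)
    simp [hvec_norm]
  simpa only [e1, e2] using k2

theorem ae_summable_sq {Ω' : Type*} [MeasurableSpace Ω'] {P' : Measure Ω'} {G : ℕ → Ω' → ℝ}
    (hG : ∀ k, MemLp (G k) 2 P') (hm : ∀ k, Measurable (G k)) {B : ℝ}
    (hB : ∀ m, ∑ k ∈ Finset.range m, ∫ ω, G k ω ^ 2 ∂P' ≤ B) :
    ∀ᵐ ω ∂P', Summable fun k => G k ω ^ 2 := by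
  have hs : Summable fun k => ∫ ω, G k ω ^ 2 ∂P' :=
    summable_of_sum_range_le (fun k => integral_nonneg fun _ => sq_nonneg _) hB
  have h1 : ∫⁻ ω, ∑' k, ENNReal.ofReal (G k ω ^ 2) ∂P' ≠ ∞ := by
    rw [lintegral_tsum fun k => by have := hm k; fun_prop]
    have : ∀ k, ∫⁻ ω, ENNReal.ofReal (G k ω ^ 2) ∂P' = ENNReal.ofReal (∫ ω, G k ω ^ 2 ∂P') := fun k =>
      (ofReal_integral_eq_lintegral_ofReal (hG k).integrable_sq (Eventually.of_forall fun _ => sq_nonneg _)).symm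
    simp_rw [this]
    exact hs.tsum_ofReal_ne_top
  have h2 := ae_lt_top' (AEMeasurable.tsum fun k => by
    have := hm k; fun_prop) h1
  filter_upwards [h2] with ω hω
  have := ENNReal.summable_toReal hω.ne
  simpa [ENNReal.toReal_ofReal, sq_nonneg] using this

section
variable {Ω 𝒵 : Type*} [mΩ : MeasurableSpace Ω] [m𝒵 : MeasurableSpace 𝒵] {P : Measure Ω}
    {Z : ℕ → Ω → 𝒵} {C r ε : ℝ}
namespace MixSetup

lemma gv_norm_bound (S : MixSetup P Z C r ε) {g : 𝒵 → L2} (hg : GV P Z ε g) {K τ : ℝ}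
    (hK : ∫ ω, ‖g (Z 0 ω)‖ ^ (2 + 2 * ε) ∂P ≤ K) (hτ : ∫ ω, ‖g (Z 0 ω)‖ ^ 2 ∂P ≤ τ) (n : ℕ) :
    ∫ ω, ‖(√n)⁻¹ • ∑ t ∈ Finset.range n, g (Z t ω)‖ ^ 2 ∂P ≤ Psi (2 * |C| + 3 * K) τ := by
  have hK0 : 0 ≤ K := le_trans (integral_nonneg fun ω => by positivity) hK
  have hτ0 : 0 ≤ τ := le_trans (integral_nonneg fun ω => by positivity) hτ
  have h := S.var_bound hg.sm hg.mom hK hg.cen hτ (Finset.range n)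
  have hP : 0 ≤ Psi (2 * |C| + 3 * K) τ := Psi_nonneg (by positivity) hτ0
  simp_rw [norm_smul, mul_pow]
  rw [integral_const_mul, Real.norm_eq_abs, sq_abs, inv_pow, Real.sq_sqrt (Nat.cast_nonneg n)]
  rcases Nat.eq_zero_or_pos n with rfl | hn
  · simpa using hP
  · rw [inv_mul_le_iff₀ (by positivity)]
    simpa using h

lemma gv_int (S : MixSetup P Z C r ε) {g : 𝒵 → L2} (hg : GV P Z ε g) (n : ℕ) :
    StronglyMeasurable (fun ω => (√n)⁻¹ • ∑ t ∈ Finset.range n, g (Z t ω)) ∧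
    Integrable (fun ω => ‖(√n)⁻¹ • ∑ t ∈ Finset.range n, g (Z t ω)‖ ^ 2) P := by
  constructor
  · exact (Finset.stronglyMeasurable_fun_sum _ fun t _ => hg.sm.comp_measurable (S.meas t)).const_smul ((√n)⁻¹ : ℝ)
  · simp_rw [norm_smul, mul_pow]
    exact (S.integrable_norm_sum_sq hg.sm hg.mom _).const_mul _

lemma tail_small (S : MixSetup P Z C r ε) {g : 𝒵 → L2} (hg : GV P Z ε g) :
    ∃ e : ℕ → ℝ, Tendsto e atTop (𝓝 0) ∧ ∀ m n : ℕ,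
      ∫ ω, ‖tailv m ((√n)⁻¹ • ∑ t ∈ Finset.range n, g (Z t ω))‖ ∂P ≤ e m := by
  have := S.prob
  set K := ∫ ω, ‖g (Z 0 ω)‖ ^ (2 + 2 * ε) ∂P with hK
  have hK0 : 0 ≤ K := integral_nonneg fun ω => by positivity
  set τ : ℕ → ℝ := fun m => ∫ ω, ‖tailv m (g (Z 0 ω))‖ ^ 2 ∂P with hτ
  have hsq : Integrable (fun ω => ‖g (Z 0 ω)‖ ^ 2) P := integrable_sq_of_moment S.eps
    (hg.sm.comp_measurable (S.meas 0)).aestronglyMeasurable hg.mom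
  have hτ0 : Tendsto τ atTop (𝓝 0) := by
    have := tendsto_integral_of_dominated_convergence (μ := P) (F := fun m ω => ‖tailv m (g (Z 0 ω))‖ ^ 2)
      (f := fun _ => (0 : ℝ)) (fun ω => ‖g (Z 0 ω)‖ ^ 2)
      (fun m => (((S.gv_tail hg m).sm.comp_measurable (S.meas 0)).norm.pow 2).aestronglyMeasurable) hsq
      (fun m => Eventually.of_forall fun ω => by
        rw [Real.norm_of_nonneg (by positivity)]
        exact pow_le_pow_left₀ (norm_nonneg _) (tailv_le _ _) 2)
      (Eventually.of_forall fun ω => by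
        have := (tailv_tendsto (g (Z 0 ω))).pow 2
        simpa using this)
    simpa using this
  refine ⟨fun m => √(Psi (2 * |C| + 3 * K) (τ m)), ?_, fun m n => ?_⟩
  · have h1 : Tendsto τ atTop (𝓝[≥] 0) := tendsto_nhdsWithin_iff.2
      ⟨hτ0, Eventually.of_forall fun m => Set.mem_Ici.2 (integral_nonneg fun ω => sq_nonneg _)⟩
    have h2 := ((Psi_tendsto (c := 2 * |C| + 3 * K) (by positivity)).comp h1)
    have h3 := (Real.continuous_sqrt.tendsto 0).comp h2
    rw [Real.sqrt_zero] at h3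
    exact h3
  · have hgt := S.gv_tail hg m
    have hb := S.gv_norm_bound hgt (K := K) (τ := τ m) (by
      refine integral_mono hgt.mom hg.mom fun ω => ?_
      have := S.eps
      exact Real.rpow_le_rpow (norm_nonneg _) (tailv_le _ _) (by positivity)) le_rfl n
    have hi := S.gv_int hgt n
    simp_rw [tailv_smul, tailv_sum]
    have h := integral_abs_le_sqrt (P := P) hi.1.norm.aestronglyMeasurable hi.2
    simp_rw [abs_norm] at h
    exact h.trans (Real.sqrt_le_sqrt hb)

lemma Gam_sum (S : MixSetup P Z C r ε) {g : 𝒵 → L2} (hg : GV P Z ε g) {Γ : ℕ → ℕ → ℝ}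
    (hΓ : ∀ k l, Tendsto (fun n : ℕ => (n : ℝ)⁻¹ *
      ∑ t ∈ Finset.range n, ∑ u ∈ Finset.range n, ∫ ω, g (Z t ω) k * g (Z u ω) l ∂P) atTop
        (𝓝 (Γ k l))) : ∃ B, ∀ m, ∑ k ∈ Finset.range m, Γ k k ≤ B := by
  have hc := S.gv_coord hg
  have hsm := fun k => (hc k).1.stronglyMeasurable
  refine ⟨Psi (2 * |C| + 3 * ∫ ω, ‖g (Z 0 ω)‖ ^ (2 + 2 * ε) ∂P) (∫ ω, ‖g (Z 0 ω)‖ ^ 2 ∂P), fun m => ?_⟩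
  refine le_of_tendsto' (tendsto_finsetSum (Finset.range m) fun k _ => hΓ k k) fun n => ?_
  have hb := S.gv_norm_bound hg le_rfl le_rfl n
  refine le_trans ?_ hb
  have e := fun k l => S.integral_sum_mul (hsm k) (hsm l) (hc k).2.1 (hc l).2.1 (Finset.range n)
  simp only at e
  have hintg : ∀ k, Integrable (fun ω => (∑ t ∈ Finset.range n, g (Z t ω) k) *
      (∑ t ∈ Finset.range n, g (Z t ω) k)) P := fun k => by
    simp_rw [Finset.sum_mul_sum]
    refine integrable_finsetSum _ fun t _ => integrable_finsetSum _ fun u _ => ?_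
    have := S.integrable_inner (hsm k) (hsm k) (hc k).2.1 (hc k).2.1 t u
    simpa [mul_comm] using this
  simp_rw [← e, ← integral_const_mul]
  rw [← integral_finsetSum _ fun k _ => (hintg k).const_mul _]
  refine integral_mono (integrable_finsetSum _ fun k _ => (hintg k).const_mul _) (S.gv_int hg n).2
    fun ω => ?_
  have h := tailv_norm m ((√n)⁻¹ • ∑ t ∈ Finset.range n, g (Z t ω))
  simp only at h ⊢
  rw [h]
  have : ∀ k, (n : ℝ)⁻¹ * ((∑ t ∈ Finset.range n, g (Z t ω) k) * (∑ t ∈ Finset.range n, g (Z t ω) k)) =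
      (((√n)⁻¹ • ∑ t ∈ Finset.range n, g (Z t ω) : L2) k) ^ 2 := fun k => by
    simp only [lp.coeFn_smul, Pi.smul_apply, smul_eq_mul, sum_coord]
    rw [mul_pow, inv_pow, Real.sq_sqrt (Nat.cast_nonneg n)]
    ring
  simp_rw [this]
  have := sq_nonneg ‖tailv m ((√n)⁻¹ • ∑ t ∈ Finset.range n, g (Z t ω))‖
  linarith

end MixSetup
end


theorem bcf_int {Ω : Type*} [MeasurableSpace Ω] {P : Measure Ω} [IsProbabilityMeasure P]
    (f : BoundedContinuousFunction ℝ ℝ) {a : Ω → ℝ} (ha : AEMeasurable a P) :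
    Integrable (fun ω => f (a ω)) P :=
  Integrable.of_bound (f.continuous.measurable.comp_aemeasurable ha).aestronglyMeasurable ‖f‖
    (Eventually.of_forall fun ω => f.norm_coe_le_norm _)

theorem lip_int_close {Ω : Type*} [MeasurableSpace Ω] {P : Measure Ω} [IsProbabilityMeasure P]
    (f : BoundedContinuousFunction ℝ ℝ) {L : ℝ≥0} (hL : LipschitzWith L f) {a b : Ω → ℝ}
    {d : Ω → ℝ} (ha : AEMeasurable a P) (hb : AEMeasurable b P) (hd : Integrable d P)
    (h : ∀ ω, |a ω - b ω| ≤ d ω) :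
    ‖∫ ω, f (a ω) ∂P - ∫ ω, f (b ω) ∂P‖ ≤ L * ∫ ω, d ω ∂P := by
  rw [← integral_sub (bcf_int f ha) (bcf_int f hb), ← integral_const_mul]
  refine norm_integral_le_of_norm_le (hd.const_mul _) (Eventually.of_forall fun ω => ?_)
  have := hL.dist_le_mul (a ω) (b ω)
  rw [Real.dist_eq, Real.dist_eq] at this
  exact this.trans (mul_le_mul_of_nonneg_left (h ω) L.2)

section
variable {Ω 𝒵 : Type*} [mΩ : MeasurableSpace Ω] [m𝒵 : MeasurableSpace 𝒵] {P : Measure Ω}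
    {Z : ℕ → Ω → 𝒵} {C r ε : ℝ}
namespace MixSetup

theorem main_conv (S : MixSetup P Z C r ε) {g : 𝒵 → L2} (hg : GV P Z ε g) {Γ : ℕ → ℕ → ℝ}
    (hΓ : ∀ k l, Tendsto (fun n : ℕ => (n : ℝ)⁻¹ *
      ∑ t ∈ Finset.range n, ∑ u ∈ Finset.range n, ∫ ω, g (Z t ω) k * g (Z u ω) l ∂P) atTop
        (𝓝 (Γ k l))) {Ω' : Type} [MeasurableSpace Ω'] {P' : Measure Ω'} [IsProbabilityMeasure P']
    {G : ℕ → Ω' → ℝ} (GS : GSeq P' G Γ)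
    (V : ℕ → Ω → ℝ) (hVm : ∀ n, Measurable (V n)) (d : ℕ → Ω → ℝ) (hdi : ∀ n, Integrable (d n) P)
    (hVd : ∀ n ω, |V n ω - ‖(√n)⁻¹ • ∑ t ∈ Finset.range n, g (Z t ω)‖| ≤ d n ω)
    (hd0 : Tendsto (fun n => ∫ ω, d n ω ∂P) atTop (𝓝 0))
    (F : BoundedContinuousFunction ℝ ℝ) :
    Tendsto (fun n => ∫ ω, F (V n ω) ∂P) atTop (𝓝 (∫ ω, F (√(∑' k, G k ω ^ 2)) ∂P')) := by
  have := S.prob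
  obtain ⟨B, hB⟩ := S.Gam_sum hg hΓ
  obtain ⟨e, he, hetail⟩ := S.tail_small hg
  have hmom := fun k => GSeq.gauss_mom (GS.meas k) (GS.lin k).1
  have hsum : ∀ᵐ ω ∂P', Summable fun k => G k ω ^ 2 := by
    refine ae_summable_sq (fun k => (hmom k).1) GS.meas (B := B) fun m => ?_
    refine le_of_eq_of_le (Finset.sum_congr rfl fun k _ => ?_) (hB m)
    rw [(hmom k).2.2, Real.coe_toNNReal _ (GS.lin k).2]
  have hhead : ∀ m, Measurable fun ω => √(∑ k ∈ Finset.range m, G k ω ^ 2) := fun m => by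
    have := GS.meas
    fun_prop
  have hconv : ∀ᵐ ω ∂P', Tendsto (fun m => √(∑ k ∈ Finset.range m, G k ω ^ 2)) atTop
      (𝓝 (√(∑' k, G k ω ^ 2))) := by
    filter_upwards [hsum] with ω hω
    exact (Real.continuous_sqrt.tendsto _).comp hω.hasSum.tendsto_sum_nat
  have hVV : AEMeasurable (fun ω => √(∑' k, G k ω ^ 2)) P' :=
    aemeasurable_of_tendsto_metrizable_ae atTop (fun m => (hhead m).aemeasurable) hconv
  have hSn := fun n => S.gv_int hg n
  -- Lipschitz functions
  have lip : ∀ f : BoundedContinuousFunction ℝ ℝ, (∃ L, LipschitzWith L f) →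
      Tendsto (fun n => ∫ ω, f (V n ω) ∂P) atTop (𝓝 (∫ ω, f (√(∑' k, G k ω ^ 2)) ∂P')) := by
    rintro f ⟨L, hL⟩
    have hlim : Tendsto (fun m => ∫ ω, f (√(∑ k ∈ Finset.range m, G k ω ^ 2)) ∂P') atTop
        (𝓝 (∫ ω, f (√(∑' k, G k ω ^ 2)) ∂P')) := by
      refine tendsto_integral_of_dominated_convergence (fun _ => ‖f‖)
        (fun m => (f.continuous.measurable.comp (hhead m)).aestronglyMeasurable)
        (integrable_const _) (fun m => Eventually.of_forall fun ω => f.norm_coe_le_norm _) ?_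
      filter_upwards [hconv] with ω hω
      exact (f.continuous.tendsto _).comp hω
    have cm : ∀ (n : ℕ) i, Measurable fun ω => ((√n)⁻¹ • ∑ t ∈ Finset.range n, g (Z t ω) : L2) i :=
      fun n i => coord_meas (hSn n).1 i
    have hA : ∀ m, Tendsto (fun n : ℕ => ∫ ω, f (√(∑ k ∈ Finset.range m,
        (((√n)⁻¹ • ∑ t ∈ Finset.range n, g (Z t ω) : L2) k) ^ 2)) ∂P) atTop
        (𝓝 (∫ ω, f (√(∑ k ∈ Finset.range m, G k ω ^ 2)) ∂P')) := fun m => by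
      refine levy_head m (fun n ω k => ((√n)⁻¹ • ∑ t ∈ Finset.range n, g (Z t ω) : L2) k)
        (fun ω k => G k ω) cm GS.meas (fun c => ?_) f
      rw [GS.char m c]
      exact S.fdd_char hg hΓ m c
    have h1 : Tendsto (fun n : ℕ => ∫ ω, f ‖(√n)⁻¹ • ∑ t ∈ Finset.range n, g (Z t ω)‖ ∂P) atTop
        (𝓝 (∫ ω, f (√(∑' k, G k ω ^ 2)) ∂P')) := by
      refine tendsto_of_approx (e := fun m => L * e m) hA (fun m n => ?_) (by simpa using he.const_mul (L : ℝ)) hlim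
      have hti : Integrable (fun ω => ‖tailv m ((√n)⁻¹ • ∑ t ∈ Finset.range n, g (Z t ω))‖) P := by
        have hh := S.gv_int (S.gv_tail hg m) n
        simp_rw [tailv_smul, tailv_sum]
        exact ((memLp_two_iff_integrable_sq hh.1.norm.aestronglyMeasurable).2 hh.2).integrable (by norm_num)
      refine (lip_int_close f hL (hSn n).1.norm.measurable.aemeasurable ?_ hti
        (fun ω => head_close m _)).trans (mul_le_mul_of_nonneg_left (hetail m n) L.2)
      have := cm n
      exact (by fun_prop : Measurable fun ω => √(∑ k ∈ Finset.range m,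
        (((√n)⁻¹ • ∑ t ∈ Finset.range n, g (Z t ω) : L2) k) ^ 2)).aemeasurable
    have h2 : Tendsto (fun n : ℕ => ∫ ω, f (V n ω) ∂P -
        ∫ ω, f ‖(√n)⁻¹ • ∑ t ∈ Finset.range n, g (Z t ω)‖ ∂P) atTop (𝓝 0) := by
      refine squeeze_zero_norm (a := fun n => L * ∫ ω, d n ω ∂P) (fun n => ?_) (by simpa using hd0.const_mul (L : ℝ))
      exact lip_int_close f hL (hVm n).aemeasurable (hSn n).1.norm.measurable.aemeasurable (hdi n) (hVd n)
    simpa using h2.add h1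
  let μ : ℕ → ProbabilityMeasure ℝ := fun n =>
    ⟨P.map (V n), Measure.isProbabilityMeasure_map (hVm n).aemeasurable⟩
  let μ₀ : ProbabilityMeasure ℝ :=
    ⟨P'.map (fun ω => √(∑' k, G k ω ^ 2)), Measure.isProbabilityMeasure_map hVV⟩
  have e1 : ∀ (f : BoundedContinuousFunction ℝ ℝ) n, ∫ x, f x ∂(μ n : Measure ℝ) = ∫ ω, f (V n ω) ∂P := fun f n => by
    change ∫ x, _ ∂(P.map _) = _
    rw [integral_map (hVm n).aemeasurable (by fun_prop)]
  have e2 : ∀ (f : BoundedContinuousFunction ℝ ℝ), ∫ x, f x ∂(μ₀ : Measure ℝ) = ∫ ω, f (√(∑' k, G k ω ^ 2)) ∂P' := fun f => by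
    change ∫ x, _ ∂(P'.map _) = _
    rw [integral_map hVV (by fun_prop)]
  have key : Tendsto μ atTop (𝓝 μ₀) := by
    rw [tendsto_iff_forall_lipschitz_integral_tendsto]
    intro f hfb hfl
    let f' : BoundedContinuousFunction ℝ ℝ :=
      { toFun := f
        continuous_toFun := hfl.choose_spec.continuous
        map_bounded' := hfb }
    have h := lip f' hfl
    rw [← e2 f'] at h
    simp_rw [← e1 f'] at h
    exact h
  rw [ProbabilityMeasure.tendsto_iff_forall_integral_tendsto] at key
  have h := key F
  rw [e2 F] at h
  simp_rw [e1 F] at h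
  exact h

end MixSetup
end


theorem tens_strong {Ω : Type*} [MeasurableSpace Ω] {a b : Ω → L2} (ha : StronglyMeasurable a)
    (hb : StronglyMeasurable b) : StronglyMeasurable fun ω => tens (a ω) (b ω) :=
  l2_strong _ fun k => by
    simp only [tens_apply]
    exact (coord_meas ha _).mul (coord_meas hb _)

theorem dcov_conv {X Y Ω : Type*} [MeasurableSpace X] [MeasurableSingletonClass X]
    [MeasurableSpace Y] [MeasurableSingletonClass Y] [MeasurableSpace Ω] {P : Measure Ω}
    {Z : ℕ → Ω → X × Y} {C r ε : ℝ} (S : MixSetup P Z C r ε)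
    (a : X → L2) (ρ : X → X → ℝ)
    (hρ : ∀ x y, 2 * ρ x y = ‖a x - a y‖ ^ 2) (b : Y → L2) (ρ' : Y → Y → ℝ)
    (hρ' : ∀ x y, 2 * ρ' x y = ‖b x - b y‖ ^ 2)
    (ga : GV P Z ε fun z => a z.1) (gb : GV P Z ε fun z => b z.2)
    (hg : GV P Z ε fun z => tens (a z.1) (b z.2)) {Γ : ℕ → ℕ → ℝ}
    (hΓ : ∀ k l, Tendsto (fun n : ℕ => (n : ℝ)⁻¹ *
      ∑ t ∈ Finset.range n, ∑ u ∈ Finset.range n,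
        ∫ ω, tens (a (Z t ω).1) (b (Z t ω).2) k * tens (a (Z u ω).1) (b (Z u ω).2) l ∂P) atTop
        (𝓝 (Γ k l))) {Ω' : Type} [MeasurableSpace Ω'] {P' : Measure Ω'} [IsProbabilityMeasure P']
    {G : ℕ → Ω' → ℝ} (GS : GSeq P' G Γ) (f : BoundedContinuousFunction ℝ ℝ) :
    Tendsto (fun n : ℕ => ∫ ω, f ((n : ℝ) * dcov ρ ρ' (emp Z n ω)) ∂P) atTop
      (𝓝 (∫ ω, f (∑' k, G k ω ^ 2) ∂P')) := by
  have := S.prob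
  let Sn : ℕ → Ω → L2 := fun n ω => (√n)⁻¹ • ∑ t ∈ Finset.range n, tens (a (Z t ω).1) (b (Z t ω).2)
  let An : ℕ → Ω → L2 := fun n ω => (√n)⁻¹ • ∑ t ∈ Finset.range n, a (Z t ω).1
  let Bn : ℕ → Ω → L2 := fun n ω => (√n)⁻¹ • ∑ t ∈ Finset.range n, b (Z t ω).2
  have hA := fun n => S.gv_int ga n
  have hB := fun n => S.gv_int gb n
  let V : ℕ → Ω → ℝ := fun n ω => ‖Sn n ω - (√n)⁻¹ • tens (An n ω) (Bn n ω)‖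
  have hV : ∀ n, Measurable (V n) := fun n =>
    ((S.gv_int hg n).1.sub ((tens_strong (hA n).1 (hB n).1).const_smul ((√n)⁻¹ : ℝ))).norm.measurable
  let d : ℕ → Ω → ℝ := fun n ω => (√n)⁻¹ * (‖An n ω‖ ^ 2 + ‖Bn n ω‖ ^ 2)
  have hdi : ∀ n, Integrable (d n) P := fun n => ((hA n).2.add (hB n).2).const_mul _
  have hVd : ∀ n ω, |V n ω - ‖Sn n ω‖| ≤ d n ω := fun n ω => by
    refine (abs_norm_sub_norm_le _ _).trans ?_
    rw [sub_sub_cancel_left, norm_neg, norm_smul, tens_norm, Real.norm_of_nonneg (by positivity)]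
    refine mul_le_mul_of_nonneg_left ?_ (by positivity)
    nlinarith [sq_nonneg (‖An n ω‖ - ‖Bn n ω‖), norm_nonneg (An n ω), norm_nonneg (Bn n ω)]
  have hd0 : Tendsto (fun n => ∫ ω, d n ω ∂P) atTop (𝓝 0) := by
    obtain ⟨K₁, hK₁⟩ : ∃ K, ∀ n, ∫ ω, ‖An n ω‖ ^ 2 ∂P ≤ K :=
      ⟨_, fun n => S.gv_norm_bound ga le_rfl le_rfl n⟩
    obtain ⟨K₂, hK₂⟩ : ∃ K, ∀ n, ∫ ω, ‖Bn n ω‖ ^ 2 ∂P ≤ K :=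
      ⟨_, fun n => S.gv_norm_bound gb le_rfl le_rfl n⟩
    refine squeeze_zero (g := fun n : ℕ => (√(n : ℝ))⁻¹ * (K₁ + K₂))
      (fun n => integral_nonneg fun ω => by positivity) (fun n => ?_) ?_
    · change ∫ ω, (√n)⁻¹ * (‖An n ω‖ ^ 2 + ‖Bn n ω‖ ^ 2) ∂P ≤ _
      rw [integral_const_mul, integral_add (hA n).2 (hB n).2]
      exact mul_le_mul_of_nonneg_left (add_le_add (hK₁ n) (hK₂ n)) (by positivity)
    · have : Tendsto (fun n : ℕ => (√(n : ℝ))⁻¹) atTop (𝓝 0) :=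
        tendsto_inv_atTop_zero.comp (Real.tendsto_sqrt_atTop.comp tendsto_natCast_atTop_atTop)
      simpa using this.mul_const (K₁ + K₂)
  have key := S.main_conv hg hΓ GS V hV d hdi hVd hd0
    (f.compContinuous ⟨fun x => x ^ 2, by fun_prop⟩)
  simp only [BoundedContinuousFunction.compContinuous_apply, ContinuousMap.coe_mk] at key
  have e : ∀ ω, √(∑' k, G k ω ^ 2) ^ 2 = ∑' k, G k ω ^ 2 := fun ω =>
    Real.sq_sqrt (tsum_nonneg fun k => sq_nonneg _)
  simp only [e] at key
  refine key.congr' ?_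
  filter_upwards [eventually_gt_atTop 0] with n hn
  refine integral_congr_ae (Eventually.of_forall fun ω => ?_)
  change f (V n ω ^ 2) = f (n * dcov ρ ρ' (unif (fun k => Z k ω) n))
  rw [n_dcov a ρ hρ b ρ' hρ' _ n hn]

theorem gv_of_law {Ω 𝒵 : Type*} [MeasurableSpace Ω] [MeasurableSpace 𝒵] {P : Measure Ω}
    {Z : ℕ → Ω → 𝒵} {ε : ℝ} (hZ : Measurable (Z 0)) {g : 𝒵 → L2} (hg : StronglyMeasurable g)
    (hm : Integrable (fun z => ‖g z‖ ^ (2 + 2 * ε)) (P.map (Z 0)))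
    (hc : ∫ z, g z ∂(P.map (Z 0)) = 0) : GV P Z ε g :=
  ⟨hg, hm.comp_measurable hZ, by rwa [integral_map hZ.aemeasurable hg.aestronglyMeasurable] at hc⟩



/-- Asymptotic distribution of `n · dcov_β(θₙ)`, `β ∈ (0,1]`, for independent `X, Y` in separable metric spaces of negative type with `𝒳 × 𝒴` σ-compact, finite `(1+ε)β`-moments and absolute regularity `β(n) = O(n^{-r})`, `r > 6(1+2/ε)`. -/
theorem dcovBeta_asymptotic_distribution_beta_le_one
    (β : ℝ) (hβ : β ∈ Set.Ioc (0 : ℝ) 1)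
    {X Y : Type*}
    [MetricSpace X] [TopologicalSpace.SeparableSpace X] [MeasurableSpace X] [BorelSpace X]
    [MetricSpace Y] [TopologicalSpace.SeparableSpace Y] [MeasurableSpace Y] [BorelSpace Y]
    [SigmaCompactSpace (X × Y)]
    -- 𝒳 and 𝒴 are of negative type
    {H₁ H₂ : Type*} [NormedAddCommGroup H₁] [InnerProductSpace ℝ H₁]
    [NormedAddCommGroup H₂] [InnerProductSpace ℝ H₂]
    (φemb : X → H₁) (hφ : ∀ x x' : X, dist x x' = ‖φemb x - φemb x'‖ ^ 2)
    (ψemb : Y → H₂) (hψ : ∀ y y' : Y, dist y y' = ‖ψemb y - ψemb y'‖ ^ 2)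
    {Ω : Type*} [MeasurableSpace Ω] (P : Measure Ω) [IsProbabilityMeasure P]
    (Z : ℕ → Ω → X × Y) (hZmeas : ∀ i, Measurable (Z i))
    -- strict stationarity
    (hstat : MeasurePreserving shift (P.map fun ω i => Z i ω) (P.map fun ω i => Z i ω))
    (θ : Measure (X × Y)) (hθ : θ = P.map (Z 0))
    -- independence of X and Y
    (hindep : θ = (θ.map Prod.fst).prod (θ.map Prod.snd))
    -- finite (1+ε)β-moments
    (ε : ℝ) (hε : 0 < ε) (x₀ : X) (y₀ : Y)
    (hmomX : Integrable (fun x => dist x x₀ ^ ((1 + ε) * β)) (θ.map Prod.fst))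
    (hmomY : Integrable (fun y => dist y y₀ ^ ((1 + ε) * β)) (θ.map Prod.snd))
    -- absolute regularity with β(n) = O(n^{-r}), r > 6(1 + 2/ε)
    (habsreg : Tendsto (betaProc P Z) atTop (𝓝 0))
    (r : ℝ) (hr : 6 * (1 + 2 / ε) < r)
    (C : ℝ) (hmix : ∀ n : ℕ, 1 ≤ n → betaProc P Z n ≤ C * (n : ℝ) ^ (-r)) :
    ∃ (lam : ℕ → ℝ) (φ : ℕ → X × Y → ℝ),
      (∀ k, 0 ≤ lam k) ∧
      (∀ k, Measurable (φ k)) ∧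
      -- eigenpairs of the integral operator f ↦ ∫ δ_θ^{(β)}(·,z) f(z) dθ(z)
      (∀ k, ∀ᵐ z ∂θ, ∫ z', deltaTheta (fun a b : X => dist a b ^ β)
          (fun a b : Y => dist a b ^ β) θ z z' * φ k z' ∂θ = lam k * φ k z) ∧
      (∀ k, lam k ≠ 0 → ∫ z, φ k z ^ 2 ∂θ = 1) ∧
      ∃ (Ω' : Type) (mΩ' : MeasurableSpace Ω') (P' : Measure Ω')
        (_ : IsProbabilityMeasure P') (ζ : ℕ → Ω' → ℝ),
        (∀ k, Measurable (ζ k)) ∧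
        -- the ζ_k are centered Gaussian
        (∀ k, ∃ v : ℝ≥0, P'.map (ζ k) = gaussianReal 0 v) ∧
        -- covariance structure determined by the dependence structure of (Z_k)
        (∀ i j, Tendsto
          (fun n : ℕ => (n : ℝ)⁻¹ * ∑ t ∈ Finset.range n, ∑ u ∈ Finset.range n,
            (∫ ω, φ i (Z t ω) * φ j (Z u ω) ∂P
              - (∫ ω, φ i (Z t ω) ∂P) * (∫ ω, φ j (Z u ω) ∂P)))
          atTop
          (𝓝 (∫ ω', ζ i ω' * ζ j ω' ∂P'
              - (∫ ω', ζ i ω' ∂P') * (∫ ω', ζ j ω' ∂P')))) ∧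
        -- convergence in distribution of n · dcov_β(θₙ) to ∑ λ_k ζ_k²
        (∀ f : BoundedContinuousFunction ℝ ℝ,
          Tendsto (fun n : ℕ => ∫ ω,
              f ((n : ℝ) * dcov (fun a b : X => dist a b ^ β)
                (fun a b : Y => dist a b ^ β) (emp Z n ω)) ∂P)
            atTop (𝓝 (∫ ω', f (∑' k, lam k * ζ k ω' ^ 2) ∂P'))) := by
  have S : MixSetup P Z C r ε := ⟨inferInstance, hZmeas, hstat, hε, hr, hmix⟩
  have hθp : IsProbabilityMeasure θ := by
    rw [hθ]; exact Measure.isProbabilityMeasure_map (hZmeas 0).aemeasurable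
  set μ := θ.map Prod.fst with hμ
  set ν := θ.map Prod.snd with hν
  have hμp : IsProbabilityMeasure μ := Measure.isProbabilityMeasure_map measurable_fst.aemeasurable
  have hνp : IsProbabilityMeasure ν := Measure.isProbabilityMeasure_map measurable_snd.aemeasurable
  obtain ⟨u, κ, M⟩ := merc_negtype hβ φemb hφ μ hε x₀ hmomX
  obtain ⟨v, κ', M'⟩ := merc_negtype hβ ψemb hψ ν hε y₀ hmomY
  obtain ⟨a, hau, hasm, hρ, ham, ha0⟩ := M.vec hε
  obtain ⟨b, hbv, hbsm, hρ', hbm, hb0⟩ := M'.vec hε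
  have hp : 0 < 2 + 2 * ε := by positivity
  -- the three fields
  have ga : GV P Z ε (fun z : X × Y => a z.1) := by
    refine gv_of_law (hZmeas 0) (hasm.comp_measurable measurable_fst) ?_ ?_
    · rw [← hθ]
      exact ham.comp_measurable measurable_fst
    · rw [← hθ]
      have := integral_map (μ := θ) measurable_fst.aemeasurable hasm.aestronglyMeasurable
      rw [← this, ← hμ, ha0]
  have gb : GV P Z ε (fun z : X × Y => b z.2) := by
    refine gv_of_law (hZmeas 0) (hbsm.comp_measurable measurable_snd) ?_ ?_
    · rw [← hθ]
      exact hbm.comp_measurable measurable_snd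
    · rw [← hθ]
      have := integral_map (μ := θ) measurable_snd.aemeasurable hbsm.aestronglyMeasurable
      rw [← this, ← hν, hb0]
  have gsm : StronglyMeasurable (fun z : X × Y => tens (a z.1) (b z.2)) :=
    tens_strong (hasm.comp_measurable measurable_fst) (hbsm.comp_measurable measurable_snd)
  have gmom : Integrable (fun z : X × Y => ‖tens (a z.1) (b z.2)‖ ^ (2 + 2 * ε)) θ := by
    rw [hindep]
    refine (ham.mul_prod hbm).congr (Eventually.of_forall fun z => ?_)
    simp only [tens_norm]
    rw [Real.mul_rpow (norm_nonneg _) (norm_nonneg _)]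
  have W : ∀ (z : X × Y) k, tens (a z.1) (b z.2) k = u k.unpair.1 z.1 * v k.unpair.2 z.2 :=
    fun z k => by rw [tens_apply, hau, hbv]
  have hg : GV P Z ε (fun z : X × Y => tens (a z.1) (b z.2)) := by
    refine gv_of_law (hZmeas 0) gsm (hθ ▸ gmom) ?_
    rw [← hθ]
    refine l2_integral_zero (integrable_of_moment hε gsm.aestronglyMeasurable gmom) fun k => ?_
    simp_rw [W]
    rw [hindep, integral_prod_mul (u k.unpair.1) (v k.unpair.2), M.zero, zero_mul]
  obtain ⟨Γ, hpsd, hΓ⟩ := S.exists_Gam hg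
  obtain ⟨Ω', mΩ', P', hP', G, GS⟩ := gauss_seq hpsd
  let lam : ℕ → ℝ := fun k => κ k.unpair.1 * κ' k.unpair.2
  have hκ : ∀ i, 0 ≤ κ i := fun i => by rw [← M.sq]; exact integral_nonneg fun x => sq_nonneg _
  have hκ' : ∀ i, 0 ≤ κ' i := fun i => by rw [← M'.sq]; exact integral_nonneg fun x => sq_nonneg _
  have hlam : ∀ k, 0 ≤ lam k := fun k => mul_nonneg (hκ _) (hκ' _)
  let w : ℕ → X × Y → ℝ := fun k z => tens (a z.1) (b z.2) k
  have hwm : ∀ k, Measurable (w k) := fun k => (S.gv_coord hg k).1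
  have hw2 : ∀ k, ∫ z, w k z ^ 2 ∂θ = lam k := fun k => by
    simp only [w, W, mul_pow]
    rw [hindep, integral_prod_mul (fun x => u k.unpair.1 x ^ 2) (fun y => v k.unpair.2 y ^ 2), M.sq, M'.sq]
  have hweig : ∀ k z, ∫ z', deltaTheta (fun a b : X => dist a b ^ β)
      (fun a b : Y => dist a b ^ β) θ z z' * w k z' ∂θ = lam k * w k z := fun k z => by
    simp only [w, W, deltaTheta, ← hμ, ← hν]
    have : ∀ z' : X × Y, dM (fun a b : X => dist a b ^ β) μ z.1 z'.1 *
        dM (fun a b : Y => dist a b ^ β) ν z.2 z'.2 * (u k.unpair.1 z'.1 * v k.unpair.2 z'.2) =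
        (dM (fun a b : X => dist a b ^ β) μ z.1 z'.1 * u k.unpair.1 z'.1) *
        (dM (fun a b : Y => dist a b ^ β) ν z.2 z'.2 * v k.unpair.2 z'.2) := fun z' => by ring
    simp_rw [this]
    have h2 := integral_prod_mul (μ := μ) (ν := ν)
      (fun x => dM (fun a b : X => dist a b ^ β) μ z.1 x * u k.unpair.1 x)
      (fun y => dM (fun a b : Y => dist a b ^ β) ν z.2 y * v k.unpair.2 y)
    rw [← hindep] at h2
    rw [h2, M.eig, M'.eig]
    simp only [lam]; ring
  let s : ℕ → ℝ := fun k => (√(lam k))⁻¹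
  -- coordinates
  have hw0 : ∀ k t, ∫ ω, w k (Z t ω) ∂P = 0 := fun k t => by
    have h := (S.gv_coord hg k).2.2
    have e1 := integral_map (μ := P) (hZmeas t).aemeasurable (hwm k).aestronglyMeasurable
    have e2 := integral_map (μ := P) (hZmeas 0).aemeasurable (hwm k).aestronglyMeasurable
    rw [← e1, S.map_one t, e2]; exact h
  have hG0 : ∀ k, ∫ ω, G k ω ∂P' = 0 := fun k => (GSeq.gauss_mom (GS.meas k) (GS.lin k).1).2.1
  have hcov := GS.cov hpsd.1
  have hGz : ∀ k, lam k = 0 → ∀ᵐ ω ∂P', G k ω = 0 := fun k hk => by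
    have hwi : Integrable (fun z => w k z ^ 2) θ := by
      have h := (S.gv_coord hg k)
      have h2 : Integrable (fun z => ‖w k z‖ ^ (2 + 2 * ε)) θ := by
        rw [hθ]
        exact (integrable_map_measure ((hwm k).norm.pow_const _).aestronglyMeasurable
          (hZmeas 0).aemeasurable).2 h.2.1
      simpa using integrable_sq_of_moment hε (hwm k).aestronglyMeasurable h2
    have hz : ∀ᵐ z ∂θ, w k z = 0 := by
      have := (integral_eq_zero_iff_of_nonneg (fun z => sq_nonneg (w k z)) hwi).1 ((hw2 k).trans hk)
      filter_upwards [this] with z hz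
      simpa using hz
    have hzt : ∀ t, ∀ᵐ ω ∂P, w k (Z t ω) = 0 := fun t => by
      rw [hθ, ← S.map_one t] at hz
      exact ae_of_ae_map (hZmeas t).aemeasurable hz
    have hΓ0 : Γ k k = 0 := by
      refine tendsto_nhds_unique (hΓ k k) ?_
      have : ∀ t q, ∫ ω, w k (Z t ω) * w k (Z q ω) ∂P = 0 := fun t q => by
        refine integral_eq_zero_of_ae ?_
        filter_upwards [hzt t] with ω hω
        simp [hω]
      simp only [w] at this
      simp [this]
    have hm := GSeq.gauss_mom (GS.meas k) (GS.lin k).1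
    have h2 : ∫ ω, G k ω ^ 2 ∂P' = 0 := by rw [hm.2.2, hΓ0]; simp
    have := (integral_eq_zero_iff_of_nonneg (fun z => sq_nonneg (G k z)) hm.1.integrable_sq).1 h2
    filter_upwards [this] with z hz
    simpa using hz
  refine ⟨lam, fun k z => s k * w k z, hlam, fun k => (hwm k).const_mul _, fun k => ?_, fun k hk => ?_,
    Ω', mΩ', P', hP', fun k ω => s k * G k ω, fun k => (GS.meas k).const_mul _, fun k => ?_,
    fun i j => ?_, fun f => ?_⟩
  · refine Eventually.of_forall fun z => ?_
    simp only [mul_left_comm _ (s k)]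
    rw [integral_const_mul, hweig]
  · simp only [mul_pow]
    rw [integral_const_mul, hw2]
    simp only [s]
    rw [inv_pow, Real.sq_sqrt (hlam k), inv_mul_cancel₀ hk]
  · have h1 := gaussianReal_map_const_mul (μ := 0) (v := (Γ k k).toNNReal) (s k)
    rw [← (GS.lin k).1, Measure.map_map (by fun_prop) (GS.meas k), mul_zero] at h1
    exact ⟨_, h1⟩
  · simp only [integral_const_mul, hw0, hG0, mul_zero, sub_zero]
    have e1 : ∀ t q, ∫ ω, s i * w i (Z t ω) * (s j * w j (Z q ω)) ∂P =
        (s i * s j) * ∫ ω, w i (Z t ω) * w j (Z q ω) ∂P := fun t q => by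
      rw [← integral_const_mul]; congr 1; ext ω; ring
    have e2 : ∫ ω, s i * G i ω * (s j * G j ω) ∂P' = (s i * s j) * Γ i j := by
      rw [← hcov, ← integral_const_mul]; congr 1; ext ω; ring
    simp only [e1, e2, ← Finset.mul_sum]
    simp only [mul_left_comm _ (s i * s j)]
    exact (hΓ i j).const_mul _
  · have h := dcov_conv S a _ hρ b _ hρ' ga gb hg hΓ GS f
    have e : ∫ ω, f (∑' k, G k ω ^ 2) ∂P' = ∫ ω, f (∑' k, lam k * (s k * G k ω) ^ 2) ∂P' := by
      refine integral_congr_ae ?_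
      have hall : ∀ᵐ ω ∂P', ∀ k, lam k = 0 → G k ω = 0 := by
        rw [ae_all_iff]; intro k
        by_cases hk : lam k = 0
        · filter_upwards [hGz k hk] with ω hω _ using hω
        · exact Eventually.of_forall fun ω h => absurd h hk
      filter_upwards [hall] with ω hω
      congr 1
      refine tsum_congr fun k => ?_
      by_cases hk : lam k = 0
      · simp [hk, hω k hk]
      · simp only [s]
        rw [mul_pow, inv_pow, Real.sq_sqrt (hlam k), mul_inv_cancel_left₀ hk]
    rw [← e]
    exact h
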